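/- arXiv:1709.00043 — 3 statements merged into one kernel-verified Lean document; each statement's English description precedes it below -/
import Mathlib

section
/- Every outerplanar finite simple graph with at least one edge admits a planar straight-line drawing whose edge-length ratio is strictly less than 2. -/
noncomputable section

/-- The Euclidean plane. -/
abbrev Plane : Type := EuclideanSpace ℝ (Fin 2)

/-- A planar straight-line drawing of a simple graph `G`: an injective placement of the
vertices in the plane such that no vertex image lies on the closed segment of an edge it
is not an endpoint of, and the closed segments of two distinct edges intersect exactly in
the images of their common endpoints. -/
def IsPlanarDrawing {V : Type} (G : SimpleGraph V) (ρ : V → Plane) : Prop :=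
  Function.Injective ρ ∧
  (∀ u v w : V, G.Adj u v → w ≠ u → w ≠ v → ρ w ∉ segment ℝ (ρ u) (ρ v)) ∧
  (∀ u v x y : V, G.Adj u v → G.Adj x y → s(u, v) ≠ s(x, y) →
    segment ℝ (ρ u) (ρ v) ∩ segment ℝ (ρ x) (ρ y) =
      {p : Plane | ∃ w : V, (w = u ∨ w = v) ∧ (w = x ∨ w = y) ∧ p = ρ w})

/-- The edge-length ratio of a drawing: the longest edge length divided by the shortest. -/
def edgeLengthRatio {V : Type} (G : SimpleGraph V) (ρ : V → Plane) : ℝ :=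
  sSup {d : ℝ | ∃ u v : V, G.Adj u v ∧ d = dist (ρ u) (ρ v)} /
  sInf {d : ℝ | ∃ u v : V, G.Adj u v ∧ d = dist (ρ u) (ρ v)}

/-- A graph is outerplanar if it admits a planar straight-line drawing with all vertex
images on a common circle. -/
def IsOuterplanar {V : Type} (G : SimpleGraph V) : Prop :=
  ∃ (ρ : V → Plane) (c : Plane) (r : ℝ),
    IsPlanarDrawing G ρ ∧ ∀ v : V, dist (ρ v) c = r

/-- The point sets of `e` and `f` are separated by an affine line that contains exactly the
common points. -/
def LineSep {V : Type} (x y : V → ℝ) (e f : Finset V) : Prop :=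
  ∃ a b c : ℝ, (∀ v ∈ e, v ∈ f → a * x v + b * y v + c = 0) ∧
    (∀ v ∈ e, v ∉ f → a * x v + b * y v + c < 0) ∧
    (∀ v ∈ f, v ∉ e → 0 < a * x v + b * y v + c)

theorem LineSep.symm {V : Type} {x y : V → ℝ} {e f : Finset V} (h : LineSep x y e f) :
    LineSep x y f e := by
  obtain ⟨a, b, c, h0, h1, h2⟩ := h
  refine ⟨-a, -b, -c, fun v hf he => ?_, fun v hf he => ?_, fun v he hf => ?_⟩
  · linarith [h0 v he hf]
  · linarith [h2 v hf he]
  · linarith [h1 v he hf]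

theorem LineSep.affine {V : Type} {x y x' y' : V → ℝ} {e f : Finset V} (x₀ y₀ a μ : ℝ)
    (hμ : μ ≠ 0) (hx : ∀ v, v ∈ e ∨ v ∈ f → x' v = x₀ + x v)
    (hy : ∀ v, v ∈ e ∨ v ∈ f → y' v = y₀ + a * x v + μ * y v) (h : LineSep x y e f) :
    LineSep x' y' e f := by
  obtain ⟨A, B, C, h0, h1, h2⟩ := h
  have key : ∀ v, v ∈ e ∨ v ∈ f →
      (A - B * a / μ) * x' v + B / μ * y' v + (C - A * x₀ - B * y₀ / μ + B * a * x₀ / μ) =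
        A * x v + B * y v + C := by
    intro v hv
    rw [hx v hv, hy v hv]
    field_simp
    ring
  refine ⟨A - B * a / μ, B / μ, C - A * x₀ - B * y₀ / μ + B * a * x₀ / μ,
    fun v he hf => ?_, fun v he hf => ?_, fun v hf he => ?_⟩
  · rw [key v (.inl he)]; exact h0 v he hf
  · rw [key v (.inl he)]; exact h1 v he hf
  · rw [key v (.inr hf)]; exact h2 v hf he

/-- Every vertex or edge inside `S` is line-separated from every vertex or edge inside `T`. -/
def Apart {V : Type} [DecidableEq V] (G : SimpleGraph V) (x y : V → ℝ) (S T : Finset V) : Prop :=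
  ∀ u ∈ S, ∀ v ∈ S, u = v ∨ G.Adj u v → ∀ a ∈ T, ∀ b ∈ T, a = b ∨ G.Adj a b →
    LineSep x y {u, v} {a, b}

theorem Apart.symm {V : Type} [DecidableEq V] {G : SimpleGraph V} {x y : V → ℝ}
    {S T : Finset V} (h : Apart G x y S T) : Apart G x y T S :=
  fun u hu v hv huv a ha b hb hab => (h a ha b hb hab u hu v hv huv).symm

theorem apart_of_strict {V : Type} [DecidableEq V] {G : SimpleGraph V} {x y : V → ℝ}
    {S T : Finset V} (a b c : ℝ) (hS : ∀ v ∈ S, a * x v + b * y v + c < 0)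
    (hT : ∀ v ∈ T, 0 < a * x v + b * y v + c) : Apart G x y S T := by
  intro u hu v hv _ s hs t ht _
  have hS' : ∀ w ∈ ({u, v} : Finset V), a * x w + b * y w + c < 0 := by
    intro w hw
    simp only [Finset.mem_insert, Finset.mem_singleton] at hw
    rcases hw with rfl | rfl <;> exact hS _ (by assumption)
  have hT' : ∀ w ∈ ({s, t} : Finset V), 0 < a * x w + b * y w + c := by
    intro w hw
    simp only [Finset.mem_insert, Finset.mem_singleton] at hw
    rcases hw with rfl | rfl <;> exact hT _ (by assumption)
  exact ⟨a, b, c, fun w h1 h2 => absurd (hS' w h1) (hT' w h2).le.not_gt, fun w h1 _ => hS' w h1,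
    fun w h2 _ => hT' w h2⟩

theorem apart_of_line {V : Type} [DecidableEq V] {G : SimpleGraph V} {x y : V → ℝ}
    {S T : Finset V} (w : V) (a b c : ℝ) (hw : a * x w + b * y w + c = 0)
    (hS : ∀ v ∈ S, v ≠ w → a * x v + b * y v + c < 0)
    (hT : ∀ v ∈ T, v ≠ w → 0 < a * x v + b * y v + c) : Apart G x y S T := by
  intro u hu v hv _ s hs t ht _
  have hS' : ∀ r ∈ ({u, v} : Finset V), r ≠ w → a * x r + b * y r + c < 0 := by
    intro r hr
    simp only [Finset.mem_insert, Finset.mem_singleton] at hr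
    rcases hr with rfl | rfl <;> exact hS _ (by assumption)
  have hT' : ∀ r ∈ ({s, t} : Finset V), r ≠ w → 0 < a * x r + b * y r + c := by
    intro r hr
    simp only [Finset.mem_insert, Finset.mem_singleton] at hr
    rcases hr with rfl | rfl <;> exact hT _ (by assumption)
  generalize ({u, v} : Finset V) = e at *
  generalize ({s, t} : Finset V) = f at *
  -- shifting the line slightly makes the separation strict
  have shift : ∀ (F : Finset V) (φ : V → ℝ), (∀ r ∈ F, 0 < φ r) → ∃ d > 0, ∀ r ∈ F, d < φ r := by
    intro F φ hF
    rcases F.eq_empty_or_nonempty with rfl | hne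
    · exact ⟨1, one_pos, by simp⟩
    · obtain ⟨m, hm, hmin⟩ := F.exists_min_image φ hne
      exact ⟨φ m / 2, half_pos (hF m hm), fun r hr => by linarith [hmin r hr, hF m hm]⟩
  by_cases he : w ∈ e <;> by_cases hf : w ∈ f
  · refine ⟨a, b, c, fun r h1 h2 => ?_, fun r h1 h2 => hS' r h1 ?_, fun r h1 h2 => hT' r h1 ?_⟩
    · by_contra hne
      have hrw : r ≠ w := by rintro rfl; exact hne hw
      linarith [hS' r h1 hrw, hT' r h2 hrw]
    · rintro rfl; exact h2 hf
    · rintro rfl; exact h2 he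
  · have hfw : ∀ r ∈ f, r ≠ w := by rintro r hr rfl; exact hf hr
    obtain ⟨d, hd, hd'⟩ := shift f (fun r => a * x r + b * y r + c) fun r hr => hT' r hr (hfw r hr)
    have hneg : ∀ r ∈ e, a * x r + b * y r + c ≤ 0 := fun r hr => by
      by_cases hrw : r = w
      · rw [hrw, hw]
      · exact (hS' r hr hrw).le
    refine ⟨a, b, c - d, fun r h1 h2 => ?_, fun r h1 _ => ?_, fun r h1 _ => ?_⟩
    · linarith [hneg r h1, hT' r h2 (hfw r h2)]
    · linarith [hneg r h1]
    · linarith [hd' r h1]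
  · have hew : ∀ r ∈ e, r ≠ w := by rintro r hr rfl; exact he hr
    obtain ⟨d, hd, hd'⟩ := shift e (fun r => -(a * x r + b * y r + c))
      fun r hr => by linarith [hS' r hr (hew r hr)]
    have hpos : ∀ r ∈ f, 0 ≤ a * x r + b * y r + c := fun r hr => by
      by_cases hrw : r = w
      · rw [hrw, hw]
      · exact (hT' r hr hrw).le
    refine ⟨a, b, c + d, fun r h1 h2 => ?_, fun r h1 _ => ?_, fun r h1 _ => ?_⟩
    · linarith [hpos r h2, hS' r h1 (hew r h1)]
    · linarith [hd' r h1]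
    · linarith [hpos r h1]
  · have hew : ∀ r ∈ e, r ≠ w := by rintro r hr rfl; exact he hr
    have hfw : ∀ r ∈ f, r ≠ w := by rintro r hr rfl; exact hf hr
    exact ⟨a, b, c, fun r h1 h2 => by linarith [hS' r h1 (hew r h1), hT' r h2 (hfw r h2)],
      fun r h1 _ => hS' r h1 (hew r h1), fun r h1 _ => hT' r h1 (hfw r h1)⟩

theorem apart_pair {V : Type} [DecidableEq V] {G : SimpleGraph V} {x y : V → ℝ}
    {p q : V} (h : x p < x q) : Apart G x y {p, q} {p, q} := by
  have hne : p ≠ q := by rintro rfl; exact lt_irrefl _ h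
  have trivial_sep : ∀ e : Finset V, LineSep x y e e := fun e =>
    ⟨0, 0, 0, fun v _ _ => by simp, fun v h1 h2 => absurd h1 h2, fun v h1 h2 => absurd h1 h2⟩
  have h1 : LineSep x y {p} {q} :=
    ⟨1, 0, -(x p + x q) / 2, by simp [hne], by simp [hne]; linarith, by simp [hne.symm]; linarith⟩
  have h2 : LineSep x y {p} {p, q} :=
    ⟨1, 0, -(x p), by simp, by simp, by simp [hne.symm]; linarith⟩
  have h3 : LineSep x y {q} {p, q} :=
    ⟨-1, 0, x q, by simp, by simp, by simp [hne]; linarith⟩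
  have hsub : ∀ u ∈ ({p, q} : Finset V), ∀ v ∈ ({p, q} : Finset V),
      ({u, v} : Finset V) = {p} ∨ ({u, v} : Finset V) = {q} ∨ ({u, v} : Finset V) = {p, q} := by
    intro u hu v hv
    simp only [Finset.mem_insert, Finset.mem_singleton] at hu hv
    rcases hu with hu | hu <;> rcases hv with hv | hv <;> rw [hu, hv]
    · simp
    · simp
    · simp [Finset.pair_comm q p]
    · simp
  intro u hu v hv _ a ha b hb _
  rcases hsub u hu v hv with h | h | h <;> rcases hsub a ha b hb with h' | h' | h' <;>
    rw [h, h']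
  exacts [trivial_sep _, h1, h2, h1.symm, trivial_sep _, h3, h2.symm, h3.symm, trivial_sep _]

theorem apart_of_cover {V : Type} [DecidableEq V] {G : SimpleGraph V} {x y : V → ℝ}
    {S : Finset V} (pieces : List (Finset V)) (hself : ∀ T ∈ pieces, Apart G x y T T)
    (hpair : pieces.Pairwise (Apart G x y))
    (hcover : ∀ u ∈ S, ∀ v ∈ S, u = v ∨ G.Adj u v → ∃ T ∈ pieces, u ∈ T ∧ v ∈ T) :
    Apart G x y S S := by
  have : Std.Symm (Apart G x y) := ⟨fun _ _ h => h.symm⟩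
  intro u hu v hv huv a ha b hb hab
  obtain ⟨T, hT, huT, hvT⟩ := hcover u hu v hv huv
  obtain ⟨T', hT', haT, hbT⟩ := hcover a ha b hb hab
  exact List.Pairwise.forall_of_forall hself hpair hT hT'
    u huT v hvT huv a haT b hbT hab

/-- Leading-order data of a nearly flat drawing: at scale `t → 0`, vertex `v` is placed at
`(x v - t ^ 2 * z v, t * y v)`. -/
structure Layout (V : Type) where
  x : V → ℝ
  y : V → ℝ
  z : V → ℝ

/-- From `u` to `v` the layout makes either a step whose length is at least `1`, or a double
step whose length is, to leading order, less than `2`. -/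
def Layout.Step {V : Type} (L : Layout V) (u v : V) : Prop :=
  (L.x v - L.x u = 1 ∧ 2 * (L.z v - L.z u) ≤ (L.y v - L.y u) ^ 2) ∨
  (L.x v - L.x u = 2 ∧ (L.y v - L.y u) ^ 2 < 4 * (L.z v - L.z u))

/-- Adjacent vertices of `S` are joined by a step of the layout, and the edges inside `S` do
not cross. -/
def Layout.Draws {V : Type} [DecidableEq V] (L : Layout V) (G : SimpleGraph V)
    (S : Finset V) : Prop :=
  (∀ u ∈ S, ∀ v ∈ S, G.Adj u v → L.Step u v ∨ L.Step v u) ∧ Apart G L.x L.y S S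

theorem Layout.Draws.affine {V : Type} [DecidableEq V] {L L' : Layout V} {G : SimpleGraph V}
    {S : Finset V} (x₀ y₀ z₀ a μ : ℝ) (hμ : μ ≠ 0) (hx : ∀ v ∈ S, L'.x v = x₀ + L.x v)
    (hy : ∀ v ∈ S, L'.y v = y₀ + a * L.x v + μ * L.y v)
    (hz : ∀ v ∈ S, L'.z v = z₀ + a ^ 2 / 2 * L.x v + a * μ * L.y v + μ ^ 2 * L.z v)
    (h : L.Draws G S) : L'.Draws G S := by
  have hμ2 : 0 < μ ^ 2 := by positivity
  have step : ∀ u ∈ S, ∀ v ∈ S, L.Step u v → L'.Step u v := by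
    intro u hu v hv huv
    rcases huv with ⟨h1, h2⟩ | ⟨h1, h2⟩
    · refine .inl ⟨by rw [hx u hu, hx v hv]; linarith, ?_⟩
      rw [hy u hu, hy v hv, hz u hu, hz v hv]
      have hxv : L.x v = L.x u + 1 := by linarith
      rw [hxv]
      nlinarith [mul_le_mul_of_nonneg_left h2 hμ2.le]
    · refine .inr ⟨by rw [hx u hu, hx v hv]; linarith, ?_⟩
      rw [hy u hu, hy v hv, hz u hu, hz v hv]
      have hxv : L.x v = L.x u + 2 := by linarith
      rw [hxv]
      nlinarith [mul_lt_mul_of_pos_left h2 hμ2]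
  refine ⟨fun u hu v hv huv => (h.1 u hu v hv huv).imp (step u hu v hv) (step v hv u hu), ?_⟩
  intro u hu v hv huv s hs t ht hst
  have hmem : ∀ w, w ∈ ({u, v} : Finset V) ∨ w ∈ ({s, t} : Finset V) → w ∈ S := by
    intro w hw
    simp only [Finset.mem_insert, Finset.mem_singleton] at hw
    rcases hw with (rfl | rfl) | (rfl | rfl) <;> assumption
  exact (h.2 u hu v hv huv s hs t ht hst).affine x₀ y₀ a μ hμ (fun w hw => hx w (hmem w hw))
    fun w hw => hy w (hmem w hw)

theorem Layout.Draws.congr {V : Type} [DecidableEq V] {L L' : Layout V} {G : SimpleGraph V}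
    {S : Finset V} (h : L.Draws G S)
    (hL : ∀ v ∈ S, L'.x v = L.x v ∧ L'.y v = L.y v ∧ L'.z v = L.z v) : L'.Draws G S := by
  refine h.affine 0 0 0 0 1 one_ne_zero (fun v hv => ?_) (fun v hv => ?_) fun v hv => ?_
  · rw [(hL v hv).1]; ring
  · rw [(hL v hv).2.1]; ring
  · rw [(hL v hv).2.2]; ring

/-- The part of the graph inside `S` can be drawn with `p` at the origin and `q` one step to
the right, all other vertices lying in a wedge above `p` and `q`, for every admissible slack
`E` of the length of `p q` and every precision `ε` of the wedge. -/
def WedgeDrawable {V : Type} [DecidableEq V] (G : SimpleGraph V) (p q : V) (S : Finset V) : Prop :=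
  ∀ E ε : ℝ, 0 ≤ E → E < 1 / 2 → 0 < ε → ε ≤ 1 / 4 → ∃ L : Layout V,
    (L.x p = 0 ∧ L.y p = 0 ∧ L.z p = 0) ∧ (L.x q = 1 ∧ L.y q = 0 ∧ L.z q = -(E / 2)) ∧
    (∀ v ∈ S, v ≠ p → v ≠ q → 1 ≤ L.x v ∧ 0 < L.y v ∧ (1 / 2 - ε) * (L.x v - 1) < L.y v ∧
      L.y v < (1 / 2 + ε) * L.x v) ∧
    L.Draws G S

theorem WedgeDrawable.place {V : Type} [DecidableEq V] {G : SimpleGraph V} {p q : V}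
    {S : Finset V} (h : WedgeDrawable G p q S) (x₀ y₀ z₀ a μ E ε : ℝ) (hμ : μ ≠ 0) (hE : 0 ≤ E)
    (hE' : E < 1 / 2) (hε : 0 < ε) (hε' : ε ≤ 1 / 4) : ∃ L : Layout V,
    (L.x p = x₀ ∧ L.y p = y₀ ∧ L.z p = z₀) ∧
    (L.x q = x₀ + 1 ∧ L.y q = y₀ + a ∧ L.z q = z₀ + a ^ 2 / 2 - μ ^ 2 * E / 2) ∧
    (∀ v ∈ S, v ≠ p → v ≠ q → ∃ s t : ℝ, L.x v = x₀ + s ∧ L.y v = y₀ + a * s + μ * t ∧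
      1 ≤ s ∧ 0 < t ∧ (1 / 2 - ε) * (s - 1) < t ∧ t < (1 / 2 + ε) * s) ∧
    L.Draws G S := by
  obtain ⟨L, ⟨hp1, hp2, hp3⟩, ⟨hq1, hq2, hq3⟩, hw, hd⟩ := h E ε hE hE' hε hε'
  refine ⟨⟨fun v => x₀ + L.x v, fun v => y₀ + a * L.x v + μ * L.y v,
    fun v => z₀ + a ^ 2 / 2 * L.x v + a * μ * L.y v + μ ^ 2 * L.z v⟩, ?_, ?_, ?_, ?_⟩
  · simp [hp1, hp2, hp3]
  · simp only [hq1, hq2, hq3]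
    exact ⟨trivial, by ring, by ring⟩
  · intro v hv h1 h2
    exact ⟨L.x v, L.y v, rfl, rfl, hw v hv h1 h2⟩
  · exact hd.affine x₀ y₀ z₀ a μ hμ (fun _ _ => rfl) (fun _ _ => rfl) fun _ _ => rfl

/-- The vertex `k` splits the part of `G` inside `S` into the parts inside `A` (containing `u`)
and inside `B` (containing `v`), apart from a possible edge `u v`. -/
structure EarSplit {V : Type} [DecidableEq V] (G : SimpleGraph V) (u v k : V)
    (S A B : Finset V) : Prop where
  union_eq : S = A ∪ B
  inter_eq : ∀ w, w ∈ A → w ∈ B → w = k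
  left_mem : u ∈ A
  right_mem : v ∈ B
  mem_left : k ∈ A
  mem_right : k ∈ B
  left_ne : u ≠ k
  right_ne : v ≠ k
  edge : ∀ a ∈ S, ∀ b ∈ S, G.Adj a b →
    (a ∈ A ∧ b ∈ A) ∨ (a ∈ B ∧ b ∈ B) ∨ (a = u ∧ b = v) ∨ (a = v ∧ b = u)

theorem EarSplit.symm {V : Type} [DecidableEq V] {G : SimpleGraph V} {u v k : V}
    {S A B : Finset V} (h : EarSplit G u v k S A B) : EarSplit G v u k S B A where
  union_eq := by rw [h.union_eq, Finset.union_comm]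
  inter_eq w h1 h2 := h.inter_eq w h2 h1
  left_mem := h.right_mem
  right_mem := h.left_mem
  mem_left := h.mem_right
  mem_right := h.mem_left
  left_ne := h.right_ne
  right_ne := h.left_ne
  edge a ha b hb hab := by
    rcases h.edge a ha b hb hab with h | h | h | h
    · exact .inr (.inl h)
    · exact .inl h
    · exact .inr (.inr (.inr h))
    · exact .inr (.inr (.inl h))

theorem Layout.Draws.of_cover {V : Type} [DecidableEq V] {L : Layout V} {G : SimpleGraph V}
    {S : Finset V} (pieces : List (Finset V)) (hself : ∀ T ∈ pieces, L.Draws G T)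
    (hpair : pieces.Pairwise (Apart G L.x L.y))
    (hcover : ∀ u ∈ S, ∀ v ∈ S, u = v ∨ G.Adj u v → ∃ T ∈ pieces, u ∈ T ∧ v ∈ T) :
    L.Draws G S := by
  refine ⟨fun u hu v hv huv => ?_,
    apart_of_cover pieces (fun T hT => (hself T hT).2) hpair hcover⟩
  obtain ⟨T, hT, huT, hvT⟩ := hcover u hu v hv (.inr huv)
  exact (hself T hT).1 u huT v hvT huv

theorem Layout.draws_pair {V : Type} [DecidableEq V] {L : Layout V} {G : SimpleGraph V}
    {p q : V} (h : L.Step p q) : L.Draws G {p, q} := by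
  refine ⟨fun u hu v hv huv => ?_, apart_pair ?_⟩
  · simp only [Finset.mem_insert, Finset.mem_singleton] at hu hv
    rcases hu with hu | hu <;> rcases hv with hv | hv <;> rw [hu, hv] at huv ⊢
    · exact (huv.ne rfl).elim
    · exact .inl h
    · exact .inr h
    · exact (huv.ne rfl).elim
  · rcases h with h | h <;> linarith [h.1]

theorem wedgeDrawable_pair {V : Type} [DecidableEq V] {G : SimpleGraph V} {p q : V}
    (hpq : p ≠ q) : WedgeDrawable G p q {p, q} := by
  intro E ε hE _ _ _
  refine ⟨⟨fun v => if v = q then 1 else 0, fun _ => 0, fun v => if v = q then -(E / 2) else 0⟩,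
    by simp [hpq], by simp, ?_, Layout.draws_pair (.inl ?_)⟩
  · intro v hv h1 h2
    simp [h1, h2] at hv
  · simp [hpq]; linarith

theorem WedgeDrawable.place_right {V : Type} [DecidableEq V] {G : SimpleGraph V} {q k : V}
    {B : Finset V} (h : WedgeDrawable G q k B) {E ε τ : ℝ} (hE : 0 ≤ E) (hε : 0 < ε)
    (hε' : ε ≤ 1 / 4) (hτ : 0 < τ) (hτE : 2 * τ ^ 2 ≤ 1 / 2 - E) :
    ∃ L : Layout V, (L.x q = 1 ∧ L.y q = 0 ∧ L.z q = -(E / 2)) ∧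
      (L.x k = 2 ∧ L.y k = 1 ∧ L.z k = 1 / 4 + τ ^ 2) ∧
      (∀ v ∈ B, v ≠ q → v ≠ k → 2 ≤ L.x v ∧ (1 / 2 - 3 * ε / 4) * (L.x v - 1) < L.y v ∧
        L.y v < 1 + (1 / 2 - ε / 4) * (L.x v - 2)) ∧ L.Draws G B := by
  have h1 : (1 : ℝ) ≤ (1 + ε) ^ 2 := by nlinarith
  have h1' : (0 : ℝ) < (1 + ε) ^ 2 := by positivity
  obtain ⟨L, ⟨hq1, hq2, hq3⟩, ⟨hk1, hk2, hk3⟩, hw, hd⟩ := h.place 1 0 (-(E / 2)) 1 (-(1 + ε))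
    ((1 / 2 - E - 2 * τ ^ 2) / (1 + ε) ^ 2) (ε / 5) (by linarith)
    (div_nonneg (by linarith) h1'.le)
    (by rw [div_lt_iff₀ h1']; nlinarith [pow_pos hτ 2]) (by linarith) (by linarith)
  refine ⟨L, ⟨hq1, hq2, hq3⟩, ⟨by rw [hk1]; norm_num, by rw [hk2]; norm_num, ?_⟩, ?_, hd⟩
  · rw [hk3, neg_sq, mul_div_cancel₀ _ h1'.ne']; ring
  · intro v hv h2 h3
    obtain ⟨s, t, hx, hy, hs, ht, hl, hu⟩ := hw v hv h2 h3
    rw [hx, hy]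
    have e1 := mul_lt_mul_of_pos_left hl (show 0 < 1 + ε by linarith)
    have e2 := mul_lt_mul_of_pos_left hu (show 0 < 1 + ε by linarith)
    have e3 : (0 : ℝ) ≤ (s - 1) * (ε * (1 / 4 - ε)) :=
      mul_nonneg (by linarith) (mul_nonneg hε.le (by linarith))
    have e4 : (0 : ℝ) ≤ ε * (1 / 4 - ε) := mul_nonneg hε.le (by linarith)
    refine ⟨by linarith, by nlinarith, by nlinarith⟩

theorem WedgeDrawable.place_upper_left {V : Type} [DecidableEq V] {G : SimpleGraph V} {p m : V}
    {A : Finset V} (h : WedgeDrawable G p m A) {τ : ℝ} (hτ : 0 < τ) :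
    ∃ L : Layout V, (L.x p = 0 ∧ L.y p = 0 ∧ L.z p = 0) ∧
      (L.x m = 1 ∧ L.y m = 1 / 2 + τ ∧ L.z m = (1 / 2 + τ) ^ 2 / 2) ∧
      (∀ v ∈ A, v ≠ p → v ≠ m → 1 ≤ L.x v ∧ (1 / 2 + τ) * L.x v < L.y v ∧
        (1 / 2 + τ) * L.x v + τ / 4 * (L.x v - 1) < L.y v ∧
        L.y v < (1 / 2 + τ) * L.x v + 3 / 4 * τ * L.x v) ∧ L.Draws G A := by
  obtain ⟨L, ⟨hq1, hq2, hq3⟩, ⟨hk1, hk2, hk3⟩, hw, hd⟩ := h.place 0 0 0 (1 / 2 + τ) τ 0 (1 / 4)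
    hτ.ne' le_rfl (by norm_num) (by norm_num) le_rfl
  refine ⟨L, ⟨hq1, hq2, hq3⟩, ⟨by rw [hk1]; norm_num, by rw [hk2]; ring, by rw [hk3]; ring⟩, ?_,
    hd⟩
  intro v hv h2 h3
  obtain ⟨s, t, hx, hy, hs, ht, hl, hu⟩ := hw v hv h2 h3
  rw [hx, hy]
  have e1 := mul_lt_mul_of_pos_left hl hτ
  have e2 := mul_lt_mul_of_pos_left hu hτ
  have e3 := mul_pos hτ ht
  refine ⟨by linarith, by nlinarith, by nlinarith, by nlinarith⟩

theorem WedgeDrawable.place_upper_right {V : Type} [DecidableEq V] {G : SimpleGraph V} {m k : V}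
    {C : Finset V} (h : WedgeDrawable G m k C) {τ : ℝ} (hτ : 0 < τ) :
    ∃ L : Layout V, (L.x m = 1 ∧ L.y m = 1 / 2 + τ ∧ L.z m = (1 / 2 + τ) ^ 2 / 2) ∧
      (L.x k = 2 ∧ L.y k = 1 ∧ L.z k = 1 / 4 + τ ^ 2) ∧
      (∀ v ∈ C, v ≠ m → v ≠ k → 2 ≤ L.x v ∧ 1 + (1 / 2 - τ) * (L.x v - 2) < L.y v ∧
        1 + (1 / 2 - τ) * (L.x v - 2) + τ / 4 * (L.x v - 2) < L.y v ∧
        L.y v < 1 / 2 + τ + (1 / 2 - τ) * (L.x v - 1) + 3 / 4 * τ * (L.x v - 1)) ∧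
      L.Draws G C := by
  obtain ⟨L, ⟨hq1, hq2, hq3⟩, ⟨hk1, hk2, hk3⟩, hw, hd⟩ := h.place 1 (1 / 2 + τ)
    ((1 / 2 + τ) ^ 2 / 2) (1 / 2 - τ) τ 0 (1 / 4) hτ.ne' le_rfl (by norm_num) (by norm_num) le_rfl
  refine ⟨L, ⟨hq1, hq2, hq3⟩, ⟨by rw [hk1]; norm_num, by rw [hk2]; ring, by rw [hk3]; ring⟩, ?_,
    hd⟩
  intro v hv h2 h3
  obtain ⟨s, t, hx, hy, hs, ht, hl, hu⟩ := hw v hv h2 h3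
  rw [hx, hy]
  have e1 := mul_lt_mul_of_pos_left hl hτ
  have e2 := mul_lt_mul_of_pos_left hu hτ
  have e3 := mul_pos hτ ht
  refine ⟨by linarith, by nlinarith, by nlinarith, by nlinarith⟩

theorem pairwise_apart_base {V : Type} [DecidableEq V] {G : SimpleGraph V} {L : Layout V}
    {p q k : V} {B : Finset V} {ε : ℝ} (hε : 0 < ε) (hε' : ε ≤ 1 / 4)
    (hp : L.x p = 0 ∧ L.y p = 0) (hq : L.x q = 1 ∧ L.y q = 0) (hk : L.x k = 2 ∧ L.y k = 1)
    (hB : ∀ v ∈ B, v ≠ q → v ≠ k → 2 ≤ L.x v ∧ (1 / 2 - 3 * ε / 4) * (L.x v - 1) < L.y v ∧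
      L.y v < 1 + (1 / 2 - ε / 4) * (L.x v - 2)) :
    List.Pairwise (Apart G L.x L.y) [{p, q}, {p, k}, B] := by
  have hB' : ∀ v ∈ B, v = q ∨ v = k ∨ (v ≠ q ∧ v ≠ k) := fun v _ => by tauto
  simp only [List.pairwise_cons, List.mem_cons, List.not_mem_nil, or_false, forall_eq_or_imp,
    forall_eq, IsEmpty.forall_iff, implies_true, List.Pairwise.nil, and_true]
  refine ⟨⟨apart_of_line p (-1 / 4) 1 0 ?_ ?_ ?_, apart_of_line q 1 1 (-1) ?_ ?_ ?_⟩,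
    (apart_of_line k (-(1 / 2 + ε / 4)) 1 (ε / 2) ?_ ?_ ?_).symm⟩
  · rw [hp.1, hp.2]; norm_num
  · simp only [Finset.mem_insert, Finset.mem_singleton]
    rintro v (rfl | rfl) hv
    · exact (hv rfl).elim
    · rw [hq.1, hq.2]; norm_num
  · simp only [Finset.mem_insert, Finset.mem_singleton]
    rintro v (rfl | rfl) hv
    · exact (hv rfl).elim
    · rw [hk.1, hk.2]; norm_num
  · rw [hq.1, hq.2]; norm_num
  · simp only [Finset.mem_insert, Finset.mem_singleton]
    rintro v (rfl | rfl) hv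
    · rw [hp.1, hp.2]; norm_num
    · exact (hv rfl).elim
  · intro v hv hvq
    rcases hB' v hv with rfl | rfl | ⟨h1, h2⟩
    · exact (hvq rfl).elim
    · rw [hk.1, hk.2]; norm_num
    · obtain ⟨e1, e2, e3⟩ := hB v hv h1 h2
      nlinarith
  · rw [hk.1, hk.2]; ring
  · intro v hv hvk
    rcases hB' v hv with rfl | rfl | ⟨h1, h2⟩
    · rw [hq.1, hq.2]; linarith
    · exact (hvk rfl).elim
    · obtain ⟨e1, e2, e3⟩ := hB v hv h1 h2
      nlinarith
  · simp only [Finset.mem_insert, Finset.mem_singleton]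
    rintro v (rfl | rfl) hv
    · rw [hp.1, hp.2]; linarith
    · exact (hv rfl).elim

theorem wedgeDrawable_of_ear {V : Type} [DecidableEq V] {G : SimpleGraph V} {p q k : V}
    {S B : Finset V} (hS : EarSplit G p q k S {p, k} B) (hB : WedgeDrawable G q k B) :
    WedgeDrawable G p q S := by
  intro E ε hE hE' hε hε'
  have hpB : p ∉ B := fun h => hS.left_ne (hS.inter_eq p hS.left_mem h)
  obtain ⟨τ, hτ, hτE⟩ : ∃ τ : ℝ, 0 < τ ∧ 2 * τ ^ 2 ≤ 1 / 2 - E :=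
    ⟨(1 / 2 - E) / 2, by linarith, by nlinarith⟩
  obtain ⟨M, hq, hk, hw, hd⟩ := hB.place_right hE hε hε' hτ hτE
  set L : Layout V := ⟨fun v => if v ∈ B then M.x v else 0, fun v => if v ∈ B then M.y v else 0,
    fun v => if v ∈ B then M.z v else 0⟩ with hL
  have hLB : ∀ v ∈ B, L.x v = M.x v ∧ L.y v = M.y v ∧ L.z v = M.z v := fun v hv => by
    simp [hL, hv]
  have hp : L.x p = 0 ∧ L.y p = 0 ∧ L.z p = 0 := by simp [hL, hpB]
  obtain ⟨hx, hy, hz⟩ := hLB q hS.right_mem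
  rw [← hx, ← hy, ← hz] at hq
  obtain ⟨hx, hy, hz⟩ := hLB k hS.mem_right
  rw [← hx, ← hy, ← hz] at hk
  have hw' : ∀ v ∈ B, v ≠ q → v ≠ k → 2 ≤ L.x v ∧
      (1 / 2 - 3 * ε / 4) * (L.x v - 1) < L.y v ∧
      L.y v < 1 + (1 / 2 - ε / 4) * (L.x v - 2) := by
    intro v hv h1 h2
    obtain ⟨hx, hy, hz⟩ := hLB v hv
    rw [hx, hy]
    exact hw v hv h1 h2
  refine ⟨L, hp, hq, ?_, ?_⟩
  · intro v hv hvp hvq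
    by_cases hvk : v = k
    · rw [hvk, hk.1, hk.2.1]
      refine ⟨by norm_num, by norm_num, by linarith, by linarith⟩
    · have hvB : v ∈ B := by
        rw [hS.union_eq] at hv
        simpa [hvp, hvk] using hv
      obtain ⟨e1, e2, e3⟩ := hw' v hvB hvq hvk
      refine ⟨by linarith, by nlinarith, by nlinarith, by nlinarith⟩
  · refine Layout.Draws.of_cover [{p, q}, {p, k}, B] ?_
      (pairwise_apart_base hε hε' ⟨hp.1, hp.2.1⟩ ⟨hq.1, hq.2.1⟩ ⟨hk.1, hk.2.1⟩ hw') ?_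
    · simp only [List.mem_cons, List.not_mem_nil, or_false, forall_eq_or_imp, forall_eq]
      refine ⟨Layout.draws_pair (.inl ?_), Layout.draws_pair (.inr ?_), hd.congr hLB⟩
      · rw [hp.1, hp.2.1, hp.2.2, hq.1, hq.2.1, hq.2.2]
        exact ⟨by norm_num, by linarith⟩
      · rw [hp.1, hp.2.1, hp.2.2, hk.1, hk.2.1, hk.2.2]
        exact ⟨by norm_num, by nlinarith⟩
    · rintro u hu v hv (rfl | huv)
      · rw [hS.union_eq, Finset.mem_union] at hu
        rcases hu with hu | hu
        · exact ⟨_, by simp, hu, hu⟩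
        · exact ⟨B, by simp, hu, hu⟩
      · rcases hS.edge u hu v hv huv with ⟨h1, h2⟩ | ⟨h1, h2⟩ | ⟨h1, h2⟩ | ⟨h1, h2⟩
        · exact ⟨{p, k}, by simp, h1, h2⟩
        · exact ⟨B, by simp, h1, h2⟩
        · exact ⟨{p, q}, by simp, by simp [h1], by simp [h2]⟩
        · exact ⟨{p, q}, by simp, by simp [h1], by simp [h2]⟩

theorem pairwise_apart_upper {V : Type} [DecidableEq V] {G : SimpleGraph V} {L : Layout V}
    {p q k m : V} {A C B : Finset V} {ε τ : ℝ} (hε : 0 < ε) (hε' : ε ≤ 1 / 4) (hτ : 0 < τ)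
    (hτε : τ ≤ ε / 4)
    (hp : L.x p = 0 ∧ L.y p = 0) (hq : L.x q = 1 ∧ L.y q = 0) (hk : L.x k = 2 ∧ L.y k = 1)
    (hm : L.x m = 1 ∧ L.y m = 1 / 2 + τ)
    (hA : ∀ v ∈ A, v ≠ p → v ≠ m → 1 ≤ L.x v ∧ (1 / 2 + τ) * L.x v < L.y v ∧
        (1 / 2 + τ) * L.x v + τ / 4 * (L.x v - 1) < L.y v ∧
        L.y v < (1 / 2 + τ) * L.x v + 3 / 4 * τ * L.x v)
    (hC : ∀ v ∈ C, v ≠ m → v ≠ k → 2 ≤ L.x v ∧ 1 + (1 / 2 - τ) * (L.x v - 2) < L.y v ∧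
        1 + (1 / 2 - τ) * (L.x v - 2) + τ / 4 * (L.x v - 2) < L.y v ∧
        L.y v < 1 / 2 + τ + (1 / 2 - τ) * (L.x v - 1) + 3 / 4 * τ * (L.x v - 1))
    (hB : ∀ v ∈ B, v ≠ q → v ≠ k → 2 ≤ L.x v ∧ (1 / 2 - 3 * ε / 4) * (L.x v - 1) < L.y v ∧
      L.y v < 1 + (1 / 2 - ε / 4) * (L.x v - 2)) :
    List.Pairwise (Apart G L.x L.y) [A, C, {p, q}, {p, k}, B] := by
  have hA' : ∀ v ∈ A, v = p ∨ v = m ∨ (v ≠ p ∧ v ≠ m) := fun v _ => by tauto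
  have hB' : ∀ v ∈ B, v = q ∨ v = k ∨ (v ≠ q ∧ v ≠ k) := fun v _ => by tauto
  have hC' : ∀ v ∈ C, v = m ∨ v = k ∨ (v ≠ m ∧ v ≠ k) := fun v _ => by tauto
  have hbase := pairwise_apart_base (G := G) hε hε' hp hq hk hB
  rw [List.pairwise_cons, List.pairwise_cons]
  refine ⟨?_, ?_, hbase⟩
  · simp only [List.mem_cons, List.not_mem_nil, or_false, forall_eq_or_imp, forall_eq]
    refine ⟨(apart_of_line m (-(1 / 2 + 5 * τ / 4)) 1 (τ / 4) ?_ ?_ ?_).symm,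
      (apart_of_line p (-1 / 4) 1 0 ?_ ?_ ?_).symm,
      (apart_of_line p (-(1 / 2 + τ / 2)) 1 0 ?_ ?_ ?_).symm,
      (apart_of_strict (-(1 / 2 + τ / 2)) 1 (τ / 2) ?_ ?_).symm⟩
    · rw [hm.1, hm.2]; ring
    · intro v hv hvm
      rcases hC' v hv with rfl | rfl | ⟨h1, h2⟩
      · exact (hvm rfl).elim
      · rw [hk.1, hk.2]; linarith
      · obtain ⟨e1, e2, e3, e4⟩ := hC v hv h1 h2
        nlinarith
    · intro v hv hvm
      rcases hA' v hv with rfl | rfl | ⟨h1, h2⟩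
      · rw [hp.1, hp.2]; linarith
      · exact (hvm rfl).elim
      · obtain ⟨e1, e2, e3, e4⟩ := hA v hv h1 h2
        nlinarith
    · rw [hp.1, hp.2]; ring
    · simp only [Finset.mem_insert, Finset.mem_singleton]
      rintro v (rfl | rfl) hv
      · exact (hv rfl).elim
      · rw [hq.1, hq.2]; norm_num
    · intro v hv hvm
      rcases hA' v hv with rfl | rfl | ⟨h1, h2⟩
      · exact (hvm rfl).elim
      · rw [hm.1, hm.2]; linarith
      · obtain ⟨e1, e2, e3, e4⟩ := hA v hv h1 h2
        nlinarith
    · rw [hp.1, hp.2]; ring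
    · simp only [Finset.mem_insert, Finset.mem_singleton]
      rintro v (rfl | rfl) hv
      · exact (hv rfl).elim
      · rw [hk.1, hk.2]; linarith
    · intro v hv hvm
      rcases hA' v hv with rfl | rfl | ⟨h1, h2⟩
      · exact (hvm rfl).elim
      · rw [hm.1, hm.2]; linarith
      · obtain ⟨e1, e2, e3, e4⟩ := hA v hv h1 h2
        nlinarith
    · intro v hv
      rcases hB' v hv with rfl | rfl | ⟨h1, h2⟩
      · rw [hq.1, hq.2]; linarith
      · rw [hk.1, hk.2]; linarith
      · obtain ⟨e1, e2, e3⟩ := hB v hv h1 h2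
        nlinarith
    · intro v hv
      rcases hA' v hv with rfl | rfl | ⟨h1, h2⟩
      · rw [hp.1, hp.2]; linarith
      · rw [hm.1, hm.2]; linarith
      · obtain ⟨e1, e2, e3, e4⟩ := hA v hv h1 h2
        nlinarith
  · have hkC : ∀ v ∈ C, v ≠ k → 0 < -(1 / 2 - 3 * τ / 4) * L.x v + 1 * L.y v - 3 * τ / 2 := by
      intro v hv hvk
      rcases hC' v hv with rfl | rfl | ⟨h1, h2⟩
      · rw [hm.1, hm.2]; linarith
      · exact (hvk rfl).elim
      · obtain ⟨e1, e2, e3, e4⟩ := hC v hv h1 h2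
        nlinarith
    simp only [List.mem_cons, List.not_mem_nil, or_false, forall_eq_or_imp, forall_eq]
    refine ⟨(apart_of_strict 0 1 (-1 / 4) ?_ ?_).symm,
      (apart_of_line k (-(1 / 2 - 3 * τ / 4)) 1 (-(3 * τ / 2)) ?_ ?_ ?_).symm,
      (apart_of_line k (-(1 / 2 - 3 * τ / 4)) 1 (-(3 * τ / 2)) ?_ ?_ ?_).symm⟩
    · simp only [Finset.mem_insert, Finset.mem_singleton]
      rintro v (rfl | rfl)
      · rw [hp.1, hp.2]; norm_num
      · rw [hq.1, hq.2]; norm_num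
    · intro v hv
      rcases hC' v hv with rfl | rfl | ⟨h1, h2⟩
      · rw [hm.1, hm.2]; linarith
      · rw [hk.1, hk.2]; norm_num
      · obtain ⟨e1, e2, e3, e4⟩ := hC v hv h1 h2
        nlinarith
    · rw [hk.1, hk.2]; ring
    · simp only [Finset.mem_insert, Finset.mem_singleton]
      rintro v (rfl | rfl) hv
      · rw [hp.1, hp.2]; linarith
      · exact (hv rfl).elim
    · intro v hv hvk; linarith [hkC v hv hvk]
    · rw [hk.1, hk.2]; ring
    · intro v hv hvk
      rcases hB' v hv with rfl | rfl | ⟨h1, h2⟩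
      · rw [hq.1, hq.2]; linarith
      · exact (hvk rfl).elim
      · obtain ⟨e1, e2, e3⟩ := hB v hv h1 h2
        nlinarith
    · intro v hv hvk; linarith [hkC v hv hvk]

theorem wedgeDrawable_of_two_ears {V : Type} [DecidableEq V] {G : SimpleGraph V} {p q k m : V}
    {S S₁ A C B : Finset V} (hS : EarSplit G p q k S S₁ B) (hS₁ : EarSplit G p k m S₁ A C)
    (hA : WedgeDrawable G p m A) (hC : WedgeDrawable G m k C) (hB : WedgeDrawable G q k B) :
    WedgeDrawable G p q S := by
  intro E ε hE hE' hε hε'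
  have hpB : p ∉ B := fun h => hS.left_ne (hS.inter_eq p hS.left_mem h)
  have hkA : k ∉ A := fun h => hS₁.right_ne (hS₁.inter_eq k h hS₁.right_mem)
  have hAS : ∀ v ∈ A, v ∈ S₁ := fun v hv => by
    rw [hS₁.union_eq]; exact Finset.mem_union_left _ hv
  have hCS : ∀ v ∈ C, v ∈ S₁ := fun v hv => by
    rw [hS₁.union_eq]; exact Finset.mem_union_right _ hv
  have hAB : ∀ v ∈ A, v ∉ B := fun v hv hvB => by
    rw [hS.inter_eq v (hAS v hv) hvB] at hv; exact hkA hv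
  have hCB : ∀ v ∈ C, v ∈ B → v = k := fun v hv hvB => hS.inter_eq v (hCS v hv) hvB
  obtain ⟨τ, hτ, hτε, hτE⟩ : ∃ τ : ℝ, 0 < τ ∧ τ ≤ ε / 4 ∧ 2 * τ ^ 2 ≤ 1 / 2 - E := by
    have hpos : 0 < min (ε / 4) ((1 / 2 - E) / 2) := lt_min (by linarith) (by linarith)
    refine ⟨_, hpos, min_le_left _ _, ?_⟩
    have h2 := min_le_right (ε / 4) ((1 / 2 - E) / 2)
    nlinarith
  obtain ⟨MB, hq, hk, hwB, hdB⟩ := hB.place_right hE hε hε' hτ hτE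
  obtain ⟨MA, hp, hm, hwA, hdA⟩ := hA.place_upper_left hτ
  obtain ⟨MC, hm', hk', hwC, hdC⟩ := hC.place_upper_right hτ
  set L : Layout V := ⟨fun v => if v ∈ B then MB.x v else if v ∈ A then MA.x v else MC.x v,
    fun v => if v ∈ B then MB.y v else if v ∈ A then MA.y v else MC.y v,
    fun v => if v ∈ B then MB.z v else if v ∈ A then MA.z v else MC.z v⟩ with hL
  have hLB : ∀ v ∈ B, L.x v = MB.x v ∧ L.y v = MB.y v ∧ L.z v = MB.z v := fun v hv => by
    simp [hL, hv]
  have hLA : ∀ v ∈ A, L.x v = MA.x v ∧ L.y v = MA.y v ∧ L.z v = MA.z v := fun v hv => by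
    simp [hL, hv, hAB v hv]
  have hLC : ∀ v ∈ C, L.x v = MC.x v ∧ L.y v = MC.y v ∧ L.z v = MC.z v := fun v hv => by
    by_cases hvB : v ∈ B
    · rw [hCB v hv hvB]
      simp [hL, hS.mem_right, hk, hk']
    · by_cases hvA : v ∈ A
      · rw [hS₁.inter_eq v hvA hv]
        simp [hL, hAB m hS₁.mem_left, hS₁.mem_left, hm, hm']
      · simp [hL, hvA, hvB]
  obtain ⟨hx, hy, hz⟩ := hLA p hS₁.left_mem
  rw [← hx, ← hy, ← hz] at hp
  obtain ⟨hx, hy, hz⟩ := hLA m hS₁.mem_left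
  rw [← hx, ← hy, ← hz] at hm
  obtain ⟨hx, hy, hz⟩ := hLB q hS.right_mem
  rw [← hx, ← hy, ← hz] at hq
  obtain ⟨hx, hy, hz⟩ := hLB k hS.mem_right
  rw [← hx, ← hy, ← hz] at hk
  have hwB' : ∀ v ∈ B, v ≠ q → v ≠ k → 2 ≤ L.x v ∧
      (1 / 2 - 3 * ε / 4) * (L.x v - 1) < L.y v ∧
      L.y v < 1 + (1 / 2 - ε / 4) * (L.x v - 2) := by
    intro v hv h1 h2
    rw [(hLB v hv).1, (hLB v hv).2.1]
    exact hwB v hv h1 h2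
  have hwA' : ∀ v ∈ A, v ≠ p → v ≠ m → 1 ≤ L.x v ∧ (1 / 2 + τ) * L.x v < L.y v ∧
      (1 / 2 + τ) * L.x v + τ / 4 * (L.x v - 1) < L.y v ∧
      L.y v < (1 / 2 + τ) * L.x v + 3 / 4 * τ * L.x v := by
    intro v hv h1 h2
    rw [(hLA v hv).1, (hLA v hv).2.1]
    exact hwA v hv h1 h2
  have hwC' : ∀ v ∈ C, v ≠ m → v ≠ k → 2 ≤ L.x v ∧ 1 + (1 / 2 - τ) * (L.x v - 2) < L.y v ∧
      1 + (1 / 2 - τ) * (L.x v - 2) + τ / 4 * (L.x v - 2) < L.y v ∧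
      L.y v < 1 / 2 + τ + (1 / 2 - τ) * (L.x v - 1) + 3 / 4 * τ * (L.x v - 1) := by
    intro v hv h1 h2
    rw [(hLC v hv).1, (hLC v hv).2.1]
    exact hwC v hv h1 h2
  refine ⟨L, hp, hq, ?_, ?_⟩
  · intro v hv hvp hvq
    by_cases hvk : v = k
    · rw [hvk, hk.1, hk.2.1]
      refine ⟨by norm_num, by norm_num, by linarith, by linarith⟩
    by_cases hvm : v = m
    · rw [hvm, hm.1, hm.2.1]
      refine ⟨by norm_num, by linarith, by linarith, by linarith⟩
    rw [hS.union_eq, hS₁.union_eq, Finset.mem_union, Finset.mem_union] at hv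
    rcases hv with (hv | hv) | hv
    · obtain ⟨e1, e2, e3, e4⟩ := hwA' v hv hvp hvm
      have p1 : 0 ≤ τ * (L.x v - 1) := mul_nonneg hτ.le (by linarith)
      have p2 : 0 ≤ (ε / 4 - τ) * (L.x v - 1) := mul_nonneg (by linarith) (by linarith)
      refine ⟨by linarith, by linarith, by linarith, by linarith⟩
    · obtain ⟨e1, e2, e3, e4⟩ := hwC' v hv hvm hvk
      have p1 : 0 ≤ τ * (L.x v - 2) := mul_nonneg hτ.le (by linarith)
      have p2 : 0 ≤ (ε / 4 - τ) * (L.x v - 2) := mul_nonneg (by linarith) (by linarith)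
      have p3 : 0 ≤ (1 / 4 - ε) * (L.x v - 2) := mul_nonneg (by linarith) (by linarith)
      refine ⟨by linarith, by linarith, by linarith, by linarith⟩
    · obtain ⟨e1, e2, e3⟩ := hwB' v hv hvq hvk
      have p1 : 0 ≤ ε * (L.x v - 2) := mul_nonneg hε.le (by linarith)
      have p3 : 0 ≤ (1 / 4 - ε) * (L.x v - 2) := mul_nonneg (by linarith) (by linarith)
      refine ⟨by linarith, by linarith, by linarith, by linarith⟩
  · refine Layout.Draws.of_cover [A, C, {p, q}, {p, k}, B] ?_
      (pairwise_apart_upper hε hε' hτ hτε ⟨hp.1, hp.2.1⟩ ⟨hq.1, hq.2.1⟩ ⟨hk.1, hk.2.1⟩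
        ⟨hm.1, hm.2.1⟩ hwA' hwC' hwB') ?_
    · simp only [List.mem_cons, List.not_mem_nil, or_false, forall_eq_or_imp, forall_eq]
      refine ⟨hdA.congr hLA, hdC.congr hLC, Layout.draws_pair (.inl ?_),
        Layout.draws_pair (.inr ?_), hdB.congr hLB⟩
      · rw [hp.1, hp.2.1, hp.2.2, hq.1, hq.2.1, hq.2.2]
        exact ⟨by norm_num, by linarith⟩
      · rw [hp.1, hp.2.1, hp.2.2, hk.1, hk.2.1, hk.2.2]
        exact ⟨by norm_num, by nlinarith⟩
    · rintro u hu v hv (rfl | huv)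
      · rw [hS.union_eq, hS₁.union_eq, Finset.mem_union, Finset.mem_union] at hu
        rcases hu with (hu | hu) | hu
        · exact ⟨A, by simp, hu, hu⟩
        · exact ⟨C, by simp, hu, hu⟩
        · exact ⟨B, by simp, hu, hu⟩
      · rcases hS.edge u hu v hv huv with ⟨h1, h2⟩ | ⟨h1, h2⟩ | ⟨h1, h2⟩ | ⟨h1, h2⟩
        · rcases hS₁.edge u h1 v h2 huv with ⟨h1, h2⟩ | ⟨h1, h2⟩ | ⟨h1, h2⟩ | ⟨h1, h2⟩
          · exact ⟨A, by simp, h1, h2⟩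
          · exact ⟨C, by simp, h1, h2⟩
          · exact ⟨{p, k}, by simp, by simp [h1], by simp [h2]⟩
          · exact ⟨{p, k}, by simp, by simp [h1], by simp [h2]⟩
        · exact ⟨B, by simp, h1, h2⟩
        · exact ⟨{p, q}, by simp, by simp [h1], by simp [h2]⟩
        · exact ⟨{p, q}, by simp, by simp [h1], by simp [h2]⟩

/-- The part of `G` inside `S` is, up to the edge `u v`, obtained by recursively hanging ears
on edges, starting from the base `u v`. -/
inductive Fan {V : Type} [DecidableEq V] (G : SimpleGraph V) : V → V → Finset V → Prop
  | base {u v : V} (huv : u ≠ v) : Fan G u v {u, v}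
  | split {u v k : V} {S A B : Finset V} (hS : EarSplit G u v k S A B) (hA : Fan G u k A)
      (hB : Fan G k v B) : Fan G u v S

theorem wedgeDrawable_of_split {V : Type} [DecidableEq V] {G : SimpleGraph V} {p q k : V}
    {S S₁ B : Finset V} (hS : EarSplit G p q k S S₁ B)
    (h₁ : S₁ = {p, k} ∨ ∃ m A C, EarSplit G p k m S₁ A C ∧ WedgeDrawable G p m A ∧
      WedgeDrawable G m k C) (hB : WedgeDrawable G q k B) : WedgeDrawable G p q S := by
  rcases h₁ with rfl | ⟨m, A, C, hS₁, hA, hC⟩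
  · exact wedgeDrawable_of_ear hS hB
  · exact wedgeDrawable_of_two_ears hS hS₁ hA hC hB

theorem Fan.wedgeDrawable {V : Type} [DecidableEq V] {G : SimpleGraph V} {u v : V}
    {S : Finset V} (h : Fan G u v S) : WedgeDrawable G u v S := by
  suffices H : WedgeDrawable G u v S ∧ WedgeDrawable G v u S ∧
      (S = {u, v} ∨ ∃ k A B, EarSplit G u v k S A B ∧ WedgeDrawable G u k A ∧
        WedgeDrawable G k u A ∧ WedgeDrawable G k v B ∧ WedgeDrawable G v k B) from H.1
  induction h with
  | @base u v huv =>
    refine ⟨wedgeDrawable_pair huv, ?_, .inl rfl⟩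
    rw [Finset.pair_comm]
    exact wedgeDrawable_pair huv.symm
  | @split u v k S A B hS _ _ ihA ihB =>
    obtain ⟨a1, a2, a3⟩ := ihA
    obtain ⟨b1, b2, b3⟩ := ihB
    refine ⟨wedgeDrawable_of_split hS (a3.imp id ?_) b2,
      wedgeDrawable_of_split hS.symm (b3.imp (fun h => ?_) ?_) a1,
      .inr ⟨k, A, B, hS, a1, a2, b1, b2⟩⟩
    · rintro ⟨m, C, D, h, h1, -, h2, -⟩
      exact ⟨m, C, D, h, h1, h2⟩
    · rw [h, Finset.pair_comm]
    · rintro ⟨m, C, D, h, -, h1, -, h2⟩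
      exact ⟨m, D, C, h.symm, h2, h1⟩

theorem exists_split_vertex {V : Type} {G : SimpleGraph V} (θ : V → ℝ) (u : V) {T : Finset V}
    (hT : T.Nonempty) : ∃ k ∈ T, (∀ b ∈ T, G.Adj u b → θ b ≤ θ k) ∧
      (G.Adj u k ∨ ∀ a ∈ T, θ k ≤ θ a) := by
  classical
  rcases (T.filter (G.Adj u)).eq_empty_or_nonempty with h | h
  · obtain ⟨k, hk, hmin⟩ := T.exists_min_image θ hT
    rw [Finset.filter_eq_empty_iff] at h
    exact ⟨k, hk, fun b hb hub => absurd hub (h hb), .inr hmin⟩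
  · obtain ⟨k, hk, hmax⟩ := (T.filter (G.Adj u)).exists_max_image θ h
    rw [Finset.mem_filter] at hk
    exact ⟨k, hk.1, fun b hb hub => hmax b (Finset.mem_filter.2 ⟨hb, hub⟩), .inl hk.2⟩

theorem fan_of_noncrossing {V : Type} [Fintype V] [DecidableEq V] {G : SimpleGraph V} {θ : V → ℝ}
    (hθ : Function.Injective θ)
    (hcross : ∀ a b c d, θ a < θ b → θ b < θ c → θ c < θ d → G.Adj a c → ¬ G.Adj b d)
    {u w : V} (huw : θ u < θ w) {S : Finset V} (hS : ∀ v, v ∈ S ↔ θ u ≤ θ v ∧ θ v ≤ θ w) :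
    Fan G u w S := by
  induction hn : S.card using Nat.strong_induction_on generalizing u w S with
  | _ n ih =>
  subst hn
  rcases (S.filter fun v => θ u < θ v ∧ θ v < θ w).eq_empty_or_nonempty with hT | hT
  · have : S = {u, w} := by
      rw [Finset.filter_eq_empty_iff] at hT
      ext v
      simp only [Finset.mem_insert, Finset.mem_singleton]
      constructor
      · intro hv
        have h1 := (hS v).1 hv
        rcases h1.1.eq_or_lt with h | h
        · exact .inl (hθ h.symm)
        · rcases h1.2.eq_or_lt with h' | h'
          · exact .inr (hθ h')
          · exact absurd ⟨h, h'⟩ (hT hv)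
      · rintro (rfl | rfl)
        · exact (hS _).2 ⟨le_rfl, huw.le⟩
        · exact (hS _).2 ⟨huw.le, le_rfl⟩
    rw [this]
    exact .base fun h => huw.ne (congrArg θ h)
  · obtain ⟨k, hk, hmax, hmin⟩ := exists_split_vertex (G := G) θ u hT
    simp only [Finset.mem_filter, hS] at hk hmax hmin
    obtain ⟨-, hk1, hk2⟩ := hk
    set A := S.filter fun v => θ v ≤ θ k with hAdef
    set B := S.filter fun v => θ k ≤ θ v with hBdef
    have hA : ∀ v, v ∈ A ↔ θ u ≤ θ v ∧ θ v ≤ θ k := fun v => by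
      rw [hAdef, Finset.mem_filter, hS]
      exact ⟨fun h => ⟨h.1.1, h.2⟩, fun h => ⟨⟨h.1, h.2.trans hk2.le⟩, h.2⟩⟩
    have hB : ∀ v, v ∈ B ↔ θ k ≤ θ v ∧ θ v ≤ θ w := fun v => by
      rw [hBdef, Finset.mem_filter, hS]
      exact ⟨fun h => ⟨h.2, h.1.2⟩, fun h => ⟨⟨hk1.le.trans h.1, h.2⟩, h.1⟩⟩
    have hAc : A.card < S.card := by
      refine Finset.card_lt_card ⟨Finset.filter_subset _ _, fun h => ?_⟩
      have := h ((hS w).2 ⟨huw.le, le_rfl⟩)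
      rw [hA] at this
      linarith [this.2]
    have hBc : B.card < S.card := by
      refine Finset.card_lt_card ⟨Finset.filter_subset _ _, fun h => ?_⟩
      have := h ((hS u).2 ⟨le_rfl, huw.le⟩)
      rw [hB] at this
      linarith [this.1]
    have main : ∀ a ∈ S, ∀ b ∈ S, θ a < θ b → G.Adj a b →
        (a ∈ A ∧ b ∈ A) ∨ (a ∈ B ∧ b ∈ B) ∨ (a = u ∧ b = w) := by
      intro a ha b hb hab hadj
      rw [hA, hA, hB, hB]
      rw [hS] at ha hb
      by_cases hbk : θ b ≤ θ k
      · exact .inl ⟨⟨ha.1, hab.le.trans hbk⟩, hb.1, hbk⟩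
      by_cases hka : θ k ≤ θ a
      · exact .inr (.inl ⟨⟨hka, ha.2⟩, hka.trans hab.le, hb.2⟩)
      rw [not_le] at hbk hka
      rcases ha.1.eq_or_lt with h | h
      · have hau := hθ h
        subst hau
        refine .inr (.inr ⟨rfl, ?_⟩)
        rcases hb.2.eq_or_lt with h' | h'
        · exact hθ h'
        · exact absurd (hmax b ⟨hb, hab, h'⟩ hadj) hbk.not_ge
      · rcases hmin with h' | h'
        · exact absurd hadj (hcross u a k b h hka hbk h')
        · exact absurd (h' a ⟨ha, h, hka.trans hk2⟩) hka.not_ge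
    refine Fan.split (k := k) (A := A) (B := B) ⟨?_, ?_, ?_, ?_, ?_, ?_, ?_, ?_, ?_⟩
      (ih _ hAc hk1 hA rfl) (ih _ hBc hk2 hB rfl)
    · ext v
      rw [Finset.mem_union, hA, hB, hS]
      constructor
      · rintro ⟨h1, h2⟩
        rcases le_total (θ v) (θ k) with h | h
        · exact .inl ⟨h1, h⟩
        · exact .inr ⟨h, h2⟩
      · rintro (h | h)
        · exact ⟨h.1, h.2.trans hk2.le⟩
        · exact ⟨hk1.le.trans h.1, h.2⟩
    · intro v h1 h2
      exact hθ (le_antisymm ((hA v).1 h1).2 ((hB v).1 h2).1)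
    · exact (hA _).2 ⟨le_rfl, hk1.le⟩
    · exact (hB _).2 ⟨hk2.le, le_rfl⟩
    · exact (hA _).2 ⟨hk1.le, le_rfl⟩
    · exact (hB _).2 ⟨le_rfl, hk2.le⟩
    · exact fun h => hk1.ne (congrArg θ h)
    · exact fun h => hk2.ne' (congrArg θ h)
    · intro a ha b hb hab
      rcases lt_or_gt_of_ne (fun h : θ a = θ b => hab.ne (hθ h)) with h | h
      · rcases main a ha b hb h hab with h | h | h
        exacts [.inl h, .inr (.inl h), .inr (.inr (.inl h))]
      · rcases main b hb a ha h hab.symm with h | h | h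
        exacts [.inl h.symm, .inr (.inl h.symm), .inr (.inr (.inr h.symm))]

theorem orient_pos_of_angle_lt {α β γ : ℝ} (h1 : α < β) (h2 : β < γ)
    (h3 : γ < α + 2 * Real.pi) :
    0 < (Real.cos β - Real.cos α) * (Real.sin γ - Real.sin α) -
      (Real.sin β - Real.sin α) * (Real.cos γ - Real.cos α) := by
  obtain ⟨x, rfl⟩ : ∃ x, β = α + 2 * x := ⟨(β - α) / 2, by ring⟩
  obtain ⟨y, rfl⟩ : ∃ y, γ = α + 2 * x + 2 * y := ⟨(γ - (α + 2 * x)) / 2, by ring⟩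
  have hx : 0 < Real.sin x := Real.sin_pos_of_pos_of_lt_pi (by linarith) (by linarith)
  have hy : 0 < Real.sin y := Real.sin_pos_of_pos_of_lt_pi (by linarith) (by linarith)
  have hxy : 0 < Real.sin (x + y) := Real.sin_pos_of_pos_of_lt_pi (by linarith) (by linarith)
  have e1 : Real.cos (α + 2 * x) * Real.sin (α + 2 * x + 2 * y) -
      Real.sin (α + 2 * x) * Real.cos (α + 2 * x + 2 * y) = Real.sin (2 * y) := by
    rw [← add_sub_cancel_left (α + 2 * x) (2 * y), Real.sin_sub]
    simp only [add_sub_cancel_left]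
    ring
  have e2 : Real.cos α * Real.sin (α + 2 * x + 2 * y) -
      Real.sin α * Real.cos (α + 2 * x + 2 * y) = Real.sin (2 * (x + y)) := by
    rw [show 2 * (x + y) = (α + 2 * x + 2 * y) - α by ring, Real.sin_sub]
    ring
  have e3 : Real.cos α * Real.sin (α + 2 * x) - Real.sin α * Real.cos (α + 2 * x) =
      Real.sin (2 * x) := by
    rw [show 2 * x = (α + 2 * x) - α by ring, Real.sin_sub]
    simp only [add_sub_cancel]
    ring
  have key : Real.sin (2 * x) + Real.sin (2 * y) - Real.sin (2 * (x + y)) =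
      4 * Real.sin (x + y) * Real.sin x * Real.sin y := by
    simp only [Real.sin_two_mul, Real.sin_add, Real.cos_add]
    have hx1 := Real.sin_sq_add_cos_sq x
    have hy1 := Real.sin_sq_add_cos_sq y
    linear_combination (-2 * Real.sin y * Real.cos y) * hx1 - (2 * Real.sin x * Real.cos x) * hy1
  have : 0 < 4 * Real.sin (x + y) * Real.sin x * Real.sin y := by positivity
  linarith

theorem IsPlanarDrawing.noncrossing_of_orient {V : Type} {G : SimpleGraph V} {ρ : V → Plane}
    (h : IsPlanarDrawing G ρ) {a b c d : V} (hac : G.Adj a c) (hbd : G.Adj b d) (hab : a ≠ b)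
    (had : a ≠ d) (hcb : c ≠ b) (hcd : c ≠ d) {X Y : V → ℝ}
    (hX : ∀ v, ρ v 0 = X v) (hY : ∀ v, ρ v 1 = Y v)
    (h1 : 0 < (X c - X b) * (Y d - Y b) - (Y c - Y b) * (X d - X b))
    (h2 : 0 < (X b - X a) * (Y d - Y a) - (Y b - Y a) * (X d - X a))
    (h3 : 0 < (X c - X a) * (Y d - Y a) - (Y c - Y a) * (X d - X a))
    (h4 : 0 < (X b - X a) * (Y c - Y a) - (Y b - Y a) * (X c - X a)) : False := by
  set D1 := (X c - X b) * (Y d - Y b) - (Y c - Y b) * (X d - X b) with hD1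
  set D2 := (X b - X a) * (Y d - Y a) - (Y b - Y a) * (X d - X a) with hD2
  set D3 := (X c - X a) * (Y d - Y a) - (Y c - Y a) * (X d - X a) with hD3
  set D4 := (X b - X a) * (Y c - Y a) - (Y b - Y a) * (X c - X a) with hD4
  have hs : D1 + D2 = D3 + D4 := by rw [hD1, hD2, hD3, hD4]; ring
  have hpos : 0 < D1 + D2 := by linarith
  have hmem : (D1 / (D1 + D2)) • ρ a + (D2 / (D1 + D2)) • ρ c ∈
      segment ℝ (ρ a) (ρ c) ∩ segment ℝ (ρ b) (ρ d) := by
    refine ⟨⟨_, _, by positivity, by positivity, by field_simp, rfl⟩,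
      D3 / (D1 + D2), D4 / (D1 + D2), by positivity, by positivity, ?_, ?_⟩
    · rw [← add_div, ← hs, div_self hpos.ne']
    · ext i
      fin_cases i
      · simp [hX]
        field_simp
        rw [hD1, hD2, hD3, hD4]; ring
      · simp [hY]
        field_simp
        rw [hD1, hD2, hD3, hD4]; ring
  rw [h.2.2 a c b d hac hbd (by simp [hab, had])] at hmem
  obtain ⟨w, hw | hw, hw' | hw', -⟩ := hmem <;> simp_all

theorem IsOuterplanar.exists_fan {V : Type} [Fintype V] [DecidableEq V] {G : SimpleGraph V}
    (hG : IsOuterplanar G) (hV : Nontrivial V) : ∃ u w, Fan G u w Finset.univ := by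
  obtain ⟨ρ, c, r, hρ, hr⟩ := hG
  set ζ : V → ℂ := fun v => ⟨ρ v 0 - c 0, ρ v 1 - c 1⟩ with hζ
  have hnorm : ∀ v, ‖ζ v‖ = r := fun v => by
    rw [← hr v, EuclideanSpace.dist_eq, Complex.norm_def, Complex.normSq_apply, Fin.sum_univ_two,
      Real.dist_eq, Real.dist_eq, sq_abs, sq_abs, sq, sq]
  set θ : V → ℝ := fun v => (ζ v).arg with hθdef
  have hX : ∀ v, ρ v 0 = c 0 + r * Real.cos (θ v) := fun v => by
    rw [← hnorm v, hθdef, Complex.norm_mul_cos_arg]; simp [hζ]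
  have hY : ∀ v, ρ v 1 = c 1 + r * Real.sin (θ v) := fun v => by
    rw [← hnorm v, hθdef, Complex.norm_mul_sin_arg]; simp [hζ]
  have hθ : Function.Injective θ := fun a b hab => hρ.1 <| by
    ext i
    fin_cases i
    · simp [hX, hab]
    · simp [hY, hab]
  have hr0 : 0 < r := by
    obtain ⟨a, b, hab⟩ := hV
    have : 0 < dist (ρ a) (ρ b) := dist_pos.2 fun h => hab (hρ.1 h)
    have h2 := dist_triangle_right (ρ a) (ρ b) c
    rw [hr, hr] at h2
    linarith
  have horient : ∀ a b d, θ a < θ b → θ b < θ d →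
      0 < ((c 0 + r * Real.cos (θ b)) - (c 0 + r * Real.cos (θ a))) *
        ((c 1 + r * Real.sin (θ d)) - (c 1 + r * Real.sin (θ a))) -
        ((c 1 + r * Real.sin (θ b)) - (c 1 + r * Real.sin (θ a))) *
        ((c 0 + r * Real.cos (θ d)) - (c 0 + r * Real.cos (θ a))) := by
    intro a b d h1 h2
    have h3 : θ d < θ a + 2 * Real.pi := by
      linarith [Complex.arg_le_pi (ζ d), Complex.neg_pi_lt_arg (ζ a)]
    have := mul_pos (mul_pos hr0 hr0) (orient_pos_of_angle_lt h1 h2 h3)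
    linarith
  have hcross : ∀ a b c d, θ a < θ b → θ b < θ c → θ c < θ d → G.Adj a c → ¬ G.Adj b d := by
    intro a b e d h1 h2 h3 hae hbd
    have hne : ∀ {s t : V}, θ s < θ t → s ≠ t := fun h h' => h.ne (congrArg θ h')
    exact hρ.noncrossing_of_orient hae hbd (hne h1) (hne (h1.trans (h2.trans h3))) (hne h2).symm
      (hne h3) hX hY
      (horient b e d h2 h3) (horient a b d h1 (h2.trans h3)) (horient a e d (h1.trans h2) h3)
      (horient a b e h1 h2)
  obtain ⟨u, -, hu⟩ := Finset.univ.exists_min_image θ Finset.univ_nonempty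
  obtain ⟨w, -, hw⟩ := Finset.univ.exists_max_image θ Finset.univ_nonempty
  refine ⟨u, w, fan_of_noncrossing hθ hcross ?_ fun v => ?_⟩
  · refine (hu w (Finset.mem_univ _)).lt_of_ne fun h => ?_
    obtain ⟨a, b, hab⟩ := hV
    apply hab
    have ha := hu a (Finset.mem_univ _)
    have ha' := hw a (Finset.mem_univ _)
    have hb := hu b (Finset.mem_univ _)
    have hb' := hw b (Finset.mem_univ _)
    exact hθ (by linarith)
  · simp [hu v (Finset.mem_univ _), hw v (Finset.mem_univ _)]

theorem LineSep.eventually_flatten {V : Type} {x y : V → ℝ} {e f : Finset V}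
    (h : LineSep x y e f) (z : V → ℝ) {κ : ℝ} (hκ : ∀ v ∈ e, v ∈ f → z v = κ) :
    ∀ᶠ t in nhdsWithin (0 : ℝ) (Set.Ioi 0),
      LineSep (fun v => x v - t ^ 2 * z v) (fun v => t * y v) e f := by
  obtain ⟨a, b, c, h0, h1, h2⟩ := h
  have lim : ∀ v, Filter.Tendsto
      (fun t : ℝ => a * x v + b * y v + c + a * (t ^ 2 * (κ - z v)))
      (nhdsWithin (0 : ℝ) (Set.Ioi 0)) (nhds (a * x v + b * y v + c)) := fun v => by
    have : Continuous fun t : ℝ => a * x v + b * y v + c + a * (t ^ 2 * (κ - z v)) := by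
      fun_prop
    have := (this.tendsto 0).mono_left (nhdsWithin_le_nhds (s := Set.Ioi 0))
    simpa using this
  have hneg : ∀ᶠ t in nhdsWithin (0 : ℝ) (Set.Ioi 0), ∀ v ∈ e, v ∉ f →
      a * x v + b * y v + c + a * (t ^ 2 * (κ - z v)) < 0 := by
    rw [Filter.eventually_all_finset]
    intro v hv
    rw [Filter.eventually_imp_distrib_left]
    exact fun hvf => (lim v).eventually_lt_const (h1 v hv hvf)
  have hpos : ∀ᶠ t in nhdsWithin (0 : ℝ) (Set.Ioi 0), ∀ v ∈ f, v ∉ e →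
      0 < a * x v + b * y v + c + a * (t ^ 2 * (κ - z v)) := by
    rw [Filter.eventually_all_finset]
    intro v hv
    rw [Filter.eventually_imp_distrib_left]
    exact fun hve => (lim v).eventually_const_lt (h2 v hv hve)
  filter_upwards [hneg, hpos, self_mem_nhdsWithin] with t hn hp ht
  have ht0 : t ≠ 0 := (Set.mem_Ioi.1 ht).ne'
  have key : ∀ v, a * (x v - t ^ 2 * z v) + b / t * (t * y v) + (c + a * (t ^ 2 * κ)) =
      a * x v + b * y v + c + a * (t ^ 2 * (κ - z v)) := fun v => by
    field_simp
    ring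
  refine ⟨a, b / t, c + a * (t ^ 2 * κ), fun v he hf => ?_, fun v he hf => ?_,
    fun v hf he => ?_⟩
  · rw [key, h0 v he hf, hκ v he hf]; ring
  · rw [key]; exact hn v he hf
  · rw [key]; exact hp v hf he

theorem Finset.pair_eq_or_exists_common {V : Type} [DecidableEq V] (u v a b : V) :
    ({u, v} : Finset V) = {a, b} ∨
      ∃ w, ∀ r ∈ ({u, v} : Finset V), r ∈ ({a, b} : Finset V) → r = w := by
  by_cases hu : u = a ∨ u = b
  · by_cases hv : v = a ∨ v = b
    · by_cases huv : u = v
      · exact .inr ⟨u, by simp [huv]⟩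
      · left
        rcases hu with rfl | rfl <;> rcases hv with rfl | rfl
        · exact (huv rfl).elim
        · rfl
        · exact Finset.pair_comm _ _
        · exact (huv rfl).elim
    · refine .inr ⟨u, fun r hr hr' => ?_⟩
      simp only [Finset.mem_insert, Finset.mem_singleton] at hr hr'
      rcases hr with rfl | rfl
      · rfl
      · exact (hv hr').elim
  · refine .inr ⟨v, fun r hr hr' => ?_⟩
    simp only [Finset.mem_insert, Finset.mem_singleton] at hr hr'
    rcases hr with rfl | rfl
    · exact (hu hr').elim
    · rfl

theorem Apart.eventually_flatten {V : Type} [Finite V] [DecidableEq V] {G : SimpleGraph V}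
    {x y : V → ℝ} {S T : Finset V} (h : Apart G x y S T) (z : V → ℝ) :
    ∀ᶠ t in nhdsWithin (0 : ℝ) (Set.Ioi 0),
      Apart G (fun v => x v - t ^ 2 * z v) (fun v => t * y v) S T := by
  simp only [Apart, Filter.eventually_all]
  intro u hu v hv huv a ha b hb hab
  rcases Finset.pair_eq_or_exists_common u v a b with heq | ⟨w, hw⟩
  · rw [heq]
    exact .of_forall fun t => ⟨0, 0, 0, by simp, fun v h1 h2 => absurd h1 h2,
      fun v h1 h2 => absurd h1 h2⟩
  · exact (h u hu v hv huv a ha b hb hab).eventually_flatten z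
      (κ := z w) fun r h1 h2 => by rw [hw r h1 h2]

theorem Layout.Step.eventually_length {V : Type} {L : Layout V} {u v : V} (h : L.Step u v) :
    ∀ᶠ t in nhdsWithin (0 : ℝ) (Set.Ioi 0),
      1 ≤ ((L.x v - t ^ 2 * L.z v) - (L.x u - t ^ 2 * L.z u)) ^ 2 + (t * L.y v - t * L.y u) ^ 2 ∧
      ((L.x v - t ^ 2 * L.z v) - (L.x u - t ^ 2 * L.z u)) ^ 2 +
        (t * L.y v - t * L.y u) ^ 2 < 4 := by
  have lim : Filter.Tendsto (fun t : ℝ =>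
      ((L.x v - t ^ 2 * L.z v) - (L.x u - t ^ 2 * L.z u)) ^ 2 + (t * L.y v - t * L.y u) ^ 2)
      (nhdsWithin (0 : ℝ) (Set.Ioi 0)) (nhds ((L.x v - L.x u) ^ 2)) := by
    have : Continuous fun t : ℝ => ((L.x v - t ^ 2 * L.z v) - (L.x u - t ^ 2 * L.z u)) ^ 2 +
        (t * L.y v - t * L.y u) ^ 2 := by fun_prop
    have := (this.tendsto 0).mono_left (nhdsWithin_le_nhds (s := Set.Ioi 0))
    simpa using this
  rcases h with ⟨h1, h2⟩ | ⟨h1, h2⟩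
  · rw [h1] at lim
    filter_upwards [lim.eventually_lt_const (show (1 : ℝ) ^ 2 < 4 by norm_num)] with t ht
    refine ⟨?_, ht⟩
    have e : ((L.x v - t ^ 2 * L.z v) - (L.x u - t ^ 2 * L.z u)) ^ 2 +
        (t * L.y v - t * L.y u) ^ 2 = 1 + t ^ 2 * ((L.y v - L.y u) ^ 2 - 2 * (L.z v - L.z u)) +
          (t ^ 2 * (L.z v - L.z u)) ^ 2 := by
      rw [show L.x v = L.x u + 1 by linarith]; ring
    rw [e]
    have : 0 ≤ t ^ 2 * ((L.y v - L.y u) ^ 2 - 2 * (L.z v - L.z u)) :=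
      mul_nonneg (sq_nonneg t) (by linarith)
    nlinarith [sq_nonneg (t ^ 2 * (L.z v - L.z u))]
  · rw [h1] at lim
    have lim2 : Filter.Tendsto (fun t : ℝ => t ^ 2 * (L.z v - L.z u) ^ 2)
        (nhdsWithin (0 : ℝ) (Set.Ioi 0)) (nhds 0) := by
      have : Continuous fun t : ℝ => t ^ 2 * (L.z v - L.z u) ^ 2 := by fun_prop
      have := (this.tendsto 0).mono_left (nhdsWithin_le_nhds (s := Set.Ioi 0))
      simpa using this
    filter_upwards [lim.eventually_const_lt (show (1 : ℝ) < 2 ^ 2 by norm_num),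
      lim2.eventually_lt_const (show 0 < 4 * (L.z v - L.z u) - (L.y v - L.y u) ^ 2 by linarith),
      self_mem_nhdsWithin] with t ht ht2 ht0
    refine ⟨ht.le, ?_⟩
    have e : ((L.x v - t ^ 2 * L.z v) - (L.x u - t ^ 2 * L.z u)) ^ 2 +
        (t * L.y v - t * L.y u) ^ 2 = 4 - t ^ 2 * (4 * (L.z v - L.z u) - (L.y v - L.y u) ^ 2 -
          t ^ 2 * (L.z v - L.z u) ^ 2) := by
      rw [show L.x v = L.x u + 2 by linarith]; ring
    rw [e]
    have : 0 < t ^ 2 * (4 * (L.z v - L.z u) - (L.y v - L.y u) ^ 2 -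
          t ^ 2 * (L.z v - L.z u) ^ 2) := mul_pos (pow_pos ht0 2) (by linarith)
    linarith

theorem Apart.isPlanarDrawing {V : Type} [Fintype V] [DecidableEq V] {G : SimpleGraph V}
    {x y : V → ℝ} (h : Apart G x y Finset.univ Finset.univ) :
    IsPlanarDrawing G fun v => !₂[x v, y v] := by
  refine ⟨fun u v huv => ?_, fun u v w huv hu hv hw => ?_, fun u v a b huv hab hne => ?_⟩
  · by_contra hne
    obtain ⟨A, B, C, -, h1, h2⟩ := h u (Finset.mem_univ _) u (Finset.mem_univ _) (.inl rfl)
      v (Finset.mem_univ _) v (Finset.mem_univ _) (.inl rfl)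
    have hx : x u = x v := by simpa using congrArg (fun p : Plane => p 0) huv
    have hy : y u = y v := by simpa using congrArg (fun p : Plane => p 1) huv
    have h1' := h1 u (by simp) (by simpa using hne)
    have h2' := h2 v (by simp) (by simpa using Ne.symm hne)
    rw [hx, hy] at h1'
    linarith
  · obtain ⟨A, B, C, -, h1, h2⟩ := h u (Finset.mem_univ _) v (Finset.mem_univ _) (.inr huv)
      w (Finset.mem_univ _) w (Finset.mem_univ _) (.inl rfl)
    have hu' := h1 u (by simp) (by simpa using hu.symm)
    have hv' := h1 v (by simp) (by simpa using hv.symm)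
    have hw' := h2 w (by simp) (by simp [hu, hv])
    obtain ⟨s, t, hs, ht, hst, hp⟩ := hw
    have hx : s * x u + t * x v = x w := by simpa using congrArg (fun p : Plane => p 0) hp
    have hy : s * y u + t * y v = y w := by simpa using congrArg (fun p : Plane => p 1) hp
    have : A * x w + B * y w + C =
        s * (A * x u + B * y u + C) + t * (A * x v + B * y v + C) := by
      rw [← hx, ← hy]; linear_combination -C * hst
    nlinarith
  · obtain ⟨A, B, C, h0, h1, h2⟩ := h u (Finset.mem_univ _) v (Finset.mem_univ _) (.inr huv)
      a (Finset.mem_univ _) b (Finset.mem_univ _) (.inr hab)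
    have hle : ∀ r ∈ ({u, v} : Finset V), A * x r + B * y r + C ≤ 0 := fun r hr => by
      by_cases hr' : r ∈ ({a, b} : Finset V)
      · exact (h0 r hr hr').le
      · exact (h1 r hr hr').le
    have hge : ∀ r ∈ ({a, b} : Finset V), 0 ≤ A * x r + B * y r + C := fun r hr => by
      by_cases hr' : r ∈ ({u, v} : Finset V)
      · exact (h0 r hr' hr).ge
      · exact (h2 r hr hr').le
    refine Set.Subset.antisymm ?_ ?_
    · rintro p ⟨⟨s, t, hs, ht, hst, hp⟩, s', t', hs', ht', hst', hp'⟩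
      have hx : s * x u + t * x v = s' * x a + t' * x b := by
        simpa using congrArg (fun p : Plane => p 0) (hp.trans hp'.symm)
      have hy : s * y u + t * y v = s' * y a + t' * y b := by
        simpa using congrArg (fun p : Plane => p 1) (hp.trans hp'.symm)
      have hφ : s * (A * x u + B * y u + C) + t * (A * x v + B * y v + C) =
          s' * (A * x a + B * y a + C) + t' * (A * x b + B * y b + C) := by
        linear_combination A * hx + B * hy + C * hst - C * hst'
      have hu := mul_nonneg hs (neg_nonneg.2 (hle u (by simp)))
      have hv := mul_nonneg ht (neg_nonneg.2 (hle v (by simp)))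
      have ha := mul_nonneg hs' (hge a (by simp))
      have hb := mul_nonneg ht' (hge b (by simp))
      have hu0 : s * (A * x u + B * y u + C) = 0 := by linarith
      have hv0 : t * (A * x v + B * y v + C) = 0 := by linarith
      by_cases hu' : u ∈ ({a, b} : Finset V) <;> by_cases hv' : v ∈ ({a, b} : Finset V)
      · refine absurd ?_ hne
        simp only [Finset.mem_insert, Finset.mem_singleton] at hu' hv'
        rcases hu' with rfl | rfl <;> rcases hv' with rfl | rfl
        · exact (huv.ne rfl).elim
        · rfl
        · exact Sym2.eq_swap
        · exact (huv.ne rfl).elim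
      · have ht0 : t = 0 := (mul_eq_zero.1 hv0).resolve_right (h1 v (by simp) hv').ne
        have hs1 : s = 1 := by linarith
        refine ⟨u, .inl rfl, by simpa using hu', ?_⟩
        rw [← hp, ht0, hs1, one_smul, zero_smul, add_zero]
      · have hs0 : s = 0 := (mul_eq_zero.1 hu0).resolve_right (h1 u (by simp) hu').ne
        have ht1 : t = 1 := by linarith
        refine ⟨v, .inr rfl, by simpa using hv', ?_⟩
        rw [← hp, hs0, ht1, one_smul, zero_smul, zero_add]
      · have ht0 : t = 0 := (mul_eq_zero.1 hv0).resolve_right (h1 v (by simp) hv').ne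
        have hs0 : s = 0 := (mul_eq_zero.1 hu0).resolve_right (h1 u (by simp) hu').ne
        linarith
    · rintro p ⟨w, hw | hw, hw' | hw', rfl⟩
      · exact ⟨hw ▸ left_mem_segment ℝ _ _, hw' ▸ left_mem_segment ℝ _ _⟩
      · exact ⟨hw ▸ left_mem_segment ℝ _ _, hw' ▸ right_mem_segment ℝ _ _⟩
      · exact ⟨hw ▸ right_mem_segment ℝ _ _, hw' ▸ left_mem_segment ℝ _ _⟩
      · exact ⟨hw ▸ right_mem_segment ℝ _ _, hw' ▸ right_mem_segment ℝ _ _⟩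

theorem edgeLengthRatio_lt_of_forall {V : Type} [Finite V] {G : SimpleGraph V} {ρ : V → Plane}
    (hE : ∃ u v : V, G.Adj u v)
    (h : ∀ u v, G.Adj u v → 1 ≤ dist (ρ u) (ρ v) ∧ dist (ρ u) (ρ v) < 2) :
    edgeLengthRatio G ρ < 2 := by
  unfold edgeLengthRatio
  set D : Set ℝ := {d : ℝ | ∃ u v : V, G.Adj u v ∧ d = dist (ρ u) (ρ v)} with hD
  have hfin : D.Finite := by
    refine (Set.finite_range fun p : V × V => dist (ρ p.1) (ρ p.2)).subset ?_
    rintro d ⟨u, v, -, rfl⟩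
    exact ⟨(u, v), rfl⟩
  have hne : D.Nonempty := by
    obtain ⟨u, v, huv⟩ := hE
    exact ⟨_, u, v, huv, rfl⟩
  have hsup : sSup D < 2 := by
    rw [hfin.csSup_lt_iff hne]
    rintro d ⟨u, v, huv, rfl⟩
    exact (h u v huv).2
  have hinf : 1 ≤ sInf D := le_csInf hne <| by
    rintro d ⟨u, v, huv, rfl⟩
    exact (h u v huv).1
  rw [div_lt_iff₀ (by linarith)]
  linarith

theorem Layout.Draws.exists_planarDrawing {V : Type} [Fintype V] [DecidableEq V]
    {G : SimpleGraph V} {L : Layout V} (h : L.Draws G Finset.univ)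
    (hE : ∃ u v : V, G.Adj u v) :
    ∃ ρ : V → Plane, IsPlanarDrawing G ρ ∧ edgeLengthRatio G ρ < 2 := by
  have hlen : ∀ᶠ t in nhdsWithin (0 : ℝ) (Set.Ioi 0), ∀ u v, G.Adj u v →
      1 ≤ ((L.x u - t ^ 2 * L.z u) - (L.x v - t ^ 2 * L.z v)) ^ 2 + (t * L.y u - t * L.y v) ^ 2 ∧
      ((L.x u - t ^ 2 * L.z u) - (L.x v - t ^ 2 * L.z v)) ^ 2 +
        (t * L.y u - t * L.y v) ^ 2 < 4 := by
    simp only [Filter.eventually_all]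
    intro u v huv
    rcases h.1 u (Finset.mem_univ _) v (Finset.mem_univ _) huv with hs | hs
    · filter_upwards [hs.eventually_length] with t ht
      rwa [← neg_sub, neg_sq, ← neg_sub (t * L.y v), neg_sq]
    · exact hs.eventually_length
  obtain ⟨t, ht, hdraw⟩ := (hlen.and (h.2.eventually_flatten L.z)).exists
  refine ⟨_, hdraw.isPlanarDrawing, edgeLengthRatio_lt_of_forall hE fun u v huv => ?_⟩
  obtain ⟨h1, h2⟩ := ht u v huv
  rw [EuclideanSpace.dist_eq, Fin.sum_univ_two, Real.dist_eq, Real.dist_eq, sq_abs, sq_abs]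
  refine ⟨Real.one_le_sqrt.2 h1, (Real.sqrt_lt' two_pos).2 ?_⟩
  norm_num
  exact h2

/-- Every outerplanar finite simple graph with at least one edge admits a
planar straight-line drawing whose edge-length ratio is strictly less than 2. -/
theorem outerplanar_edgeLengthRatio_lt_two {V : Type} [Fintype V] (G : SimpleGraph V)
    (hG : IsOuterplanar G) (hE : ∃ u v : V, G.Adj u v) :
    ∃ ρ : V → Plane, IsPlanarDrawing G ρ ∧ edgeLengthRatio G ρ < 2 := by
  classical
  have hV : Nontrivial V := by
    obtain ⟨u, v, huv⟩ := hE
    exact ⟨u, v, huv.ne⟩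
  obtain ⟨u, w, hfan⟩ := hG.exists_fan hV
  obtain ⟨L, -, -, -, hL⟩ := hfan.wedgeDrawable 0 (1 / 4) le_rfl (by norm_num) (by norm_num) le_rfl
  exact hL.exists_planarDrawing hE
end
end

section
/- Every maximal outerplanar graph admits a planar straight-line drawing ρ in which every edge {u,v} satisfies 1/2 < dist(ρ(u), ρ(v)) ≤ 1; in particular, the edge-length ratio of this drawing is strictly less than 2. -/
noncomputable section

/-- A maximal outerplanar graph: an outerplanar graph on at least 3 vertices to which no
edge can be added while staying outerplanar. -/
def IsMaximalOuterplanar {V : Type} [Fintype V] (G : SimpleGraph V) : Prop :=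
  3 ≤ Fintype.card V ∧ IsOuterplanar G ∧
  ∀ u v : V, u ≠ v → ¬ G.Adj u v →
    ¬ IsOuterplanar (G ⊔ SimpleGraph.fromEdgeSet {s(u, v)})


namespace OuterplanarDrawing

/-- A triangulated polygon lying on one side of the edge `uv`, given as the family of its vertices
(as singletons) and its edges (as pairs). -/
inductive Side {α : Type} : α → α → Set (Set α) → Prop
  | edge (u v : α) (huv : u ≠ v) : Side u v {{u}, {v}, {u, v}}
  | glue (u v w : α) (C D : Set (Set α)) (hC : Side u w C) (hD : Side w v D)
      (hCD : ⋃₀ C ∩ ⋃₀ D ⊆ {w}) : Side u v (insert {u, v} (C ∪ D))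

theorem Side.left_mem {α : Type} {u v : α} {C : Set (Set α)} (h : Side u v C) : {u} ∈ C := by
  induction h with
  | edge u v huv => simp
  | glue u v w C D hC hD hCD ihC ihD => exact Or.inr (Or.inl ihC)

theorem Side.right_mem {α : Type} {u v : α} {C : Set (Set α)} (h : Side u v C) : {v} ∈ C := by
  induction h with
  | edge u v huv => simp
  | glue u v w C D hC hD hCD ihC ihD => exact Or.inr (Or.inr ihD)

/-- Noncrossing chords over an interval of `ℕ` extend to a triangulated polygon. -/
theorem exists_side (A : ℕ → ℕ → Prop)
    (hA : ∀ a b c d, a < b → b < c → c < d → A a c → A b d → False) (i j : ℕ) (hij : i < j) :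
    ∃ C, Side i j C ∧ ⋃₀ C = Set.Icc i j ∧
      (∀ x y, i ≤ x → x < y → y ≤ j → A x y → {x, y} ∈ C) ∧
      ∀ x, i ≤ x → x ≤ j → {x} ∈ C := by
  classical
  induction hn : j - i using Nat.strong_induction_on generalizing i j with
  | _ n ih =>
  by_cases h1 : j = i + 1
  · subst h1
    refine ⟨_, Side.edge i (i + 1) (by omega), ?_, ?_, ?_⟩
    · ext x
      simp only [Set.mem_sUnion, Set.mem_insert_iff, Set.mem_singleton_iff, exists_eq_or_imp,
        exists_eq_left, Set.mem_Icc]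
      omega
    · intro x y hx hxy hy _
      obtain rfl : x = i := by omega
      obtain rfl : y = x + 1 := by omega
      simp
    · intro x hx hx'
      rcases (by omega : x = i ∨ x = i + 1) with rfl | rfl <;> simp
  · have hne : (({i + 1} : Finset ℕ) ∪ (Finset.Ioo i j).filter (A i)).Nonempty := by simp
    obtain ⟨k, hk, hmax⟩ := Finset.exists_max_image _ id hne
    simp only [Finset.mem_union, Finset.mem_singleton, Finset.mem_filter, Finset.mem_Ioo, id]
      at hk hmax
    have hik : i < k := by omega
    have hkj : k < j := by omega
    obtain ⟨C, hC, hCU, hCA, hCs⟩ := ih (k - i) (by omega) i k hik rfl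
    obtain ⟨D, hD, hDU, hDA, hDs⟩ := ih (j - k) (by omega) k j hkj rfl
    refine ⟨_, Side.glue i j k C D hC hD ?_, ?_, ?_, ?_⟩
    · rw [hCU, hDU]
      rintro x ⟨⟨_, h⟩, ⟨h', _⟩⟩
      exact le_antisymm h h'
    · rw [Set.sUnion_insert, Set.sUnion_union, hCU, hDU]
      ext x
      simp only [Set.mem_union, Set.mem_insert_iff, Set.mem_singleton_iff, Set.mem_Icc]
      omega
    · intro x y hx hxy hy hAxy
      by_cases hyk : y ≤ k
      · exact Or.inr (Or.inl (hCA x y hx hxy hyk hAxy))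
      by_cases hkx : k ≤ x
      · exact Or.inr (Or.inr (hDA x y hkx hxy hy hAxy))
      rcases hx.eq_or_lt with rfl | hix
      · rcases hy.eq_or_lt with rfl | hyj
        · exact Or.inl rfl
        · have := hmax y (Or.inr ⟨⟨hxy, hyj⟩, hAxy⟩)
          omega
      · rcases hk with hk | hk
        · omega
        · exact (hA i x k y hix (by omega) (by omega) hk.2 hAxy).elim
    · intro x hx hx'
      rcases le_total x k with h | h
      · exact Or.inr (Or.inl (hCs x hx h))
      · exact Or.inr (Or.inr (hDs x h hx'))

/-- A planar drawing of the complex `C` all of whose edges have length in `(1/2, 1]`, and which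
stays in the region `R` apart from the edge `uv`. -/
structure IsDrawing {α : Type} (R : Set ℂ) (u v : α) (C : Set (Set α)) (ρ : α → ℂ) : Prop where
  inter : ∀ s ∈ C, ∀ t ∈ C,
    convexHull ℝ (ρ '' s) ∩ convexHull ℝ (ρ '' t) ⊆ convexHull ℝ (ρ '' (s ∩ t))
  length : ∀ x y, x ≠ y → {x, y} ∈ C → 1 / 2 < dist (ρ x) (ρ y) ∧ dist (ρ x) (ρ y) ≤ 1
  region : ∀ s ∈ C, convexHull ℝ (ρ '' s) ⊆ R ∪ segment ℝ (ρ u) (ρ v)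

/-- `C` has a drawing in the region `R` placing `u` at `p` and `v` at `q`. -/
def Drawable {α : Type} (R : Set ℂ) (u v : α) (C : Set (Set α)) (p q : ℂ) : Prop :=
  ∃ ρ : α → ℂ, ρ u = p ∧ ρ v = q ∧ IsDrawing R u v C ρ

theorem mem_of_hull_inter {α : Type} {C : Set (Set α)} {ρ : α → ℂ} {R : Set ℂ} {u v : α}
    (h : IsDrawing R u v C ρ) {s : Set α} (hs : s ∈ C) {w : α} (hw : {w} ∈ C)
    (hws : ρ w ∈ convexHull ℝ (ρ '' s)) : w ∈ s := by
  have := h.inter s hs {w} hw ⟨hws, by simp⟩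
  by_contra hn
  rw [Set.inter_singleton_eq_empty.2 hn] at this
  simp at this

theorem drawable_edge {α : Type} (R : Set ℂ) {u v : α} (huv : u ≠ v) {p q : ℂ}
    (h : 1 / 2 < dist p q ∧ dist p q ≤ 1) : Drawable R u v {{u}, {v}, {u, v}} p q := by
  classical
  have hpq : p ≠ q := by
    rintro rfl
    have := h.1
    rw [dist_self] at this
    norm_num at this
  refine ⟨fun x => if x = u then p else q, by simp, by simp [huv.symm], ?_, ?_, ?_⟩
  · have h1 : ({u} ∩ {v} : Set α) = ∅ := by simpa using huv.symm
    have h2 : ({v} ∩ {u} : Set α) = ∅ := by simpa using huv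
    have e1 : ({u} ∩ {u, v} : Set α) = {u} := by simp
    have e2 : ({v} ∩ {u, v} : Set α) = {v} := by simp
    have e3 : ({u, v} ∩ {u} : Set α) = {u} := by rw [Set.inter_comm, e1]
    have e4 : ({u, v} ∩ {v} : Set α) = {v} := by rw [Set.inter_comm, e2]
    rintro s (rfl | rfl | rfl) t (rfl | rfl | rfl) <;>
      simp [h1, h2, e1, e2, e3, e4, Set.image_pair, huv.symm, hpq, hpq.symm,
        convexHull_pair, -Set.singleton_inter_eq_empty, -Set.inter_singleton_eq_empty]
  · intro x y hxy hm
    simp only [Set.mem_insert_iff, Set.mem_singleton_iff, Set.pair_eq_pair_iff] at hm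
    rcases hm with hm | hm | ⟨rfl, rfl⟩ | ⟨rfl, rfl⟩
    · exact (hxy ((hm ▸ (by simp) : x ∈ ({u} : Set α)).trans
        (hm ▸ (by simp) : y ∈ ({u} : Set α)).symm)).elim
    · exact (hxy ((hm ▸ (by simp) : x ∈ ({v} : Set α)).trans
        (hm ▸ (by simp) : y ∈ ({v} : Set α)).symm)).elim
    · simpa [huv.symm] using h
    · simpa [huv.symm, dist_comm] using h
  · rintro s (rfl | rfl | rfl) <;>
      simp [Set.image_pair, huv.symm, convexHull_pair, left_mem_segment, right_mem_segment]

theorem Drawable.glue {α : Type} {R R₁ R₂ : Set ℂ} {u v w : α} {C D : Set (Set α)} {p q r : ℂ}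
    (h₁ : Drawable R₁ u w C p r) (h₂ : Drawable R₂ w v D r q)
    (hu : {u} ∈ C) (hw : {w} ∈ C) (hw' : {w} ∈ D) (hv : {v} ∈ D)
    (hCD : ⋃₀ C ∩ ⋃₀ D ⊆ {w}) (hpq : 1 / 2 < dist p q ∧ dist p q ≤ 1)
    (h12 : (R₁ ∪ segment ℝ p r) ∩ (R₂ ∪ segment ℝ r q) ⊆ {r})
    (h1 : (R₁ ∪ segment ℝ p r) ∩ segment ℝ p q ⊆ {p})
    (h2 : (R₂ ∪ segment ℝ r q) ∩ segment ℝ p q ⊆ {q})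
    (hR₁ : R₁ ∪ segment ℝ p r ⊆ R ∪ segment ℝ p q)
    (hR₂ : R₂ ∪ segment ℝ r q ⊆ R ∪ segment ℝ p q) :
    Drawable R u v (insert {u, v} (C ∪ D)) p q := by
  classical
  obtain ⟨ρ₁, rfl, rfl, d₁⟩ := h₁
  obtain ⟨ρ₂, hr, rfl, d₂⟩ := h₂
  set ρ : α → ℂ := fun x => if x ∈ ⋃₀ C then ρ₁ x else ρ₂ x with hρ
  have e₁ : ∀ x ∈ ⋃₀ C, ρ x = ρ₁ x := fun x hx => if_pos hx
  have e₂ : ∀ x ∈ ⋃₀ D, ρ x = ρ₂ x := by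
    intro x hx
    by_cases hxC : x ∈ ⋃₀ C
    · obtain rfl : x = w := hCD ⟨hxC, hx⟩
      rw [e₁ x hxC, hr]
    · exact if_neg hxC
  have hsub : ∀ {E : Set (Set α)} {s : Set α}, s ∈ E → s ⊆ ⋃₀ E :=
    fun h => Set.subset_sUnion_of_mem h
  have i₁ : ∀ s ⊆ ⋃₀ C, ρ '' s = ρ₁ '' s := fun s hs =>
    Set.image_congr fun x hx => e₁ x (hs hx)
  have i₂ : ∀ s ⊆ ⋃₀ D, ρ '' s = ρ₂ '' s := fun s hs =>
    Set.image_congr fun x hx => e₂ x (hs hx)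
  have eu : ρ u = ρ₁ u := e₁ u (hsub hu rfl)
  have ev : ρ v = ρ₂ v := e₂ v (hsub hv rfl)
  have ew : ρ w = ρ₁ w := e₁ w (hsub hw rfl)
  have dC : IsDrawing R₁ u w C ρ := by
    refine ⟨fun s hs t ht => ?_, fun x y hxy hm => ?_, fun s hs => ?_⟩
    · rw [i₁ s (hsub hs), i₁ t (hsub ht), i₁ _ (Set.inter_subset_left.trans (hsub hs))]
      exact d₁.inter s hs t ht
    · rw [e₁ x (hsub hm (by simp)), e₁ y (hsub hm (by simp))]
      exact d₁.length x y hxy hm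
    · rw [i₁ s (hsub hs), eu, ew]
      exact d₁.region s hs
  have dD : IsDrawing R₂ w v D ρ := by
    refine ⟨fun s hs t ht => ?_, fun x y hxy hm => ?_, fun s hs => ?_⟩
    · rw [i₂ s (hsub hs), i₂ t (hsub ht), i₂ _ (Set.inter_subset_left.trans (hsub hs))]
      exact d₂.inter s hs t ht
    · rw [e₂ x (hsub hm (by simp)), e₂ y (hsub hm (by simp))]
      exact d₂.length x y hxy hm
    · rw [i₂ s (hsub hs), ev, ew, ← hr]
      exact d₂.region s hs
  rw [← eu, ← ev] at hpq
  simp only [← eu, ← ev, ← ew] at h12 h1 h2 hR₁ hR₂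
  have huv : ρ '' {u, v} = {ρ u, ρ v} := Set.image_pair _ _ _
  have key : ∀ (s t : Set α) (x : α), x ∈ s → x ∈ t → ρ x ∈ convexHull ℝ (ρ '' (s ∩ t)) :=
    fun s t x hs ht => subset_convexHull ℝ _ ⟨x, ⟨hs, ht⟩, rfl⟩
  have cCD : ∀ s ∈ C, ∀ t ∈ D,
      convexHull ℝ (ρ '' s) ∩ convexHull ℝ (ρ '' t) ⊆ convexHull ℝ (ρ '' (s ∩ t)) := by
    rintro s hs t ht z ⟨hz, hz'⟩
    obtain rfl : z = ρ w := h12 ⟨dC.region s hs hz, dD.region t ht hz'⟩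
    exact key s t w (mem_of_hull_inter dC hs hw hz) (mem_of_hull_inter dD ht hw' hz')
  have cC : ∀ s ∈ C,
      convexHull ℝ (ρ '' s) ∩ convexHull ℝ (ρ '' {u, v}) ⊆ convexHull ℝ (ρ '' (s ∩ {u, v})) := by
    rintro s hs z ⟨hz, hz'⟩
    rw [huv, convexHull_pair] at hz'
    obtain rfl : z = ρ u := h1 ⟨dC.region s hs hz, hz'⟩
    exact key s _ u (mem_of_hull_inter dC hs hu hz) (by simp)
  have cD : ∀ s ∈ D,
      convexHull ℝ (ρ '' s) ∩ convexHull ℝ (ρ '' {u, v}) ⊆ convexHull ℝ (ρ '' (s ∩ {u, v})) := by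
    rintro s hs z ⟨hz, hz'⟩
    rw [huv, convexHull_pair] at hz'
    obtain rfl : z = ρ v := h2 ⟨dD.region s hs hz, hz'⟩
    exact key s _ v (mem_of_hull_inter dD hs hv hz) (by simp)
  refine ⟨ρ, eu, ev, ?_, ?_, ?_⟩
  · rintro s (rfl | hs | hs) t (rfl | ht | ht)
    · simp
    · rw [Set.inter_comm, Set.inter_comm _ t]
      exact cC t ht
    · rw [Set.inter_comm, Set.inter_comm _ t]
      exact cD t ht
    · exact cC s hs
    · exact dC.inter s hs t ht
    · exact cCD s hs t ht
    · exact cD s hs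
    · rw [Set.inter_comm, Set.inter_comm s]
      exact cCD t ht s hs
    · exact dD.inter s hs t ht
  · rintro x y hxy (hm | hm | hm)
    · rcases Set.pair_eq_pair_iff.1 hm with ⟨rfl, rfl⟩ | ⟨rfl, rfl⟩
      · exact hpq
      · rwa [dist_comm]
    · exact dC.length x y hxy hm
    · exact dD.length x y hxy hm
  · rintro s (rfl | hs | hs)
    · rw [huv, convexHull_pair]
      exact Set.subset_union_right
    · exact (dC.region s hs).trans hR₁
    · exact (dD.region s hs).trans hR₂

/-- The image of a drawing under the glide reflection `z ↦ a + d * conj z`. -/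
theorem Drawable.reflect {α : Type} {R R' : Set ℂ} {u v : α} {C : Set (Set α)} {p q : ℂ}
    (h : Drawable R u v C p q) (a d : ℂ) (hd : ‖d‖ = 1) {p' q' : ℂ}
    (hp : a + d * star p = p') (hq : a + d * star q = q')
    (hR : ∀ z ∈ R, a + d * star z ∈ R') : Drawable R' u v C p' q' := by
  subst hp hq
  obtain ⟨ρ, rfl, rfl, h⟩ := h
  let L : ℂ →ₗ[ℝ] ℂ := (LinearMap.mulLeft ℝ d) ∘ₗ Complex.conjAe.toLinearMap
  let f : ℂ →ᵃ[ℝ] ℂ := AffineMap.const ℝ ℂ a + L.toAffineMap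
  have hf : ∀ z, f z = a + d * star z := fun z => rfl
  have hdist : ∀ z w, dist (f z) (f w) = dist z w := by
    intro z w
    rw [hf, hf, dist_add_left, dist_eq_norm, ← mul_sub, norm_mul, hd, one_mul, ← star_sub,
      norm_star, dist_eq_norm]
  have hinj : Function.Injective f := fun z w h => by
    rw [← dist_eq_zero, ← hdist, h, dist_self]
  have him : ∀ s : Set α, convexHull ℝ ((fun x => f (ρ x)) '' s) =
      f '' convexHull ℝ (ρ '' s) := by
    intro s
    rw [AffineMap.image_convexHull, Set.image_image]
  refine ⟨fun x => f (ρ x), rfl, rfl, ?_, ?_, ?_⟩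
  · intro s hs t ht
    rw [him, him, him, ← Set.image_inter hinj]
    exact Set.image_mono (h.inter s hs t ht)
  · intro x y hxy hm
    rw [hdist]
    exact h.length x y hxy hm
  · intro s hs
    rw [him, ← image_segment]
    rintro _ ⟨z, hz, rfl⟩
    rcases h.region s hs hz with hz | hz
    · exact Or.inl (hR z hz)
    · exact Or.inr ⟨z, hz, rfl⟩


theorem Drawable.symm {α : Type} {R : Set ℂ} {u v : α} {C : Set (Set α)} {p q : ℂ}
    (h : Drawable R u v C p q) : Drawable R v u C q p := by
  obtain ⟨ρ, hp, hq, h⟩ := h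
  refine ⟨ρ, hq, hp, h.inter, h.length, fun s hs => ?_⟩
  rw [segment_symm]
  exact h.region s hs

theorem exists_of_mem_segment {p q z : ℂ} (h : z ∈ segment ℝ p q) :
    ∃ t : ℝ, 0 ≤ t ∧ t ≤ 1 ∧ z.re = p.re + t * (q.re - p.re) ∧
      z.im = p.im + t * (q.im - p.im) := by
  rw [segment_eq_image'] at h
  obtain ⟨t, ⟨h0, h1⟩, rfl⟩ := h
  exact ⟨t, h0, h1, by simp, by simp⟩

/-- The wedge with apex `0` between the positive real axis and the ray of slope `δ`. -/
def wedge (δ : ℝ) : Set ℂ := {z | 0 < z.im ∧ z.im < δ * z.re}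

/-- The strip bounded by the real axis, the line through `p` with direction `d`, and the line
through `0` and `p`. -/
def strip (p d : ℂ) : Set ℂ :=
  {z | 0 < z.im ∧ d.re * (z.im - p.im) - d.im * (z.re - p.re) < 0 ∧
    p.re * z.im - p.im * z.re < 0}

/-- With the edge `uv` of length `1`, the polygon can be drawn in arbitrarily thin wedges. -/
def LongDrawable {α : Type} (u v : α) (C : Set (Set α)) : Prop :=
  ∀ δ : ℝ, 0 < δ → Drawable (wedge δ) u v C 0 1

/-- With the edge `uv` slightly longer than `1 / 2`, the polygon can be drawn in any strip that is
close enough to a horizontal one. -/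
def ShortDrawable {α : Type} (u v : α) (C : Set (Set α)) : Prop :=
  ∀ T : ℝ, 0 < T → T ≤ 1 / 4 → ∃ η : ℝ, 0 < η ∧ ∀ p d : ℂ, |p.re - 1 / 2| < η →
    |p.im - T| < η → d.re ^ 2 + d.im ^ 2 = 1 → 0 < d.re → 0 < d.im → d.im < η →
      Drawable (strip p d) u v C 0 p

theorem dist_zero_bounds {T η : ℝ} (hT : 0 < T) (hT' : T ≤ 1 / 4) (hη : η ≤ T ^ 2 / 4) {p : ℂ}
    (hre : |p.re - 1 / 2| < η) (him : |p.im - T| < η) :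
    1 / 2 < dist 0 p ∧ dist 0 p ≤ 1 := by
  rw [dist_zero_left, Complex.norm_def, Complex.normSq_apply]
  rw [abs_lt] at hre him
  have hTT : T ^ 2 / 4 ≤ T / 16 := by nlinarith
  have h1 : 0 < 1 / 2 - T ^ 2 / 4 := by nlinarith
  have h2 : (1 / 2 - T ^ 2 / 4) ^ 2 ≤ p.re ^ 2 := by
    apply pow_le_pow_left₀ h1.le
    linarith
  have h3 : (T * (15 / 16)) ^ 2 ≤ p.im ^ 2 := by
    apply pow_le_pow_left₀ (by positivity)
    linarith
  constructor
  · apply Real.lt_sqrt_of_sq_lt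
    nlinarith
  · rw [Real.sqrt_le_one]
    nlinarith

theorem norm_eq_one_of_sq {d : ℂ} (h : d.re ^ 2 + d.im ^ 2 = 1) : ‖d‖ = 1 := by
  rw [Complex.norm_def, Complex.normSq_apply, ← sq, ← sq, h, Real.sqrt_one]

theorem longDrawable_edge {α : Type} {u v : α} (huv : u ≠ v) :
    LongDrawable u v {{u}, {v}, {u, v}} := fun _ _ =>
  drawable_edge _ huv (by norm_num)

theorem shortDrawable_edge {α : Type} {u v : α} (huv : u ≠ v) :
    ShortDrawable u v {{u}, {v}, {u, v}} := fun T hT hT' =>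
  ⟨T ^ 2 / 4, by positivity, fun _ _ hre him _ _ _ _ =>
    drawable_edge _ huv (dist_zero_bounds hT hT' le_rfl hre him)⟩

theorem bend_estimates {T η μ a b c e f : ℝ} (hT : 0 < T) (hT' : T ≤ 1 / 4)
    (hμη : μ ≤ η / 8) (hμT : μ ≤ T ^ 2 / 4) (ha1 : -μ < a - 1 / 2) (ha2 : a - 1 / 2 < μ)
    (hb1 : -μ < b - T) (hb2 : b - T < μ) (hd : c ^ 2 + (2 * f) ^ 2 = 1) (hc : 0 < c)
    (hf : 0 < f) (hfμ : 2 * f < μ) (he : 0 < e) (hef : e ^ 2 + f ^ 2 = 1) :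
    0 < a ∧ 0 < b ∧ 0 < e - a ∧ f < b ∧ e ≤ 1 ∧ 0 < 2 * f * e - c * f ∧ 2 * f * e - c * f < η ∧
      0 < e * b - f * a ∧ 0 < c * b - 2 * f * a ∧
      |(e - a) * c + (f - b) * (2 * f) - 1 / 2| < η ∧
      |(e - a) * (2 * f) - (f - b) * c - T| < η := by
  have hTT : T ^ 2 / 4 ≤ T / 16 := by nlinarith
  have he1 : e ≤ 1 := (sq_le_one_iff₀ he.le).1 (by linarith [sq_nonneg f])
  have hc1 : c ≤ 1 := (sq_le_one_iff₀ hc.le).1 (by linarith [sq_nonneg (2 * f)])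
  have hf2 : 4 * f ^ 2 ≤ f := by
    have : f * (4 * f) ≤ f * 1 := mul_le_mul_of_nonneg_left (by linarith) hf.le
    linarith
  have hce : c < e := lt_of_pow_lt_pow_left₀ 2 he.le (by linarith [pow_pos hf 2])
  have hc0 : 1 - f ≤ c := by
    have : c * c ≤ c := mul_le_of_le_one_right hc.le hc1
    linarith
  have hb : 0 < b := by linarith
  have ha : 0 < a := by linarith
  have hae : 0 < e - a := by linarith
  have hbf : f < b := by linarith
  have k1 : f * a ≤ f := mul_le_of_le_one_right hf.le (by linarith)
  have k2 : b * (1 - c) ≤ 1 - c := mul_le_of_le_one_left (by linarith) (by linarith)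
  have k3 : b * (1 - e) ≤ 1 - e := mul_le_of_le_one_left (by linarith) (by linarith)
  have k4 : 0 < f * (2 * e - c) := mul_pos hf (by linarith)
  have k5 : 2 * f * e ≤ 2 * f := mul_le_of_le_one_right (by linarith) he1
  have k6 : 0 < c * f := mul_pos hc hf
  have m1 : (e - a) * c ≤ e - a := mul_le_of_le_one_right hae.le hc1
  have m2 : (e - a) * (1 - c) ≤ 1 - c := mul_le_of_le_one_left (by linarith) (by linarith)
  have m3 : (b - f) * (2 * f) ≤ 2 * f := mul_le_of_le_one_left (by linarith) (by linarith)
  have m4 : 0 ≤ (b - f) * (2 * f) := mul_nonneg (by linarith) (by linarith)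
  have m5 : (e - a) * (2 * f) ≤ 2 * f := mul_le_of_le_one_left (by linarith) (by linarith)
  have m6 : 0 ≤ (e - a) * (2 * f) := mul_nonneg hae.le (by linarith)
  have m7 : (b - f) * c ≤ b - f := mul_le_of_le_one_right (by linarith) hc1
  have m8 : (b - f) * (1 - c) ≤ 1 - c := mul_le_of_le_one_left (by linarith) (by linarith)
  refine ⟨ha, hb, hae, hbf, he1, by linarith, by linarith, by linarith, by linarith, ?_, ?_⟩
  · rw [abs_lt]
    constructor <;> linarith
  · rw [abs_lt]
    constructor <;> linarith

/-- Gluing at a bend of a strip: a wedge along the edge from `0` to `e + f * I`, and the strip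
continuing between the line through that edge and the line through `a + b * I`. -/
theorem Drawable.glue_strip {α : Type} {u v w : α} {C D : Set (Set α)} {a b c s e f : ℝ}
    (hC : Drawable {z : ℂ | 0 < z.im ∧ e * z.im - f * z.re < 0} u w C 0 ⟨e, f⟩)
    (hD : Drawable {z : ℂ | c * (z.im - b) - s * (z.re - a) < 0 ∧
      0 < e * z.im - f * z.re ∧ 0 < (e - a) * (z.im - b) - (f - b) * (z.re - a)}
      w v D ⟨e, f⟩ ⟨a, b⟩)
    (hu : {u} ∈ C) (hw : {w} ∈ C) (hw' : {w} ∈ D) (hv : {v} ∈ D)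
    (hCD : ⋃₀ C ∩ ⋃₀ D ⊆ {w}) (hlen : 1 / 2 < dist 0 (⟨a, b⟩ : ℂ) ∧ dist 0 (⟨a, b⟩ : ℂ) ≤ 1)
    (hb : 0 < b) (hc : 0 < c) (hs : 0 < s) (hf : 0 < f)
    (hae : 0 < e - a) (hbf : f < b) (h_slope : 0 < s * e - c * f) (h_ep : 0 < e * b - f * a)
    (h_dp : 0 < c * b - s * a) :
    Drawable (strip ⟨a, b⟩ ⟨c, s⟩) u v (insert {u, v} (C ∪ D)) 0 ⟨a, b⟩ := by
  have t1 : ∀ z ∈ {z : ℂ | 0 < z.im ∧ e * z.im - f * z.re < 0} ∪ segment ℝ 0 ⟨e, f⟩,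
      z = 0 ∨ 0 < z.im ∧ e * z.im - f * z.re ≤ 0 := by
    rintro z (⟨h1, h2⟩ | hz)
    · exact Or.inr ⟨h1, h2.le⟩
    · obtain ⟨t, ht0, ht1, hx, hy⟩ := exists_of_mem_segment hz
      simp only [Complex.zero_re, Complex.zero_im, zero_add, sub_zero] at hx hy
      rcases ht0.eq_or_lt with rfl | ht
      · exact Or.inl (Complex.ext (by simpa using hx) (by simpa using hy))
      · refine Or.inr ⟨by rw [hy]; positivity, by rw [hx, hy]; linarith⟩
  have t2 : ∀ z ∈ {z : ℂ | c * (z.im - b) - s * (z.re - a) < 0 ∧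
      0 < e * z.im - f * z.re ∧ 0 < (e - a) * (z.im - b) - (f - b) * (z.re - a)} ∪
      segment ℝ ⟨e, f⟩ ⟨a, b⟩, z = ⟨a, b⟩ ∨ c * (z.im - b) - s * (z.re - a) < 0 ∧
      0 ≤ e * z.im - f * z.re ∧ 0 ≤ (e - a) * (z.im - b) - (f - b) * (z.re - a) := by
    rintro z (⟨h1, h2, h3⟩ | hz)
    · exact Or.inr ⟨h1, h2.le, h3.le⟩
    · rw [segment_symm] at hz
      obtain ⟨t, ht0, ht1, hx, hy⟩ := exists_of_mem_segment hz
      simp only at hx hy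
      rcases ht0.eq_or_lt with rfl | ht
      · exact Or.inl (Complex.ext (by simpa using hx) (by simpa using hy))
      · refine Or.inr ⟨?_, ?_, ?_⟩ <;> rw [hx, hy]
        · have h1 : 0 < t * (c * (b - f) + s * (e - a)) := by
            have : 0 < b - f := by linarith
            positivity
          linarith
        · have h1 : 0 ≤ (1 - t) * (e * b - f * a) := mul_nonneg (by linarith) h_ep.le
          linarith
        · linarith
  have r1 : ∀ z : ℂ, 0 < z.im → e * z.im - f * z.re ≤ 0 → z ∈ strip ⟨a, b⟩ ⟨c, s⟩ := by
    intro z h1 h2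
    refine ⟨h1, ?_, ?_⟩
    · simp only
      have h3 : s * (e * z.im - f * z.re) ≤ 0 := mul_nonpos_of_nonneg_of_nonpos hs.le h2
      have h4 : 0 < z.im * (s * e - c * f) := mul_pos h1 h_slope
      have h5 : f * (c * z.im - s * z.re) < f * 0 := by linarith
      have := lt_of_mul_lt_mul_left h5 hf.le
      linarith
    · simp only
      have h3 : b * (e * z.im - f * z.re) ≤ 0 := mul_nonpos_of_nonneg_of_nonpos hb.le h2
      have h4 : 0 < z.im * (e * b - f * a) := mul_pos h1 h_ep
      have h5 : f * (a * z.im - b * z.re) < f * 0 := by linarith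
      exact lt_of_mul_lt_mul_left h5 hf.le
  have r2 : ∀ z : ℂ, c * (z.im - b) - s * (z.re - a) < 0 → 0 ≤ e * z.im - f * z.re →
      0 ≤ (e - a) * (z.im - b) - (f - b) * (z.re - a) → z ∈ strip ⟨a, b⟩ ⟨c, s⟩ := by
    intro z h1 h2 h3
    have hbf' : 0 < b - f := by linarith
    have h4 : a * z.im - b * z.re < 0 := by
      have k1 : (c * (b - f) + s * (e - a)) * (a * z.im - b * z.re) =
          (e * b - f * a) * (c * (z.im - b) - s * (z.re - a)) -
          (c * b - s * a) * ((e - a) * (z.im - b) - (f - b) * (z.re - a)) := by ring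
      have k2 := mul_neg_of_pos_of_neg h_ep h1
      have k3 := mul_nonneg h_dp.le h3
      have k4 : 0 < c * (b - f) + s * (e - a) := by positivity
      exact neg_of_mul_neg_right (by linarith) k4.le
    refine ⟨?_, h1, h4⟩
    have k1 : (e * b - f * a) * (z.im - f) = (b - f) * (e * z.im - f * z.re) +
        f * ((e - a) * (z.im - b) - (f - b) * (z.re - a)) := by ring
    have k2 := mul_nonneg hbf'.le h2
    have k3 := mul_nonneg hf.le h3
    have k4 : 0 ≤ z.im - f := nonneg_of_mul_nonneg_right (by linarith) h_ep
    linarith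
  have e1 : ∀ z ∈ {z : ℂ | 0 < z.im ∧ e * z.im - f * z.re < 0} ∪ segment ℝ 0 ⟨e, f⟩,
      e * z.im - f * z.re ≤ 0 := by
    intro z hz
    rcases t1 z hz with rfl | h
    · simp
    · exact h.2
  have e2 : ∀ z ∈ {z : ℂ | c * (z.im - b) - s * (z.re - a) < 0 ∧
      0 < e * z.im - f * z.re ∧ 0 < (e - a) * (z.im - b) - (f - b) * (z.re - a)} ∪
      segment ℝ ⟨e, f⟩ ⟨a, b⟩, z = ⟨e, f⟩ ∨ 0 < e * z.im - f * z.re := by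
    rintro z (⟨h1, h2, h3⟩ | hz)
    · exact Or.inr h2
    · obtain ⟨t, ht0, ht1, hx, hy⟩ := exists_of_mem_segment hz
      simp only at hx hy
      rcases ht0.eq_or_lt with rfl | ht
      · exact Or.inl (Complex.ext (by simpa using hx) (by simpa using hy))
      · have := mul_pos ht h_ep
        refine Or.inr ?_
        rw [hx, hy]
        linarith
  have hseg : ∀ z ∈ segment ℝ 0 (⟨a, b⟩ : ℂ), z ∉ strip ⟨a, b⟩ ⟨c, s⟩ := by
    rintro z hz ⟨-, -, h⟩
    obtain ⟨t, ht0, ht1, hx, hy⟩ := exists_of_mem_segment hz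
    simp only [Complex.zero_re, Complex.zero_im, zero_add, sub_zero] at hx hy h
    rw [hx, hy] at h
    linarith
  refine hC.glue hD hu hw hw' hv hCD hlen ?_ ?_ ?_ ?_ ?_
  · rintro z ⟨hz, hz'⟩
    have := e1 z hz
    rcases e2 z hz' with h | h
    · exact h
    · linarith
  · rintro z ⟨hz, hz'⟩
    rcases t1 z hz with h | h
    · exact h
    · exact (hseg z hz' (r1 z h.1 h.2)).elim
  · rintro z ⟨hz, hz'⟩
    rcases t2 z hz with h | h
    · exact h
    · exact (hseg z hz' (r2 z h.1 h.2.1 h.2.2)).elim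
  · intro z hz
    rcases t1 z hz with rfl | h
    · exact Or.inr (left_mem_segment ℝ _ _)
    · exact Or.inl (r1 z h.1 h.2)
  · intro z hz
    rcases t2 z hz with rfl | h
    · exact Or.inr (right_mem_segment ℝ _ _)
    · exact Or.inl (r2 z h.1 h.2.1 h.2.2)

theorem LongDrawable.shortDrawable_insert {α : Type} {u v w : α} {C D : Set (Set α)}
    (hL : LongDrawable u w C) (hS : ShortDrawable v w D)
    (hu : {u} ∈ C) (hw : {w} ∈ C) (hw' : {w} ∈ D) (hv : {v} ∈ D)
    (hCD : ⋃₀ C ∩ ⋃₀ D ⊆ {w}) : ShortDrawable u v (insert {u, v} (C ∪ D)) := by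
  intro T hT hT'
  obtain ⟨η, hη, hS⟩ := hS T hT hT'
  obtain ⟨μ, hμ, hμη, hμT⟩ : ∃ μ, 0 < μ ∧ μ ≤ η / 8 ∧ μ ≤ T ^ 2 / 4 :=
    ⟨min (η / 8) (T ^ 2 / 4), by positivity, min_le_left _ _, min_le_right _ _⟩
  refine ⟨μ, hμ, ?_⟩
  intro p d hre him hd hc hs hsμ
  have hlen := dist_zero_bounds hT hT' hμT hre him
  obtain ⟨a, b⟩ := p
  obtain ⟨c, s⟩ := d
  simp only [abs_lt] at hre him hd hc hs hsμ
  obtain ⟨f, rfl⟩ : ∃ f, s = 2 * f := ⟨s / 2, by ring⟩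
  have hf : 0 < f := by linarith
  obtain ⟨e, he, hef⟩ : ∃ e : ℝ, 0 < e ∧ e ^ 2 + f ^ 2 = 1 := by
    have : 0 < 1 - f ^ 2 := by linarith [pow_pos hf 2, pow_pos hc 2]
    exact ⟨√(1 - f ^ 2), Real.sqrt_pos.2 this, by rw [Real.sq_sqrt this.le]; ring⟩
  obtain ⟨ha, hb, hae, hbf, he1, h_slope, h_slope', h_ep, h_dp, hre', him'⟩ :=
    bend_estimates hT hT' hμη hμT hre.1 hre.2 him.1 him.2 hd hc hf hsμ he hef
  refine Drawable.glue_strip (e := e) (f := f) ?_ (Drawable.symm ?_) hu hw hw' hv hCD hlen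
    hb hc hs hf hae hbf h_slope h_ep h_dp
  · refine (hL f hf).reflect 0 ⟨e, f⟩ (norm_eq_one_of_sq hef) (by simp) (by simp) ?_
    rintro ⟨x, y⟩ ⟨hy, hyx⟩
    simp only [zero_add, Set.mem_ofPred_eq, Complex.mul_im, Complex.mul_re, Complex.star_def,
      Complex.conj_re, Complex.conj_im] at hy hyx ⊢
    constructor
    · linarith [mul_le_mul_of_nonneg_right he1 hy.le]
    · linear_combination hy - y * hef
  · refine (hS ⟨(e - a) * c + (f - b) * (2 * f), (e - a) * (2 * f) - (f - b) * c⟩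
      ⟨c * e + 2 * f * f, 2 * f * e - c * f⟩ hre' him' ?_ ?_ h_slope h_slope').reflect
      ⟨a, b⟩ ⟨c, 2 * f⟩ (norm_eq_one_of_sq hd) ?_ ?_ ?_
    · linear_combination hef + (e ^ 2 + f ^ 2) * hd
    · simp only
      positivity
    · simp
    · apply Complex.ext
      · simp
        linear_combination (e - a) * hd
      · simp
        linear_combination (f - b) * hd
    · rintro ⟨x, y⟩ ⟨hy, hyx, hyp⟩
      simp only [Set.mem_ofPred_eq, Complex.mul_im, Complex.mul_re, Complex.star_def,
        Complex.conj_re, Complex.conj_im, Complex.add_re, Complex.add_im] at hy hyx hyp ⊢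
      refine ⟨?_, ?_, ?_⟩
      · linear_combination hy - y * hd
      · linear_combination hyx + (e * b - f * a) * hd
      · linear_combination hyp

/-- Gluing at the apex of a triangle over the unit interval, inside a thin wedge. -/
theorem Drawable.glue_wedge {α : Type} {u v w : α} {C D : Set (Set α)} {T δ c s k l g h : ℝ}
    (hC : Drawable {z : ℂ | k * z.im - l * z.re < 0 ∧ 0 < g * (z.im - T) - h * (z.re - 1 / 2) ∧
      0 < 1 / 2 * z.im - T * z.re} u w C 0 ⟨1 / 2, T⟩)
    (hD : Drawable {z : ℂ | 0 < z.im ∧ c * (z.im - T) - s * (z.re - 1 / 2) < 0 ∧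
      0 < 1 / 2 * (z.im - T) + T * (z.re - 1 / 2)} w v D ⟨1 / 2, T⟩ 1)
    (hu : {u} ∈ C) (hw : {w} ∈ C) (hw' : {w} ∈ D) (hv : {v} ∈ D)
    (hCD : ⋃₀ C ∩ ⋃₀ D ⊆ {w}) (hT : 0 < T) (hTδ : T < δ / 2) (hc : 0 < c) (hs : 0 < s)
    (hsδ : s ≤ c * δ) (hk : 0 < k) (hl : 0 < l) (hlδ : l < δ * k) (h_apex : T * k < l / 2)
    (hg : 0 < g) (h_slope : g * s ≤ h * c) :
    Drawable (wedge δ) u v (insert {u, v} (C ∪ D)) 0 1 := by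
  have hre : ∀ z : ℂ, c * (z.im - T) - s * (z.re - 1 / 2) < 0 →
      0 < 1 / 2 * (z.im - T) + T * (z.re - 1 / 2) → 0 < z.re - 1 / 2 := by
    intro z h1 h2
    have h3 := mul_pos hc h2
    have h4 : 0 < (s / 2 + c * T) * (z.re - 1 / 2) := by linarith
    have h5 : 0 < s / 2 + c * T := by positivity
    exact pos_of_mul_pos_right h4 h5.le
  have t1 : ∀ z ∈ {z : ℂ | k * z.im - l * z.re < 0 ∧ 0 < g * (z.im - T) - h * (z.re - 1 / 2) ∧
      0 < 1 / 2 * z.im - T * z.re} ∪ segment ℝ 0 ⟨1 / 2, T⟩, z = 0 ∨ z ∈ wedge δ := by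
    rintro z (⟨h1, -, h3⟩ | hz)
    · have h4 := mul_pos hl h3
      have h5 := mul_neg_of_pos_of_neg hT h1
      have h6 : 0 < (l / 2 - T * k) * z.im := by linarith
      have him : 0 < z.im := pos_of_mul_pos_right h6 (by linarith)
      have h7 := mul_pos hk him
      have hre : 0 < z.re := pos_of_mul_pos_right (by linarith) hl.le
      refine Or.inr ⟨him, lt_of_mul_lt_mul_left (a := k) ?_ hk.le⟩
      linarith [mul_lt_mul_of_pos_right hlδ hre]
    · obtain ⟨t, ht0, ht1, hx, hy⟩ := exists_of_mem_segment hz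
      simp only [Complex.zero_re, Complex.zero_im, zero_add, sub_zero] at hx hy
      rcases ht0.eq_or_lt with rfl | ht
      · exact Or.inl (Complex.ext (by simpa using hx) (by simpa using hy))
      · refine Or.inr ⟨by rw [hy]; positivity, ?_⟩
        rw [hx, hy]
        linarith [mul_lt_mul_of_pos_left hTδ ht]
  have t2 : ∀ z ∈ {z : ℂ | 0 < z.im ∧ c * (z.im - T) - s * (z.re - 1 / 2) < 0 ∧
      0 < 1 / 2 * (z.im - T) + T * (z.re - 1 / 2)} ∪ segment ℝ ⟨1 / 2, T⟩ 1,
      z = 1 ∨ z ∈ wedge δ := by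
    rintro z (⟨h1, h2, h3⟩ | hz)
    · refine Or.inr ⟨h1, lt_of_mul_lt_mul_left (a := c) ?_ hc.le⟩
      linarith [mul_le_mul_of_nonneg_right hsδ (hre z h2 h3).le, mul_lt_mul_of_pos_left hTδ hc]
    · rw [segment_symm] at hz
      obtain ⟨t, ht0, ht1, hx, hy⟩ := exists_of_mem_segment hz
      simp only [Complex.one_re, Complex.one_im, zero_add, sub_zero] at hx hy
      rcases ht0.eq_or_lt with rfl | ht
      · exact Or.inl (Complex.ext (by simpa using hx) (by simpa using hy))
      · refine Or.inr ⟨by rw [hy]; positivity, ?_⟩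
        rw [hx, hy]
        linarith [mul_le_mul_of_nonneg_right ht1 hT.le,
          mul_le_mul_of_nonneg_right ht1 (by linarith : 0 ≤ δ)]
  have hseg : ∀ z ∈ segment ℝ (0 : ℂ) 1, z ∉ wedge δ := by
    rintro z hz ⟨h, -⟩
    obtain ⟨t, ht0, ht1, hx, hy⟩ := exists_of_mem_segment hz
    simp [hy] at h
  refine hC.glue hD hu hw hw' hv hCD (by norm_num) ?_ ?_ ?_ ?_ ?_
  · rintro z ⟨⟨h1, h2, h3⟩ | hz, ⟨h4, h5, h6⟩ | hz'⟩
    · have h7 := hre z h5 h6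
      have h8 := mul_neg_of_pos_of_neg hg h5
      have h9 := mul_pos hc h2
      linarith [mul_le_mul_of_nonneg_right h_slope h7.le]
    · obtain ⟨t, ht0, ht1, hx, hy⟩ := exists_of_mem_segment hz'
      simp only [Complex.one_re, Complex.one_im] at hx hy
      rw [hx, hy] at h3
      linarith [mul_nonneg ht0 hT.le]
    · obtain ⟨t, ht0, ht1, hx, hy⟩ := exists_of_mem_segment hz
      simp only [Complex.zero_re, Complex.zero_im] at hx hy
      rw [hx, hy] at h6
      linarith [mul_le_mul_of_nonneg_right ht1 hT.le]
    · obtain ⟨t, ht0, ht1, hx, hy⟩ := exists_of_mem_segment hz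
      obtain ⟨t', ht0', ht1', hx', hy'⟩ := exists_of_mem_segment hz'
      simp only [Complex.zero_re, Complex.zero_im, Complex.one_re, Complex.one_im] at hx hy hx' hy'
      have h1 : t' * T = 0 := by
        linear_combination T * (hx - hx') - (hy - hy') / 2
      obtain rfl : t' = 0 := (mul_eq_zero.1 h1).resolve_right hT.ne'
      exact Complex.ext (by simpa using hx') (by simpa using hy')
  · rintro z ⟨hz, hz'⟩
    rcases t1 z hz with h | h
    · exact h
    · exact (hseg z hz' h).elim
  · rintro z ⟨hz, hz'⟩
    rcases t2 z hz with h | h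
    · exact h
    · exact (hseg z hz' h).elim
  · intro z hz
    rcases t1 z hz with rfl | h
    · exact Or.inr (left_mem_segment ℝ _ _)
    · exact Or.inl h
  · intro z hz
    rcases t2 z hz with rfl | h
    · exact Or.inr (right_mem_segment ℝ _ _)
    · exact Or.inl h

theorem apex_estimates {T δ c s k l μ : ℝ} (hT : 0 < T) (hT' : T ≤ 1 / 8) (hTδ : T ≤ δ / 8)
    (hk : k * (1 / 4 + T ^ 2) = 1 / 4 - T ^ 2) (hl : l * (1 / 4 + T ^ 2) = T)
    (hc : 0 < c) (hs : 0 < s) (hd : c ^ 2 + s ^ 2 = 1) (hsT : s ≤ T / 4) (hsμ : 2 * s < μ) :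
    s ≤ c * δ ∧ 0 < k ∧ 0 < l ∧ l < δ * k ∧ T * k < l / 2 ∧ k ^ 2 + l ^ 2 = 1 ∧
      0 < k * c + l * s ∧ (k * c + l * s) * s ≤ (l * c - k * s) * c ∧
      |c / 2 - s * T - 1 / 2| < μ ∧ |c * T + s / 2 - T| < μ := by
  have hTT : T ^ 2 ≤ T * (1 / 8) := by rw [sq]; exact mul_le_mul_of_nonneg_left hT' hT.le
  have hN : 0 < 1 / 4 + T ^ 2 := by positivity
  have hk0 : 0 < k := pos_of_mul_pos_left (by linarith) hN.le
  have hl0 : 0 < l := pos_of_mul_pos_left (by linarith) hN.le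
  have hc1 : c ≤ 1 := (sq_le_one_iff₀ hc.le).1 (by linarith [sq_nonneg s])
  have hss : s ^ 2 ≤ s * (1 / 32) := by
    rw [sq]; exact mul_le_mul_of_nonneg_left (by linarith) hs.le
  have hcc : 1 - s / 32 ≤ c := by
    have : c * c ≤ c := mul_le_of_le_one_right hc.le hc1
    linarith
  have hkl : k ^ 2 + l ^ 2 = 1 := by
    have h1 : (k ^ 2 + l ^ 2) * (1 / 4 + T ^ 2) ^ 2 = 1 * (1 / 4 + T ^ 2) ^ 2 := by
      linear_combination (k * (1 / 4 + T ^ 2) + (1 / 4 - T ^ 2)) * hk +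
        (l * (1 / 4 + T ^ 2) + T) * hl
    exact mul_right_cancel₀ (by positivity) h1
  have hk1 : k ≤ 1 := (sq_le_one_iff₀ hk0.le).1 (by linarith [sq_nonneg l])
  have hl3 : 3 * T ≤ l := by
    have := mul_le_mul_of_nonneg_left hTT hl0.le
    have := mul_le_mul_of_nonneg_left hT' hl0.le
    linarith
  have hδ : 0 < δ := by linarith
  have hsT1 : s * T ≤ s * (1 / 8) := mul_le_mul_of_nonneg_left hT' hs.le
  have hsT0 : 0 < s * T := mul_pos hs hT
  have hcT : (1 - c) * T ≤ 1 - c := mul_le_of_le_one_right (by linarith) (by linarith)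
  have hcT0 : 0 ≤ (1 - c) * T := mul_nonneg (by linarith) hT.le
  refine ⟨?_, hk0, hl0, ?_, ?_, hkl, by positivity, ?_, ?_, ?_⟩
  · have : (1 / 2) * δ ≤ c * δ := mul_le_mul_of_nonneg_right (by linarith) hδ.le
    linarith
  · refine lt_of_mul_lt_mul_right (a := 1 / 4 + T ^ 2) ?_ hN.le
    rw [hl, mul_assoc, hk]
    linarith [mul_le_mul_of_nonneg_left (by linarith : T ^ 2 ≤ 1 / 64) hδ.le]
  · refine lt_of_mul_lt_mul_right (a := 1 / 4 + T ^ 2) ?_ hN.le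
    rw [mul_assoc, hk]
    linarith [pow_pos hT 3]
  · have h1 : k * (c * s) ≤ c * s := mul_le_of_le_one_left (by positivity) hk1
    have h2 : c * s ≤ s := mul_le_of_le_one_left hs.le hc1
    have h3 : l * (1 / 2) ≤ l * (c ^ 2 - s ^ 2) :=
      mul_le_mul_of_nonneg_left (by linarith) hl0.le
    linarith
  · rw [abs_lt]
    constructor <;> linarith
  · rw [abs_lt]
    constructor <;> linarith

theorem ShortDrawable.longDrawable_insert {α : Type} {u v w : α} {C D : Set (Set α)}
    (hL : ShortDrawable u w C) (hS : ShortDrawable w v D)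
    (hu : {u} ∈ C) (hw : {w} ∈ C) (hw' : {w} ∈ D) (hv : {v} ∈ D)
    (hCD : ⋃₀ C ∩ ⋃₀ D ⊆ {w}) : LongDrawable u v (insert {u, v} (C ∪ D)) := by
  intro δ hδ
  obtain ⟨T, hT, hT', hTδ⟩ : ∃ T, 0 < T ∧ T ≤ 1 / 8 ∧ T ≤ δ / 8 :=
    ⟨min (1 / 8) (δ / 8), by positivity, min_le_left _ _, min_le_right _ _⟩
  obtain ⟨η₁, hη₁, hL⟩ := hL T hT (by linarith)
  obtain ⟨η₂, hη₂, hS⟩ := hS T hT (by linarith)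
  obtain ⟨s, hs, hsT, hs1, hs2⟩ : ∃ s, 0 < s ∧ s ≤ T / 4 ∧ s ≤ η₁ / 4 ∧ s ≤ η₂ / 4 :=
    ⟨min (T / 4) (min (η₁ / 4) (η₂ / 4)), by positivity, min_le_left _ _,
      (min_le_right _ _).trans (min_le_left _ _), (min_le_right _ _).trans (min_le_right _ _)⟩
  obtain ⟨c, hc, hd⟩ : ∃ c : ℝ, 0 < c ∧ c ^ 2 + s ^ 2 = 1 := by
    have : s ^ 2 < 1 := (sq_lt_one_iff₀ hs.le).2 (by linarith)
    exact ⟨√(1 - s ^ 2), Real.sqrt_pos.2 (by linarith), by rw [Real.sq_sqrt (by linarith)]; ring⟩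
  have hN : 1 / 4 + T ^ 2 ≠ 0 := by positivity
  obtain ⟨k, hk⟩ : ∃ k, k * (1 / 4 + T ^ 2) = 1 / 4 - T ^ 2 := ⟨_, div_mul_cancel₀ _ hN⟩
  obtain ⟨l, hl⟩ : ∃ l, l * (1 / 4 + T ^ 2) = T := ⟨_, div_mul_cancel₀ _ hN⟩
  obtain ⟨hsδ, hk0, hl0, hlδ, h_apex, hkl, hg, h_slope, hre, him⟩ :=
    apex_estimates (μ := η₂) hT hT' hTδ hk hl hc hs hd hsT (by linarith)
  refine Drawable.glue_wedge (g := k * c + l * s) (h := l * c - k * s) ?_ ?_ hu hw hw' hv hCD hT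
    (by linarith) hc hs hsδ hk0 hl0 hlδ h_apex hg h_slope
  · have h0 : k / 2 + l * T = 1 / 2 := by
      refine mul_right_cancel₀ hN ?_
      linear_combination hk / 2 + T * hl
    have h1 : l / 2 - k * T = T := by
      refine mul_right_cancel₀ hN ?_
      linear_combination hl / 2 - T * hk
    refine (hL ⟨1 / 2, T⟩ ⟨c, s⟩ (by simpa) (by simpa) hd hc hs
      (by simp only; linarith)).reflect 0 ⟨k, l⟩ (norm_eq_one_of_sq hkl) (by simp) ?_ ?_
    · apply Complex.ext
      · simp
        linear_combination h0
      · simp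
        linear_combination h1
    · rintro ⟨x, y⟩ ⟨hy, hyx, hyp⟩
      simp only [zero_add, Set.mem_ofPred_eq, Complex.mul_im, Complex.mul_re, Complex.star_def,
        Complex.conj_re, Complex.conj_im] at hy hyx hyp ⊢
      refine ⟨?_, ?_, ?_⟩
      · linear_combination hy - y * hkl
      · linear_combination hyx + (c * y - s * x) * hkl - c * h1 + s * h0
      · linear_combination hyp - x * h1 + y * h0
  · refine (hS ⟨c / 2 - s * T, c * T + s / 2⟩ ⟨c, s⟩ hre him hd hc hs
      (by simp only; linarith)).reflect ⟨1 / 2, T⟩ ⟨c, s⟩ (norm_eq_one_of_sq hd) (by simp) ?_ ?_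
    · apply Complex.ext
      · simp
        linear_combination hd / 2
      · simp
        linear_combination -T * hd
    · rintro ⟨x, y⟩ ⟨hy, hyx, hyp⟩
      simp only [Set.mem_ofPred_eq, Complex.mul_im, Complex.mul_re, Complex.star_def,
        Complex.conj_re, Complex.conj_im, Complex.add_re, Complex.add_im] at hy hyx hyp ⊢
      refine ⟨?_, ?_, ?_⟩
      · linear_combination hyx + T * hd
      · linear_combination hy - y * hd
      · linear_combination hyp

theorem Side.drawable {α : Type} {u v : α} {C : Set (Set α)} (h : Side u v C) :
    LongDrawable u v C ∧ LongDrawable v u C ∧ ShortDrawable u v C ∧ ShortDrawable v u C := by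
  induction h with
  | edge u v huv =>
    have e : ({{u}, {v}, {u, v}} : Set (Set α)) = {{v}, {u}, {v, u}} := by
      rw [Set.insert_comm, Set.pair_comm u v]
    refine ⟨longDrawable_edge huv, ?_, shortDrawable_edge huv, ?_⟩ <;> rw [e]
    · exact longDrawable_edge huv.symm
    · exact shortDrawable_edge huv.symm
  | glue u v w C D hC hD hCD ihC ihD =>
    obtain ⟨lC, lC', sC, sC'⟩ := ihC
    obtain ⟨lD, lD', sD, sD'⟩ := ihD
    have hDC : ⋃₀ D ∩ ⋃₀ C ⊆ {w} := by rwa [Set.inter_comm]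
    have e : insert {u, v} (C ∪ D) = insert {v, u} (D ∪ C) := by
      rw [Set.pair_comm, Set.union_comm]
    refine
      ⟨sC.longDrawable_insert sD hC.left_mem hC.right_mem hD.left_mem hD.right_mem hCD, ?_,
        lC.shortDrawable_insert sD' hC.left_mem hC.right_mem hD.left_mem hD.right_mem hCD, ?_⟩ <;> rw [e]
    · exact sD'.longDrawable_insert sC' hD.right_mem hD.left_mem hC.right_mem hC.left_mem hDC
    · exact lD'.shortDrawable_insert sC hD.right_mem hD.left_mem hC.right_mem hC.left_mem hDC

theorem orientation_pos {α β γ : ℝ} (h₁ : α < β) (h₂ : β < γ) (h₃ : γ < α + 2 * Real.pi) :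
    0 < (Real.cos β - Real.cos α) * (Real.sin γ - Real.sin α) -
      (Real.sin β - Real.sin α) * (Real.cos γ - Real.cos α) := by
  obtain ⟨x, rfl⟩ : ∃ x, β = α + 2 * x := ⟨(β - α) / 2, by ring⟩
  obtain ⟨y, rfl⟩ : ∃ y, γ = α + 2 * x + 2 * y := ⟨(γ - (α + 2 * x)) / 2, by ring⟩
  have hx : 0 < Real.sin x := Real.sin_pos_of_pos_of_lt_pi (by linarith) (by linarith)
  have hy : 0 < Real.sin y := Real.sin_pos_of_pos_of_lt_pi (by linarith) (by linarith)
  have hxy : 0 < Real.sin (x + y) := Real.sin_pos_of_pos_of_lt_pi (by linarith) (by linarith)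
  have key : (Real.cos (α + 2 * x) - Real.cos α) * (Real.sin (α + 2 * x + 2 * y) - Real.sin α) -
      (Real.sin (α + 2 * x) - Real.sin α) * (Real.cos (α + 2 * x + 2 * y) - Real.cos α) =
      4 * Real.sin x * Real.sin y * Real.sin (x + y) := by
    have e : α + 2 * x + 2 * y = α + 2 * (x + y) := by ring
    have e' : Real.sin y = Real.sin (x + y) * Real.cos x - Real.cos (x + y) * Real.sin x := by
      rw [← Real.sin_sub, add_sub_cancel_left]
    rw [e, e', Real.cos_sub_cos, Real.cos_sub_cos, Real.sin_sub_sin, Real.sin_sub_sin]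
    have e1 : (α + 2 * x + α) / 2 = α + x := by ring
    have e2 : (α + 2 * x - α) / 2 = x := by ring
    have e3 : (α + 2 * (x + y) + α) / 2 = α + (x + y) := by ring
    have e4 : (α + 2 * (x + y) - α) / 2 = x + y := by ring
    rw [e1, e2, e3, e4]
    have e5 : Real.sin (x + y) * Real.cos x - Real.cos (x + y) * Real.sin x =
        Real.sin (α + (x + y)) * Real.cos (α + x) - Real.cos (α + (x + y)) * Real.sin (α + x) := by
      rw [← Real.sin_sub, ← Real.sin_sub]
      ring_nf
    rw [e5]
    ring
  rw [key]
  positivity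

theorem exists_mem_segment_inter {α β γ δ r : ℝ} (h₁ : α < β) (h₂ : β < γ) (h₃ : γ < δ)
    (h₄ : δ < α + 2 * Real.pi) {c : Plane} {q : ℝ → Plane}
    (hq : ∀ θ, q θ = c + !₂[r * Real.cos θ, r * Real.sin θ]) :
    (segment ℝ (q α) (q γ) ∩ segment ℝ (q β) (q δ)).Nonempty := by
  have hA := orientation_pos h₂ h₃ (by linarith)
  have hB := orientation_pos (h₁.trans h₂) h₃ h₄
  have hC := orientation_pos h₁ (h₂.trans h₃) h₄
  have hD := orientation_pos h₁ h₂ (by linarith)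
  set A := (Real.cos γ - Real.cos β) * (Real.sin δ - Real.sin β) -
    (Real.sin γ - Real.sin β) * (Real.cos δ - Real.cos β) with A_def
  set B := (Real.cos γ - Real.cos α) * (Real.sin δ - Real.sin α) -
    (Real.sin γ - Real.sin α) * (Real.cos δ - Real.cos α) with B_def
  set C := (Real.cos β - Real.cos α) * (Real.sin δ - Real.sin α) -
    (Real.sin β - Real.sin α) * (Real.cos δ - Real.cos α) with C_def
  set D := (Real.cos β - Real.cos α) * (Real.sin γ - Real.sin α) -
    (Real.sin β - Real.sin α) * (Real.cos γ - Real.cos α) with D_def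
  have hsum : B + D = A + C := by rw [A_def, B_def, C_def, D_def]; ring
  have hAC : 0 < A + C := by positivity
  refine ⟨(A / (A + C)) • q α + (C / (A + C)) • q γ,
    ⟨_, _, by positivity, by positivity, by field_simp, rfl⟩,
    ⟨B / (A + C), D / (A + C), by positivity, by positivity, ?_, ?_⟩⟩
  · rw [← add_div, hsum, div_self hAC.ne']
  · rw [← smul_right_injective _ hAC.ne' |>.eq_iff]
    simp only [smul_add, smul_smul, mul_div_cancel₀ _ hAC.ne', hq]
    ext i
    fin_cases i
    · simp
      linear_combination c 0 * hsum + r * (by rw [A_def, B_def, C_def, D_def]; ring :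
        B * Real.cos β + D * Real.cos δ = A * Real.cos α + C * Real.cos γ)
    · simp
      linear_combination c 1 * hsum + r * (by rw [A_def, B_def, C_def, D_def]; ring :
        B * Real.sin β + D * Real.sin δ = A * Real.sin α + C * Real.sin γ)

/-- Angular coordinates for points on a circle. -/
theorem exists_angle {x c : Plane} {r : ℝ} (h : dist x c = r) :
    ∃ θ, -Real.pi < θ ∧ θ ≤ Real.pi ∧ x = c + !₂[r * Real.cos θ, r * Real.sin θ] := by
  have hr : ‖(⟨x 0 - c 0, x 1 - c 1⟩ : ℂ)‖ = r := by
    rw [← h, EuclideanSpace.dist_eq, Complex.norm_def, Complex.normSq_mk]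
    simp [Real.dist_eq, sq_abs, Fin.sum_univ_two, ← sq]
  refine ⟨Complex.arg ⟨x 0 - c 0, x 1 - c 1⟩, Complex.neg_pi_lt_arg _, Complex.arg_le_pi _, ?_⟩
  rw [← hr, Complex.norm_mul_cos_arg, Complex.norm_mul_sin_arg]
  ext i
  fin_cases i <;> simp

/-- The vertices of an outerplanar graph can be numbered so that no two edges cross. -/
theorem exists_noncrossing_index {V : Type} [Fintype V] {G : SimpleGraph V}
    (hG : IsOuterplanar G) :
    ∃ f : V → ℕ, Function.Injective f ∧ (∀ v, f v < Fintype.card V) ∧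
      ∀ u v x y, f u < f x → f x < f v → f v < f y → G.Adj u v → G.Adj x y → False := by
  classical
  obtain ⟨ρ, c, r, ⟨hinj, -, hρ⟩, hr⟩ := hG
  choose θ hθ hθ' hθρ using fun v => exists_angle (hr v)
  have hθinj : ∀ u v, θ u = θ v → u = v := fun u v h => hinj (by rw [hθρ u, hθρ v, h])
  let f : V → ℕ := fun v => (Finset.univ.filter fun w => θ w < θ v).card
  have hlt : ∀ u v, θ u < θ v → f u < f v := fun u v h => by
    apply Finset.card_lt_card
    rw [Finset.ssubset_iff_of_subset
      (Finset.monotone_filter_right _ fun w _ hw => lt_trans hw h)]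
    exact ⟨u, by simpa using h, by simp⟩
  have hlt' : ∀ u v, f u < f v → θ u < θ v := fun u v h => by
    by_contra hn
    rcases (not_lt.1 hn).lt_or_eq with h' | h'
    · exact lt_asymm h (hlt _ _ h')
    · rw [hθinj _ _ h'] at h
      exact lt_irrefl _ h
  refine ⟨f, fun u v h => ?_, fun v => ?_, fun u v x y h₁ h₂ h₃ huv hxy => ?_⟩
  · apply hθinj
    by_contra hn
    rcases lt_or_gt_of_ne hn with h' | h'
    · exact (hlt _ _ h').ne h
    · exact (hlt _ _ h').ne' h
  · exact Finset.card_lt_univ_of_notMem (x := v) (by simp)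
  · have hne : s(u, v) ≠ s(x, y) := by
      rw [Ne, Sym2.eq_iff]
      rintro (⟨rfl, rfl⟩ | ⟨rfl, rfl⟩) <;> omega
    obtain ⟨p, hp⟩ := exists_mem_segment_inter (r := r) (c := c) (hlt' _ _ h₁) (hlt' _ _ h₂)
      (hlt' _ _ h₃) (by linarith [hθ u, hθ' y]) (fun _ => rfl)
    rw [← hθρ, ← hθρ, ← hθρ, ← hθρ, hρ u v x y huv hxy hne] at hp
    obtain ⟨w, rfl | rfl, rfl | rfl, -⟩ := hp <;> omega

theorem isPlanarDrawing_of_convexHull_inter {V : Type} {G : SimpleGraph V} {ρ : V → Plane}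
    {K : Set (Set V)} (hv : ∀ v, {v} ∈ K) (he : ∀ u v, G.Adj u v → {u, v} ∈ K)
    (h : ∀ s ∈ K, ∀ t ∈ K,
      convexHull ℝ (ρ '' s) ∩ convexHull ℝ (ρ '' t) ⊆ convexHull ℝ (ρ '' (s ∩ t))) :
    IsPlanarDrawing G ρ := by
  have hmem : ∀ s ∈ K, ∀ w, ρ w ∈ convexHull ℝ (ρ '' s) → w ∈ s := by
    intro s hs w hw
    have := h s hs {w} (hv w) ⟨hw, by simp⟩
    by_contra hn
    rw [Set.inter_singleton_eq_empty.2 hn] at this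
    simp at this
  refine ⟨fun u v huv => hmem {v} (hv v) u (by simp [huv]), ?_, ?_⟩
  · intro u v w huv hwu hwv hw
    rw [← convexHull_pair, ← Set.image_pair] at hw
    rcases hmem _ (he u v huv) w hw with rfl | rfl
    · exact hwu rfl
    · exact hwv rfl
  · intro u v x y huv hxy hne
    apply subset_antisymm
    · rw [← convexHull_pair, ← convexHull_pair, ← Set.image_pair, ← Set.image_pair]
      refine (h _ (he u v huv) _ (he x y hxy)).trans ?_
      have hs : ({u, v} ∩ {x, y} : Set V).Subsingleton := by
        rintro a ⟨ha, ha'⟩ b ⟨hb, hb'⟩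
        by_contra hab
        apply hne
        rw [Sym2.eq_iff]
        simp only [Set.mem_insert_iff, Set.mem_singleton_iff] at ha ha' hb hb'
        grind
      rw [(hs.image ρ).convex.convexHull_eq]
      rintro _ ⟨w, ⟨h₁, h₂⟩, rfl⟩
      exact ⟨w, h₁, h₂, rfl⟩
    · rintro _ ⟨w, h₁, h₂, rfl⟩
      constructor
      · rcases h₁ with rfl | rfl
        · exact left_mem_segment ℝ _ _
        · exact right_mem_segment ℝ _ _
      · rcases h₂ with rfl | rfl
        · exact left_mem_segment ℝ _ _
        · exact right_mem_segment ℝ _ _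

theorem exists_good_drawing {V : Type} [Fintype V] {G : SimpleGraph V}
    (hcard : 2 ≤ Fintype.card V) (hG : IsOuterplanar G) :
    ∃ ρ : V → Plane, IsPlanarDrawing G ρ ∧
      ∀ u v : V, G.Adj u v → 1 / 2 < dist (ρ u) (ρ v) ∧ dist (ρ u) (ρ v) ≤ 1 := by
  obtain ⟨f, hf, hfc, hcross⟩ := exists_noncrossing_index hG
  obtain ⟨C, hC, -, hCA, hCs⟩ := exists_side
    (fun x y => ∃ u v, f u = x ∧ f v = y ∧ G.Adj u v)
    (by
      rintro _ _ _ _ h₁ h₂ h₃ ⟨u, v, rfl, rfl, huv⟩ ⟨x, y, rfl, rfl, hxy⟩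
      exact hcross u v x y h₁ h₂ h₃ huv hxy)
    0 (Fintype.card V - 1) (by omega)
  obtain ⟨σ, -, -, hσ⟩ := hC.drawable.1 1 one_pos
  have hle : ∀ v, f v ≤ Fintype.card V - 1 := fun v => Nat.le_sub_one_of_lt (hfc v)
  have hpair : ∀ u v, G.Adj u v → {f u, f v} ∈ C := by
    intro u v huv
    rcases lt_or_gt_of_ne (hf.ne huv.ne) with h | h
    · exact hCA _ _ (Nat.zero_le _) h (hle v) ⟨u, v, rfl, rfl, huv⟩
    · rw [Set.pair_comm]
      exact hCA _ _ (Nat.zero_le _) h (hle u) ⟨v, u, rfl, rfl, huv.symm⟩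
  let L : ℂ ≃ₗᵢ[ℝ] Plane := Complex.orthonormalBasisOneI.repr
  have himage : ∀ s : Set V, convexHull ℝ ((fun v => L (σ (f v))) '' s) =
      L '' convexHull ℝ (σ '' (f '' s)) := by
    intro s
    have := L.toLinearEquiv.toLinearMap.image_convexHull (σ '' (f '' s))
    rw [Set.image_image, Set.image_image] at this
    rw [Set.image_image σ]
    exact this.symm
  refine ⟨fun v => L (σ (f v)), ?_, ?_⟩
  · refine isPlanarDrawing_of_convexHull_inter (K := {s | f '' s ∈ C}) (fun v => ?_)
      (fun u v huv => ?_) fun s hs t ht => ?_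
    · rw [Set.mem_ofPred_eq, Set.image_singleton]
      exact hCs _ (Nat.zero_le _) (hle v)
    · rw [Set.mem_ofPred_eq, Set.image_pair]
      exact hpair u v huv
    · rw [himage, himage, himage, ← Set.image_inter L.injective, Set.image_inter hf]
      exact Set.image_mono (hσ.inter _ hs _ ht)
  · intro u v huv
    rw [L.dist_map]
    exact hσ.length _ _ (hf.ne huv.ne) (hpair u v huv)

theorem edgeLengthRatio_lt_two {V : Type} [Finite V] {G : SimpleGraph V} {ρ : V → Plane}
    (h : ∀ u v : V, G.Adj u v → 1 / 2 < dist (ρ u) (ρ v) ∧ dist (ρ u) (ρ v) ≤ 1) :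
    edgeLengthRatio G ρ < 2 := by
  unfold edgeLengthRatio
  set S := {d : ℝ | ∃ u v : V, G.Adj u v ∧ d = dist (ρ u) (ρ v)}
  rcases S.eq_empty_or_nonempty with h0 | h0
  · simp [h0]
  · have hfin : S.Finite :=
      (Set.finite_range fun p : V × V => dist (ρ p.1) (ρ p.2)).subset (by
        rintro _ ⟨u, v, -, rfl⟩
        exact ⟨(u, v), rfl⟩)
    have h1 : 1 / 2 < sInf S := by
      obtain ⟨u, v, huv, e⟩ := h0.csInf_mem hfin
      rw [e]
      exact (h u v huv).1
    have h2 : sSup S ≤ 1 := csSup_le h0 (by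
      rintro _ ⟨u, v, huv, rfl⟩
      exact (h u v huv).2)
    rw [div_lt_iff₀ (by linarith)]
    linarith

end OuterplanarDrawing

/-- Every maximal outerplanar graph admits a planar straight-line drawing in
which every edge has length in (1/2, 1]; in particular this drawing has edge-length ratio
strictly less than 2. -/
theorem maximalOuterplanar_good_drawing {V : Type} [Fintype V] (G : SimpleGraph V)
    (hG : IsMaximalOuterplanar G) :
    ∃ ρ : V → Plane, IsPlanarDrawing G ρ ∧
      (∀ u v : V, G.Adj u v →
        1 / 2 < dist (ρ u) (ρ v) ∧ dist (ρ u) (ρ v) ≤ 1) ∧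
      edgeLengthRatio G ρ < 2 := by
  obtain ⟨ρ, hρ, hlen⟩ := OuterplanarDrawing.exists_good_drawing (by have := hG.1; omega) hG.2.1
  exact ⟨ρ, hρ, hlen, OuterplanarDrawing.edgeLengthRatio_lt_two hlen⟩
end
end

section
/- For every real number ε > 0 there exists an outerplanar finite simple graph G with at least one edge such that every planar straight-line drawing of G has edge-length ratio strictly greater than 2 − ε. -/
noncomputable section

/-- Twice the signed area of the triangle `p q r`. -/
def signedArea (p q r : Plane) : ℝ :=
  (q 0 - p 0) * (r 1 - p 1) - (q 1 - p 1) * (r 0 - p 0)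

/-- `x` lies in the open triangle `p q r`. -/
def InTriangle (p q r x : Plane) : Prop :=
  ∃ α β γ : ℝ, 0 < α ∧ 0 < β ∧ 0 < γ ∧ α + β + γ = 1 ∧ x = α • p + β • q + γ • r

lemma Plane.ext {p q : Plane} (h0 : p 0 = q 0) (h1 : p 1 = q 1) : p = q := by
  ext i
  fin_cases i <;> assumption

lemma InTriangle.rotate {p q r x : Plane} (h : InTriangle p q r x) : InTriangle q r p x := by
  obtain ⟨α, β, γ, hα, hβ, hγ, h1, rfl⟩ := h
  exact ⟨β, γ, α, hβ, hγ, hα, by linarith, by abel⟩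

lemma InTriangle.swap {p q r x : Plane} (h : InTriangle p q r x) : InTriangle q p r x := by
  obtain ⟨α, β, γ, hα, hβ, hγ, h1, rfl⟩ := h
  exact ⟨β, α, γ, hβ, hα, hγ, by linarith, by abel⟩

lemma signedArea_rotate (p q r : Plane) : signedArea q r p = signedArea p q r := by
  simp only [signedArea]; ring

lemma signedArea_swap (p q r : Plane) : signedArea q p r = -signedArea p q r := by
  simp only [signedArea]; ring

lemma signedArea_combo (p q a b c : Plane) {α β γ : ℝ} (h : α + β + γ = 1) :
    signedArea p q (α • a + β • b + γ • c) =
      α * signedArea p q a + β * signedArea p q b + γ * signedArea p q c := by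
  obtain rfl : α = 1 - β - γ := by linarith
  simp [signedArea]
  ring

lemma signedArea_left_self (p q : Plane) : signedArea p q p = 0 := by
  simp only [signedArea]; ring

lemma signedArea_right_self (p q : Plane) : signedArea p q q = 0 := by
  simp only [signedArea]; ring

/-- Barycentric coordinates with respect to a nondegenerate triangle. -/
lemma exists_barycentric {p q r : Plane} (h : signedArea p q r ≠ 0) (x : Plane) :
    ∃ α β γ : ℝ, α + β + γ = 1 ∧ x = α • p + β • q + γ • r ∧
      α * signedArea p q r = signedArea q r x ∧ β * signedArea p q r = signedArea r p x ∧
      γ * signedArea p q r = signedArea p q x := by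
  refine ⟨signedArea q r x / signedArea p q r, signedArea r p x / signedArea p q r,
    signedArea p q x / signedArea p q r, ?_, ?_, ?_, ?_, ?_⟩
  · field_simp
    simp only [signedArea]; ring
  · apply Plane.ext <;> simp <;> field_simp <;> simp only [signedArea] <;> ring
  all_goals field_simp

lemma combo_mem_segment {p q : Plane} {a b : ℝ} (ha : 0 ≤ a) (hb : 0 ≤ b) (h : a + b = 1)
    {x : Plane} (hx : x = a • p + b • q) : x ∈ segment ℝ p q :=
  ⟨a, b, ha, hb, h, hx.symm⟩

lemma not_mem_segment_of_disjoint {p q r s : Plane}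
    (h : Disjoint (segment ℝ p q) (segment ℝ r s)) (x : Plane) (hx : x ∈ segment ℝ p q) :
    x ∉ segment ℝ r s :=
  Set.disjoint_left.1 h hx

/-- A segment that starts inside a triangle and misses its sides ends inside it. -/
lemma InTriangle.of_disjoint {p q r x z : Plane} (hn : signedArea p q r ≠ 0)
    (hx : InTriangle p q r x) (h1 : Disjoint (segment ℝ x z) (segment ℝ p q))
    (h2 : Disjoint (segment ℝ x z) (segment ℝ q r))
    (h3 : Disjoint (segment ℝ x z) (segment ℝ r p)) : InTriangle p q r z := by
  obtain ⟨α, β, γ, hα, hβ, hγ, hs, hxe⟩ := hx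
  obtain ⟨α', β', γ', hs', hze, -⟩ := exists_barycentric hn z
  by_contra hz
  have hle : min α' (min β' γ') ≤ 0 := by
    by_contra! hlt
    simp only [lt_min_iff] at hlt
    exact hz ⟨α', β', γ', hlt.1, hlt.2.1, hlt.2.2, hs', hze⟩
  let f : ℝ → ℝ := fun t => min ((1 - t) * α + t * α')
    (min ((1 - t) * β + t * β') ((1 - t) * γ + t * γ'))
  have hf : Continuous f := by fun_prop
  have h0 : (0 : ℝ) ∈ f '' Set.Icc 0 1 := by
    apply intermediate_value_Icc' zero_le_one hf.continuousOn
    constructor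
    · simpa [f] using hle
    · simp [f, hα.le, hβ.le, hγ.le]
  obtain ⟨t, ⟨ht0, ht1⟩, ht⟩ := h0
  have hsum : ((1 - t) * α + t * α') + ((1 - t) * β + t * β') + ((1 - t) * γ + t * γ') = 1 := by
    linear_combination (1 - t) * hs + t * hs'
  set A := (1 - t) * α + t * α'
  set B := (1 - t) * β + t * β'
  set C := (1 - t) * γ + t * γ'
  have hw : (1 - t) • x + t • z = A • p + B • q + C • r := by
    rw [hxe, hze]
    apply Plane.ext <;> simp [A, B, C] <;> ring
  have hmem : (1 - t) • x + t • z ∈ segment ℝ x z :=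
    ⟨1 - t, t, by linarith, ht0, by ring, rfl⟩
  have hf0 : min A (min B C) = 0 := ht
  have hA : 0 ≤ A := hf0 ▸ min_le_left _ _
  have hBC : 0 ≤ min B C := hf0 ▸ min_le_right _ _
  have hB : 0 ≤ B := hBC.trans (min_le_left _ _)
  have hC : 0 ≤ C := hBC.trans (min_le_right _ _)
  rcases min_choice A (min B C) with h | h
  · have hA0 : A = 0 := by rw [← h, hf0]
    exact Set.disjoint_left.1 h2 hmem
      (combo_mem_segment hB hC (by linarith) (by rw [hw, hA0]; simp))
  · rcases min_choice B C with h' | h'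
    · have hB0 : B = 0 := by rw [← h', ← h, hf0]
      exact Set.disjoint_left.1 h3 hmem
        (combo_mem_segment hC hA (by linarith) (by rw [hw, hB0]; simp [add_comm]))
    · have hC0 : C = 0 := by rw [← h', ← h, hf0]
      exact Set.disjoint_left.1 h1 hmem
        (combo_mem_segment hA hB (by linarith) (by rw [hw, hC0]; simp))

/-- A vertex of a triangle is not inside a triangle spanned by another vertex and two inner
points. -/
lemma InTriangle.not_vertex {p q r u v : Plane} (hn : signedArea p q r ≠ 0)
    (hu : InTriangle p q r u) (hv : InTriangle p q r v) : ¬ InTriangle p u v r := by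
  rintro ⟨a, b, c, ha, hb, hc, hs, he⟩
  obtain ⟨α, β, γ, hα, hβ, hγ, h1, rfl⟩ := hu
  obtain ⟨α', β', γ', hα', hβ', hγ', h1', rfl⟩ := hv
  have key := congrArg (signedArea p q) he
  rw [signedArea_combo _ _ _ _ _ hs, signedArea_combo _ _ _ _ _ h1,
    signedArea_combo _ _ _ _ _ h1', signedArea_left_self, signedArea_right_self] at key
  have : signedArea p q r * (1 - b * γ - c * γ') = 0 := by linear_combination key
  rcases mul_eq_zero.1 this with h | h
  · exact hn h
  · nlinarith

/-- Two triangles on the same side of a common edge are nested. -/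
lemma inTriangle_or_inTriangle {p q r x : Plane} (hs : 0 < signedArea p q r * signedArea p q x)
    (h1 : Disjoint (segment ℝ p x) (segment ℝ q r))
    (h2 : Disjoint (segment ℝ q x) (segment ℝ p r)) :
    InTriangle p q r x ∨ InTriangle p q x r := by
  have hn : signedArea p q r ≠ 0 := by rintro h; simp [h] at hs
  obtain ⟨α, β, γ, h, hx, -, -, hγ⟩ := exists_barycentric hn x
  have hγ0 : 0 < γ := by
    rw [← hγ] at hs
    have : 0 < γ * (signedArea p q r) ^ 2 := by linarith
    exact pos_of_mul_pos_left this (sq_nonneg _)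
  by_cases hα : 0 < α
  · by_cases hβ : 0 < β
    · exact .inl ⟨α, β, γ, hα, hβ, hγ0, h, hx⟩
    · exfalso
      push Not at hβ
      have hd : 0 < 1 - β := by linarith
      refine not_mem_segment_of_disjoint h2 ((-β / (1 - β)) • q + (1 / (1 - β)) • x)
        (combo_mem_segment (by apply div_nonneg <;> linarith) (by positivity)
          (by field_simp; ring) rfl)
        (combo_mem_segment (a := α / (1 - β)) (b := γ / (1 - β)) (by positivity) (by positivity)
          (by field_simp; linarith) ?_)
      rw [hx]
      apply Plane.ext <;> simp <;> field_simp <;> ring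
  · push Not at hα
    by_cases hβ : 0 ≤ β
    · exfalso
      have hd : 0 < 1 - α := by linarith
      refine not_mem_segment_of_disjoint h1 ((-α / (1 - α)) • p + (1 / (1 - α)) • x)
        (combo_mem_segment (by apply div_nonneg <;> linarith) (by positivity)
          (by field_simp; ring) rfl)
        (combo_mem_segment (a := β / (1 - α)) (b := γ / (1 - α)) (by positivity) (by positivity)
          (by field_simp; linarith) ?_)
      rw [hx]
      apply Plane.ext <;> simp <;> field_simp <;> ring
    · push Not at hβ
      rcases hα.lt_or_eq with hα | hα
      · refine .inr ⟨-α / γ, -β / γ, 1 / γ, ?_, ?_, by positivity, ?_, ?_⟩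
        · apply div_pos <;> linarith
        · apply div_pos <;> linarith
        · field_simp; linarith
        · rw [hx]
          apply Plane.ext <;> simp <;> field_simp <;> ring
      · exfalso
        subst hα
        have hd : 0 < 1 - β := by linarith
        refine not_mem_segment_of_disjoint h2 ((-β / (1 - β)) • q + (1 / (1 - β)) • x)
          (combo_mem_segment (by apply div_nonneg <;> linarith) (by positivity)
            (by field_simp; ring) rfl)
          (combo_mem_segment (a := 0) (b := γ / (1 - β)) le_rfl (by positivity)
            (by field_simp; linarith) ?_)
        rw [hx]
        apply Plane.ext <;> simp <;> field_simp <;> ring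

/-- Two inner triangles erected without crossings on two sides of a triangle have total area at
most the area of that triangle. -/
lemma abs_signedArea_add_le {a b c x y : Plane} (hx : InTriangle a c b x)
    (hy : InTriangle a c b y) (h1 : Disjoint (segment ℝ a x) (segment ℝ b y))
    (h2 : Disjoint (segment ℝ c x) (segment ℝ b y))
    (h3 : Disjoint (segment ℝ a x) (segment ℝ c y)) :
    |signedArea a c x| + |signedArea c b y| ≤ |signedArea a c b| := by
  obtain ⟨xa, xc, xb, hxa, hxc, hxb, hxs, hxe⟩ := hx
  obtain ⟨ya, yc, yb, hya, hyc, hyb, hys, hye⟩ := hy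
  have ex : signedArea a c x = xb * signedArea a c b := by
    rw [hxe, signedArea_combo _ _ _ _ _ hxs, signedArea_left_self, signedArea_right_self]; ring
  have ey : signedArea c b y = ya * signedArea a c b := by
    rw [hye, signedArea_combo _ _ _ _ _ hys, signedArea_left_self, signedArea_right_self,
      signedArea_rotate]; ring
  rw [ex, ey, abs_mul, abs_mul, abs_of_pos hxb, abs_of_pos hya, ← add_mul]
  refine mul_le_of_le_one_left (abs_nonneg _) ?_
  by_contra! hlt
  have hab : xa * yb ≤ xb * ya := by nlinarith
  rcases le_total (xa * yc) (ya * xc) with hca | hca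
  · rcases le_total (yb * xc) (xb * yc) with hcb | hcb
    · have hD : 0 < ya * xc + yc * xc + xb * yc := by positivity
      refine not_mem_segment_of_disjoint h1
        ((ya * xc / (ya * xc + yc * xc + xb * yc)) • a +
          (yc * xc / (ya * xc + yc * xc + xb * yc)) • c +
          (xb * yc / (ya * xc + yc * xc + xb * yc)) • b)
        (combo_mem_segment (a := (ya * xc - xa * yc) / (ya * xc + yc * xc + xb * yc))
          (b := yc / (ya * xc + yc * xc + xb * yc))
          (div_nonneg (by linarith) hD.le) (by positivity) ?_ ?_)
        (combo_mem_segment (a := (xb * yc - yb * xc) / (ya * xc + yc * xc + xb * yc))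
          (b := xc / (ya * xc + yc * xc + xb * yc))
          (div_nonneg (by linarith) hD.le) (by positivity) ?_ ?_)
      · field_simp; linear_combination (-yc) * hxs
      · rw [hxe]; apply Plane.ext <;> simp <;> field_simp <;> ring
      · field_simp; linear_combination (-xc) * hys
      · rw [hye]; apply Plane.ext <;> simp <;> field_simp <;> ring
    · have hD : 0 < ya * xb + yb * xc + xb * yb := by positivity
      refine not_mem_segment_of_disjoint h3
        ((ya * xb / (ya * xb + yb * xc + xb * yb)) • a +
          (yb * xc / (ya * xb + yb * xc + xb * yb)) • c +
          (xb * yb / (ya * xb + yb * xc + xb * yb)) • b)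
        (combo_mem_segment (a := (ya * xb - xa * yb) / (ya * xb + yb * xc + xb * yb))
          (b := yb / (ya * xb + yb * xc + xb * yb))
          (div_nonneg (by linarith) hD.le) (by positivity) ?_ ?_)
        (combo_mem_segment (a := (yb * xc - xb * yc) / (ya * xb + yb * xc + xb * yb))
          (b := xb / (ya * xb + yb * xc + xb * yb))
          (div_nonneg (by linarith) hD.le) (by positivity) ?_ ?_)
      · field_simp; linear_combination (-yb) * hxs
      · rw [hxe]; apply Plane.ext <;> simp <;> field_simp <;> ring
      · field_simp; linear_combination (-xb) * hys
      · rw [hye]; apply Plane.ext <;> simp <;> field_simp <;> ring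
  · have hD : 0 < xa * ya + xa * yc + xb * ya := by positivity
    refine not_mem_segment_of_disjoint h2
      ((xa * ya / (xa * ya + xa * yc + xb * ya)) • a +
        (xa * yc / (xa * ya + xa * yc + xb * ya)) • c +
        (xb * ya / (xa * ya + xa * yc + xb * ya)) • b)
      (combo_mem_segment (a := (xa * yc - ya * xc) / (xa * ya + xa * yc + xb * ya))
        (b := ya / (xa * ya + xa * yc + xb * ya))
        (div_nonneg (by linarith) hD.le) (by positivity) ?_ ?_)
      (combo_mem_segment (a := (xb * ya - xa * yb) / (xa * ya + xa * yc + xb * ya))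
        (b := xa / (xa * ya + xa * yc + xb * ya))
        (div_nonneg (by linarith) hD.le) (by positivity) ?_ ?_)
    · field_simp; linear_combination (-ya) * hxs
    · rw [hxe]; apply Plane.ext <;> simp <;> field_simp <;> ring
    · field_simp; linear_combination (-xa) * hys
    · rw [hye]; apply Plane.ext <;> simp <;> field_simp <;> ring

/-- The rational parametrization of the unit circle. -/
def circlePoint (t : ℝ) : Plane := !₂[(1 - t ^ 2) / (1 + t ^ 2), 2 * t / (1 + t ^ 2)]

lemma dist_circlePoint_zero (t : ℝ) : dist (circlePoint t) 0 = 1 := by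
  have h : (0 : ℝ) < 1 + t ^ 2 := by positivity
  rw [EuclideanSpace.dist_eq, Real.sqrt_eq_one]
  simp [circlePoint]
  field_simp
  ring

lemma signedArea_circlePoint (s t u : ℝ) :
    signedArea (circlePoint s) (circlePoint t) (circlePoint u) =
      4 * ((t - s) * (u - t) * (u - s)) / ((1 + s ^ 2) * (1 + t ^ 2) * (1 + u ^ 2)) := by
  have hs : (0 : ℝ) < 1 + s ^ 2 := by positivity
  have ht : (0 : ℝ) < 1 + t ^ 2 := by positivity
  have hu : (0 : ℝ) < 1 + u ^ 2 := by positivity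
  simp [circlePoint, signedArea]
  field_simp
  ring

lemma signedArea_circlePoint_ne_zero {s t u : ℝ} (h1 : s ≠ t) (h2 : t ≠ u) (h3 : s ≠ u) :
    signedArea (circlePoint s) (circlePoint t) (circlePoint u) ≠ 0 := by
  rw [signedArea_circlePoint]
  have := sub_ne_zero.2 h1.symm
  have := sub_ne_zero.2 h2.symm
  have := sub_ne_zero.2 h3.symm
  positivity

lemma circlePoint_injective : Function.Injective circlePoint := by
  intro s t h
  by_contra hne
  obtain ⟨u, hu⟩ := Set.Infinite.exists_notMem_finset (Set.infinite_univ (α := ℝ)) {s, t}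
  simp only [Set.mem_univ, Finset.mem_insert, Finset.mem_singleton, not_or, true_and] at hu
  refine signedArea_circlePoint_ne_zero hne (Ne.symm hu.2) (Ne.symm hu.1) ?_
  rw [h]
  simp [signedArea]

lemma signedArea_of_mem_segment {p q r : Plane} (h : r ∈ segment ℝ p q) :
    signedArea p q r = 0 := by
  obtain ⟨a, b, -, -, hab, rfl⟩ := h
  obtain rfl : a = 1 - b := by linarith
  simp [signedArea]
  ring

/-- Two segments with a common endpoint and independent directions meet only there. -/
lemma eq_of_mem_segment_of_mem_segment {p q r x : Plane} (hn : signedArea p q r ≠ 0)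
    (h1 : x ∈ segment ℝ p q) (h2 : x ∈ segment ℝ p r) : x = p := by
  have h := signedArea_of_mem_segment h1
  obtain ⟨a, b, -, -, hab, rfl⟩ := h2
  obtain rfl : a = 1 - b := by linarith
  have hb : b * signedArea p q r = 0 := by
    rw [← h]
    simp [signedArea]
    ring
  obtain rfl : b = 0 := (mul_eq_zero.1 hb).resolve_right hn
  simp

/-- A segment strictly on one side of the line through another one misses it. -/
lemma disjoint_segment_of_same_side {p q x y : Plane}
    (h : 0 < signedArea p q x * signedArea p q y) :
    Disjoint (segment ℝ p q) (segment ℝ x y) := by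
  rw [Set.disjoint_left]
  intro z hz hz'
  have h0 := signedArea_of_mem_segment hz
  obtain ⟨a, b, ha, hb, hab, rfl⟩ := hz'
  have hsum : a * signedArea p q x + b * signedArea p q y = 0 := by
    rw [← h0]
    obtain rfl : a = 1 - b := by linarith
    simp [signedArea]
    ring
  rcases pos_and_pos_or_neg_and_neg_of_mul_pos h with ⟨h1, h2⟩ | ⟨h1, h2⟩
  · rcases ha.eq_or_lt with rfl | ha
    · obtain rfl : b = 1 := by linarith
      linarith
    · nlinarith [mul_pos ha h1, mul_nonneg hb h2.le]
  · rcases ha.eq_or_lt with rfl | ha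
    · obtain rfl : b = 1 := by linarith
      linarith
    · nlinarith [mul_pos_of_neg_of_neg h1 (neg_neg_of_pos ha),
        mul_nonneg hb (neg_nonneg.2 h2.le)]

/-- A graph whose vertices can be ordered so that no two disjoint edges interleave is
outerplanar. -/
lemma isOuterplanar_of_noncrossing {V : Type} (G : SimpleGraph V) (τ : V → ℝ)
    (hτ : Function.Injective τ)
    (h : ∀ u v x y, G.Adj u v → G.Adj x y → u ≠ x → u ≠ y → v ≠ x → v ≠ y →
      0 < (τ x - τ u) * (τ x - τ v) * ((τ y - τ u) * (τ y - τ v))) :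
    IsOuterplanar G := by
  refine ⟨fun v => circlePoint (τ v), 0, 1, ⟨circlePoint_injective.comp hτ, ?_, ?_⟩,
    fun v => dist_circlePoint_zero _⟩
  · intro u v w huv hwu hwv hmem
    exact signedArea_circlePoint_ne_zero (hτ.ne huv.ne) (hτ.ne hwv.symm) (hτ.ne hwu.symm)
      (signedArea_of_mem_segment hmem)
  · intro u v x y huv hxy hne
    apply Set.Subset.antisymm
    · rintro p ⟨hp1, hp2⟩
      have shared : ∀ a b c : V, a ≠ b → a ≠ c → b ≠ c →
          p ∈ segment ℝ (circlePoint (τ a)) (circlePoint (τ b)) →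
          p ∈ segment ℝ (circlePoint (τ a)) (circlePoint (τ c)) → p = circlePoint (τ a) :=
        fun a b c hab hac hbc => eq_of_mem_segment_of_mem_segment
          (signedArea_circlePoint_ne_zero (hτ.ne hab) (hτ.ne hbc) (hτ.ne hac))
      by_cases hux : u = x
      · subst hux
        exact ⟨u, .inl rfl, .inl rfl,
          shared u v y huv.ne hxy.ne (by rintro rfl; exact hne rfl) hp1 hp2⟩
      by_cases huy : u = y
      · subst huy
        rw [segment_symm ℝ (circlePoint (τ x))] at hp2
        exact ⟨u, .inl rfl, .inr rfl,
          shared u v x huv.ne (Ne.symm hxy.ne) (by rintro rfl; exact hne Sym2.eq_swap) hp1 hp2⟩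
      by_cases hvx : v = x
      · subst hvx
        rw [segment_symm ℝ (circlePoint (τ u))] at hp1
        exact ⟨v, .inr rfl, .inl rfl, shared v u y (Ne.symm huv.ne) hxy.ne huy hp1 hp2⟩
      by_cases hvy : v = y
      · subst hvy
        rw [segment_symm ℝ (circlePoint (τ u))] at hp1
        rw [segment_symm ℝ (circlePoint (τ x))] at hp2
        exact ⟨v, .inr rfl, .inr rfl,
          shared v u x (Ne.symm huv.ne) (Ne.symm hxy.ne) hux hp1 hp2⟩
      exfalso
      refine Set.disjoint_left.1 (disjoint_segment_of_same_side ?_) hp1 hp2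
      have key := h u v x y huv hxy hux huy hvx hvy
      have hvu : 0 < (τ v - τ u) ^ 2 := by
        have := sub_ne_zero.2 (hτ.ne (Ne.symm huv.ne))
        positivity
      rw [signedArea_circlePoint, signedArea_circlePoint, div_mul_div_comm]
      apply div_pos _ (by positivity)
      have := mul_pos hvu key
      linarith
    · rintro p ⟨w, hw1, hw2, rfl⟩
      constructor
      · rcases hw1 with rfl | rfl
        · exact left_mem_segment ℝ _ _
        · exact right_mem_segment ℝ _ _
      · rcases hw2 with rfl | rfl
        · exact left_mem_segment ℝ _ _
        · exact right_mem_segment ℝ _ _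

/-- Disjoint edges of a planar drawing are drawn as disjoint segments. -/
lemma IsPlanarDrawing.disjoint_segment {V : Type} {G : SimpleGraph V} {ρ : V → Plane}
    (hρ : IsPlanarDrawing G ρ) {u v x y : V} (huv : G.Adj u v) (hxy : G.Adj x y)
    (hux : u ≠ x) (huy : u ≠ y) (hvx : v ≠ x) (hvy : v ≠ y) :
    Disjoint (segment ℝ (ρ u) (ρ v)) (segment ℝ (ρ x) (ρ y)) := by
  have hne : s(u, v) ≠ s(x, y) := by
    rw [Ne, Sym2.eq_iff]
    tauto
  rw [Set.disjoint_iff_inter_eq_empty, hρ.2.2 u v x y huv hxy hne, Set.eq_empty_iff_forall_notMem]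
  rintro p ⟨w, rfl | rfl, rfl | rfl, -⟩ <;> contradiction


lemma Plane.dist_sq (p q : Plane) : dist p q ^ 2 = (p 0 - q 0) ^ 2 + (p 1 - q 1) ^ 2 := by
  rw [EuclideanSpace.dist_eq, Real.sq_sqrt (by positivity)]
  simp [Real.dist_eq]

/-- The signed area is Lipschitz in the third vertex. -/
lemma abs_signedArea_sub_le (p q r r' : Plane) :
    |signedArea p q r - signedArea p q r'| ≤ dist p q * dist r r' := by
  apply abs_le_of_sq_le_sq _ (by positivity)
  rw [mul_pow, Plane.dist_sq, Plane.dist_sq]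
  simp only [signedArea]
  nlinarith [sq_nonneg ((p 0 - q 0) * (r 0 - r' 0) + (p 1 - q 1) * (r 1 - r' 1))]

lemma abs_signedArea_le (p q r : Plane) : |signedArea p q r| ≤ dist p q * dist r p := by
  simpa [signedArea_left_self] using abs_signedArea_sub_le p q r p

/-- A triangle whose side lengths have ratio at most `2 - ε` is not thin. -/
lemma le_abs_signedArea {p q r : Plane} {ε s : ℝ} (hε : 0 < ε) (hs : 0 < s)
    (h1 : s ≤ dist p q) (h2 : s ≤ dist q r) (h3 : s ≤ dist p r)
    (h1' : dist p q ≤ (2 - ε) * s) (h2' : dist q r ≤ (2 - ε) * s)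
    (h3' : dist p r ≤ (2 - ε) * s) :
    ε ^ 2 / 2 * s ^ 2 ≤ |signedArea p q r| := by
  have heron : 4 * signedArea p q r ^ 2 = (dist p q + dist q r + dist p r) *
      ((dist p q + dist q r - dist p r) * ((dist p q + dist p r - dist q r) *
        (dist q r + dist p r - dist p q))) := by
    have e1 := Plane.dist_sq p q
    have e2 := Plane.dist_sq q r
    have e3 := Plane.dist_sq p r
    set a := dist p q
    set b := dist q r
    set c := dist p r
    have : (a + b + c) * ((a + b - c) * ((a + c - b) * (b + c - a))) =
        2 * (a ^ 2 * b ^ 2 + b ^ 2 * c ^ 2 + c ^ 2 * a ^ 2) -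
          ((a ^ 2) ^ 2 + (b ^ 2) ^ 2 + (c ^ 2) ^ 2) := by ring
    rw [this, e1, e2, e3]
    simp only [signedArea]
    ring
  have hεs : 0 < ε * s := by positivity
  have hlow : ε * s * ((ε * s) * ((ε * s) * (ε * s))) ≤ 4 * signedArea p q r ^ 2 := by
    rw [heron]
    gcongr
    all_goals nlinarith
  by_contra! hlt
  have := pow_lt_pow_left₀ hlt (abs_nonneg _) two_ne_zero
  rw [sq_abs] at this
  nlinarith

/-- If a hinge `b c d` has a slightly moved copy `b' c' d'` that does not cross the triangle
`b c a`, and the midpoint of `b' c'` lies on the side of `b c` containing `a`, then `d'` is inside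
the triangle `b c a`. -/
lemma inTriangle_of_close {a b c b' c' d' : Plane} {κ L δ : ℝ} (hδ : 2 * (L * δ) < κ)
    (hκ : κ ≤ |signedArea b c a|) (hab : dist a b ≤ L) (hca : dist c a ≤ L)
    (hb : dist b b' ≤ δ) (hc : dist c c' ≤ δ)
    (hmid : 0 ≤ (signedArea b c b' + signedArea b c c') * signedArea b c a)
    (h1 : Disjoint (segment ℝ b' c') (segment ℝ b c))
    (h2 : Disjoint (segment ℝ b' c') (segment ℝ c a))
    (h3 : Disjoint (segment ℝ b' c') (segment ℝ a b))
    (h4 : Disjoint (segment ℝ b' d') (segment ℝ b c))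
    (h5 : Disjoint (segment ℝ b' d') (segment ℝ c a))
    (h6 : Disjoint (segment ℝ b' d') (segment ℝ a b)) :
    InTriangle b c a d' := by
  have hL : 0 ≤ L := dist_nonneg.trans hab
  have hδ0 : 0 ≤ δ := dist_nonneg.trans hb
  have hκ0 : 0 < κ := lt_of_le_of_lt (by positivity) hδ
  have hn : signedArea b c a ≠ 0 := abs_pos.1 (hκ0.trans_le hκ)
  set m : Plane := (1 / 2 : ℝ) • b' + (1 / 2 : ℝ) • c' with hm
  have mid : ∀ p q : Plane, signedArea p q m = (signedArea p q b' + signedArea p q c') / 2 := by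
    intro p q
    simp [hm, signedArea]
    ring
  have hmseg : m ∈ segment ℝ b' c' := combo_mem_segment (by norm_num) (by norm_num) (by norm_num) hm
  obtain ⟨α, β, γ, hs, hme, hα, hβ, hγ⟩ := exists_barycentric hn m
  have sign : ∀ t x y : ℝ, t * signedArea b c a = (x + y) / 2 →
      |x - signedArea b c a| ≤ L * δ → |y| ≤ L * δ → 0 < t := by
    intro t x y ht hx hy
    by_contra! ht0
    rw [abs_le] at hx hy
    rcases le_abs.1 hκ with h | h
    · nlinarith
    · nlinarith
  have hα0 : 0 < α := by
    refine sign α (signedArea c a b') (signedArea c a c') (by rw [hα, mid]) ?_ ?_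
    · rw [← signedArea_rotate b c a, abs_sub_comm]
      exact (abs_signedArea_sub_le c a b b').trans (by gcongr)
    · have := abs_signedArea_sub_le c a c c'
      rw [signedArea_left_self, zero_sub, abs_neg] at this
      exact this.trans (by gcongr)
  have hβ0 : 0 < β := by
    refine sign β (signedArea a b c') (signedArea a b b') (by rw [hβ, mid, add_comm]) ?_ ?_
    · rw [signedArea_rotate a b c, abs_sub_comm]
      exact (abs_signedArea_sub_le a b c c').trans (by gcongr)
    · have := abs_signedArea_sub_le a b b b'
      rw [signedArea_right_self, zero_sub, abs_neg] at this
      exact this.trans (by gcongr)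
  have hγ0 : 0 < γ := by
    have h0 : 0 ≤ γ := by
      rw [mid] at hγ
      have : 0 ≤ γ * signedArea b c a ^ 2 := by
        have : γ * signedArea b c a ^ 2 =
            (signedArea b c b' + signedArea b c c') * signedArea b c a / 2 := by
          linear_combination signedArea b c a * hγ
        rw [this]
        positivity
      exact nonneg_of_mul_nonneg_left this (by positivity)
    refine h0.lt_of_ne ?_
    rintro rfl
    exact not_mem_segment_of_disjoint h1 m hmseg
      (combo_mem_segment hα0.le hβ0.le (by linarith) (by rw [hme]; simp))
  have hmT : InTriangle b c a m := ⟨α, β, γ, hα0, hβ0, hγ0, hs, hme⟩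
  have hsub : segment ℝ m b' ⊆ segment ℝ b' c' :=
    (convex_segment b' c').segment_subset hmseg (left_mem_segment ℝ _ _)
  exact (hmT.of_disjoint hn (h1.mono_left hsub) (h2.mono_left hsub)
    (h3.mono_left hsub)).of_disjoint hn h4 h5 h6

/-- If the path `d b c a` together with `d c` and `a b` has a slightly moved disjoint copy, then
`a` and `d` lie on the same side of `b c`. -/
lemma same_side_of_close {V : Type} {A : V → V → Prop} (hA : ∀ i j, A i j → A j i)
    {Q Q' : V → Plane} {κ L δ : ℝ} (hδ : 2 * (L * δ) < κ)
    (hlen : ∀ i j, A i j → dist (Q i) (Q j) ≤ L)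
    (hclose : ∀ i j, A i j → dist (Q i) (Q' i) ≤ δ)
    (hκ : ∀ i j m, A i j → A j m → A i m → κ ≤ |signedArea (Q i) (Q j) (Q m)|)
    (hcross : ∀ i j i' j', A i j → A i' j' →
      Disjoint (segment ℝ (Q' i') (Q' j')) (segment ℝ (Q i) (Q j)))
    {a b c d : V} (hbc : A b c) (hca : A c a) (hab : A a b) (hcd : A c d) (hdb : A d b) :
    0 < signedArea (Q b) (Q c) (Q a) * signedArea (Q b) (Q c) (Q d) := by
  have hL : 0 ≤ L := dist_nonneg.trans (hlen _ _ hbc)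
  have hδ0 : 0 ≤ δ := dist_nonneg.trans (hclose _ _ hbc)
  have hLδ : 0 ≤ L * δ := by positivity
  have hκa := hκ b c a hbc hca (hA _ _ hab)
  have hκd := hκ b c d hbc hcd (hA _ _ hdb)
  have side : ∀ u v, A c u → A u b → A c v → A v b →
      0 ≤ (signedArea (Q b) (Q c) (Q' b) + signedArea (Q b) (Q c) (Q' c)) *
        signedArea (Q b) (Q c) (Q u) →
      0 < signedArea (Q b) (Q c) (Q u) * signedArea (Q b) (Q c) (Q v) := by
    intro u v hcu hub hcv hvb hmid
    have hκu := hκ b c u hbc hcu (hA _ _ hub)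
    have hκv := hκ b c v hbc hcv (hA _ _ hvb)
    have hin : InTriangle (Q b) (Q c) (Q u) (Q' v) :=
      inTriangle_of_close hδ hκu (hlen _ _ hub) (hlen _ _ hcu)
        (hclose _ _ hbc) (hclose _ _ hcu) hmid (hcross _ _ _ _ hbc hbc) (hcross _ _ _ _ hcu hbc)
        (hcross _ _ _ _ hub hbc) (hcross _ _ _ _ hbc (hA _ _ hvb))
        (hcross _ _ _ _ hcu (hA _ _ hvb)) (hcross _ _ _ _ hub (hA _ _ hvb))
    obtain ⟨α, β, γ, -, -, hγ, hs, he⟩ := hin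
    have e : signedArea (Q b) (Q c) (Q' v) = γ * signedArea (Q b) (Q c) (Q u) := by
      rw [he, signedArea_combo _ _ _ _ _ hs, signedArea_left_self, signedArea_right_self]; ring
    have hv := (abs_signedArea_sub_le (Q b) (Q c) (Q v) (Q' v)).trans
      (mul_le_mul (hlen _ _ hbc) (hclose _ _ hvb) dist_nonneg hL)
    rw [e, abs_le] at hv
    rcases le_abs.1 hκu with h | h <;> rcases le_abs.1 hκv with h' | h'
    · exact mul_pos (by linarith) (by linarith)
    · nlinarith
    · nlinarith
    · exact mul_pos_of_neg_of_neg (by linarith) (by linarith)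
  by_contra hneg
  rcases le_total 0 ((signedArea (Q b) (Q c) (Q' b) + signedArea (Q b) (Q c) (Q' c)) *
    signedArea (Q b) (Q c) (Q a)) with h | h
  · exact hneg (side a d hca hab hcd hdb h)
  · refine hneg ?_
    rw [mul_comm]
    refine side d a hcd hdb hca hab ?_
    by_contra! h'
    push Not at hneg
    have hn : signedArea (Q b) (Q c) (Q a) ≠ 0 := abs_pos.1 (by linarith)
    have h2 := mul_nonneg_of_nonpos_of_nonpos h h'.le
    have h3 : 0 ≤ (signedArea (Q b) (Q c) (Q' b) + signedArea (Q b) (Q c) (Q' c)) ^ 2 *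
      (signedArea (Q b) (Q c) (Q a) * signedArea (Q b) (Q c) (Q d)) := by linarith
    have hd : signedArea (Q b) (Q c) (Q d) ≠ 0 := abs_pos.1 (by linarith)
    have hne : signedArea (Q b) (Q c) (Q' b) + signedArea (Q b) (Q c) (Q' c) ≠ 0 := by
      rintro h0
      simp [h0] at h'
    have h4 := nonneg_of_mul_nonneg_right h3 (by positivity)
    exact mul_ne_zero hn hd (le_antisymm hneg h4)

/-- The dyadic interval of length `2 ^ l` starting at `a`, inside `[0, 2 ^ k]`. -/
def DyadicCell (k l a : ℕ) : Prop := 2 ^ l ∣ a ∧ a + 2 ^ l ≤ 2 ^ k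

lemma DyadicCell.left {k l a : ℕ} (h : DyadicCell k (l + 1) a) : DyadicCell k l a :=
  ⟨(pow_dvd_pow 2 l.le_succ).trans h.1, by have := h.2; rw [pow_succ] at this; omega⟩

lemma DyadicCell.right {k l a : ℕ} (h : DyadicCell k (l + 1) a) : DyadicCell k l (a + 2 ^ l) :=
  ⟨Dvd.dvd.add ((pow_dvd_pow 2 l.le_succ).trans h.1) dvd_rfl,
    by have := h.2; rw [pow_succ] at this; omega⟩

/-- A triangle erected over a side `a b` of an inner triangle, and folded onto it, is inside. -/
lemma InTriangle.fold {a q b c x : Plane} (hn : signedArea a q b ≠ 0) (hc : InTriangle a q b c)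
    (hs : 0 < signedArea a c b * signedArea a c x)
    (h1 : Disjoint (segment ℝ a x) (segment ℝ c b))
    (h2 : Disjoint (segment ℝ c x) (segment ℝ a q))
    (h3 : Disjoint (segment ℝ c x) (segment ℝ q b))
    (h4 : Disjoint (segment ℝ c x) (segment ℝ b a)) : InTriangle a c b x :=
  (inTriangle_or_inTriangle hs h1 (segment_symm ℝ b a ▸ h4)).resolve_right
    (InTriangle.not_vertex hn hc (hc.of_disjoint hn h2 h3 h4))

lemma abs_signedArea_swap_right (p q r : Plane) :
    |signedArea p r q| = |signedArea p q r| := by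
  rw [← signedArea_rotate, signedArea_swap, abs_neg, ← signedArea_rotate, ← signedArea_rotate]

section Dyadic

variable {k : ℕ} {A : ℕ → ℕ → Prop} {Q : ℕ → Plane} {κ : ℝ}

/-- In a folded dyadic triangulation, every inner triangle contains a full binary tree of
triangles and has correspondingly large area. -/
lemma le_abs_signedArea_of_folded (hA : ∀ i j, A i j → A j i)
    (hcell : ∀ l a, DyadicCell k l a → A a (a + 2 ^ l))
    (hdis : ∀ i j i' j', A i j → A i' j' → i ≠ i' ∧ i ≠ j' ∧ j ≠ i' ∧ j ≠ j' →
      Disjoint (segment ℝ (Q i) (Q j)) (segment ℝ (Q i') (Q j')))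
    (hκ0 : 0 < κ)
    (hκ : ∀ i j m, A i j → A j m → A i m → κ ≤ |signedArea (Q i) (Q j) (Q m)|)
    (hside : ∀ a b c d, A b c → A c a → A a b → A c d → A d b →
      0 < signedArea (Q b) (Q c) (Q a) * signedArea (Q b) (Q c) (Q d))
    (l : ℕ) : ∀ a q, DyadicCell k (l + 1) a → A a q → A q (a + 2 ^ (l + 1)) →
      (q < a ∨ a + 2 ^ (l + 1) < q) →
      InTriangle (Q a) (Q q) (Q (a + 2 ^ (l + 1))) (Q (a + 2 ^ l)) →
      2 ^ l * κ ≤ |signedArea (Q a) (Q (a + 2 ^ l)) (Q (a + 2 ^ (l + 1)))| := by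
  have hne : ∀ i j m, A i j → A j m → A i m → signedArea (Q i) (Q j) (Q m) ≠ 0 :=
    fun i j m h1 h2 h3 => abs_pos.1 (hκ0.trans_le (hκ i j m h1 h2 h3))
  have hmid : ∀ l a, DyadicCell k (l + 1) a → A (a + 2 ^ l) (a + 2 ^ (l + 1)) := by
    intro l a h
    have := hcell _ _ h.right
    rwa [add_assoc, ← two_mul, ← pow_succ'] at this
  induction l with
  | zero =>
    intro a q h _ _ _ _
    simpa using hκ _ _ _ (hcell _ _ h.left) (hmid _ _ h) (hcell _ _ h)
  | succ l ih =>
    intro a q h haq hqb hq hc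
    have hpos : 0 < 2 ^ l := by positivity
    have e1 : 2 ^ (l + 1) = 2 * 2 ^ l := pow_succ' 2 l
    have e2 : 2 ^ (l + 1 + 1) = 2 * 2 ^ (l + 1) := pow_succ' 2 (l + 1)
    have hab := hcell _ _ h
    have hac := hcell _ _ h.left
    have hcb := hmid _ _ h
    have hax := hcell _ _ h.left.left
    have hxc := hmid _ _ h.left
    have hcy := hcell _ _ h.right.left
    have hyb := hmid _ _ h.right
    have eb : a + 2 ^ (l + 1) + 2 ^ (l + 1) = a + 2 ^ (l + 1 + 1) := by omega
    rw [eb] at hyb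
    have ihx := ih a (a + 2 ^ (l + 1 + 1)) h.left hab (hA _ _ hcb) (by omega)
    have ihy := ih (a + 2 ^ (l + 1)) a h.right (hA _ _ hac) (by rwa [eb]) (by omega)
    rw [eb] at ihy
    generalize hB : a + 2 ^ (l + 1 + 1) = b at *
    generalize hY : a + 2 ^ (l + 1) + 2 ^ l = y at *
    generalize hC : a + 2 ^ (l + 1) = c at *
    generalize hX : a + 2 ^ l = x at *
    have hx : InTriangle (Q a) (Q c) (Q b) (Q x) :=
      InTriangle.fold (hne _ _ _ haq hqb hab) hc
        (hside _ _ _ _ hac hcb (hA _ _ hab) (hA _ _ hxc) (hA _ _ hax))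
        (hdis _ _ _ _ hax hcb (by omega)) (hdis _ _ _ _ (hA _ _ hxc) haq (by omega))
        (hdis _ _ _ _ (hA _ _ hxc) hqb (by omega))
        (hdis _ _ _ _ (hA _ _ hxc) (hA _ _ hab) (by omega))
    have hy : InTriangle (Q b) (Q c) (Q a) (Q y) :=
      InTriangle.fold (hne _ _ _ (hA _ _ hqb) (hA _ _ haq) (hA _ _ hab)) hc.rotate.swap
        (hside _ _ _ _ (hA _ _ hcb) (hA _ _ hac) hab hcy hyb)
        (hdis _ _ _ _ (hA _ _ hyb) (hA _ _ hac) (by omega))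
        (hdis _ _ _ _ hcy (hA _ _ hqb) (by omega))
        (hdis _ _ _ _ hcy (hA _ _ haq) (by omega))
        (hdis _ _ _ _ hcy hab (by omega))
    have key := abs_signedArea_add_le hx hy.rotate.swap
      (hdis _ _ _ _ hax (hA _ _ hyb) (by omega))
      (hdis _ _ _ _ (hA _ _ hxc) (hA _ _ hyb) (by omega))
      (hdis _ _ _ _ hax hcy (by omega))
    have h1 := ihx hx.rotate.rotate.swap
    have h2 := ihy hy.rotate
    rw [abs_signedArea_swap_right] at h1 h2
    rw [pow_succ]
    linarith

/-- A folded dyadic triangulation of depth `l + 2` contains a triangle of area at least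
`2 ^ l * κ`. -/
lemma exists_large_triangle_of_folded {l : ℕ} (hA : ∀ i j, A i j → A j i)
    (hcell : ∀ m a, DyadicCell (l + 2) m a → A a (a + 2 ^ m))
    (hdis : ∀ i j i' j', A i j → A i' j' → i ≠ i' ∧ i ≠ j' ∧ j ≠ i' ∧ j ≠ j' →
      Disjoint (segment ℝ (Q i) (Q j)) (segment ℝ (Q i') (Q j')))
    (hκ0 : 0 < κ)
    (hκ : ∀ i j m, A i j → A j m → A i m → κ ≤ |signedArea (Q i) (Q j) (Q m)|)
    (hside : ∀ a b c d, A b c → A c a → A a b → A c d → A d b →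
      0 < signedArea (Q b) (Q c) (Q a) * signedArea (Q b) (Q c) (Q d)) :
    ∃ i j m, A i j ∧ A i m ∧ 2 ^ l * κ ≤ |signedArea (Q i) (Q j) (Q m)| := by
  have area := le_abs_signedArea_of_folded hA hcell hdis hκ0 hκ hside l
  have hne : ∀ i j m, A i j → A j m → A i m → signedArea (Q i) (Q j) (Q m) ≠ 0 :=
    fun i j m h1 h2 h3 => abs_pos.1 (hκ0.trans_le (hκ i j m h1 h2 h3))
  obtain ⟨a, h⟩ : ∃ a, DyadicCell (l + 2) (l + 2) a := ⟨0, dvd_zero _, by simp⟩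
  have hpos : 0 < 2 ^ l := by positivity
  have e1 : 2 ^ (l + 1) = 2 * 2 ^ l := pow_succ' 2 l
  have e2 : 2 ^ (l + 1 + 1) = 2 * 2 ^ (l + 1) := pow_succ' 2 (l + 1)
  have hmid : ∀ m a, DyadicCell (l + 2) (m + 1) a → A (a + 2 ^ m) (a + 2 ^ (m + 1)) := by
    intro m a h
    have := hcell _ _ h.right
    rwa [add_assoc, ← two_mul, ← pow_succ'] at this
  have hab := hcell _ _ h
  have hac := hcell _ _ h.left
  have hcb := hmid _ _ h
  have hax := hcell _ _ h.left.left
  have hxc := hmid _ _ h.left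
  have hcy := hcell _ _ h.right.left
  have hyb := hmid _ _ h.right
  have eb : a + 2 ^ (l + 1) + 2 ^ (l + 1) = a + 2 ^ (l + 1 + 1) := by omega
  rw [eb] at hyb
  have ihx := area a (a + 2 ^ (l + 1 + 1)) h.left hab (hA _ _ hcb) (by omega)
  have ihy := area (a + 2 ^ (l + 1)) a h.right (hA _ _ hac) (by rwa [eb]) (by omega)
  rw [eb] at ihy
  change A a (a + 2 ^ (l + 1 + 1)) at hab
  generalize hB : a + 2 ^ (l + 1 + 1) = b at *
  generalize hY : a + 2 ^ (l + 1) + 2 ^ l = y at *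
  generalize hC : a + 2 ^ (l + 1) = c at *
  generalize hX : a + 2 ^ l = x at *
  have hx := inTriangle_or_inTriangle
    (hside _ _ _ _ hac hcb (hA _ _ hab) (hA _ _ hxc) (hA _ _ hax))
    (hdis _ _ _ _ hax hcb (by omega)) (hdis _ _ _ _ (hA _ _ hxc) hab (by omega))
  have hy := inTriangle_or_inTriangle
    (hside _ _ _ _ (hA _ _ hcb) (hA _ _ hac) hab hcy hyb)
    (hdis _ _ _ _ (hA _ _ hyb) (hA _ _ hac) (by omega))
    (hdis _ _ _ _ hcy (hA _ _ hab) (by omega))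
  rcases hx with hx | hx
  · exact ⟨a, x, c, hax, hac, ihx hx.rotate.rotate.swap⟩
  rcases hy with hy | hy
  · exact ⟨c, y, b, hcy, hcb, ihy hy.rotate⟩
  exfalso
  have hn := hne _ _ _ (hA _ _ hxc) (hA _ _ hax) (hA _ _ hac)
  refine InTriangle.not_vertex hn hx.rotate (hx.rotate.of_disjoint hn
    (hdis _ _ _ _ (hA _ _ hyb) (hA _ _ hxc) (by omega))
    (hdis _ _ _ _ (hA _ _ hyb) (hA _ _ hax) (by omega))
    (hdis _ _ _ _ (hA _ _ hyb) hac (by omega))) hy.swap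

end Dyadic

/-- Among sufficiently many bounded configurations, two are close to each other. -/
lemma exists_close_configurations (ι : Type) [Fintype ι] (R : ℝ) {δ : ℝ} (hδ : 0 < δ) :
    ∃ N : ℕ, ∀ F : Fin N → ι → Plane, (∀ t i, ‖F t i‖ ≤ R) →
      ∃ t t', t ≠ t' ∧ ∀ i, dist (F t i) (F t' i) ≤ δ := by
  have hR : (0 : ℝ) ≤ max R 0 := le_max_right _ _
  obtain ⟨T, hT, hcover⟩ := Metric.totallyBounded_iff.1
    (isCompact_closedBall (0 : ι → Plane) (max R 0)).totallyBounded (δ / 2) (by positivity)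
  refine ⟨hT.toFinset.card + 1, fun F hF => ?_⟩
  have hmem : ∀ t, ∃ c : hT.toFinset, dist (F t) c < δ / 2 := by
    intro t
    have : F t ∈ Metric.closedBall (0 : ι → Plane) (max R 0) := by
      rw [mem_closedBall_zero_iff, pi_norm_le_iff_of_nonneg hR]
      exact fun i => (hF t i).trans (le_max_left _ _)
    obtain ⟨c, hc, hd⟩ := Set.mem_iUnion₂.1 (hcover this)
    exact ⟨⟨c, hT.mem_toFinset.2 hc⟩, hd⟩
  choose f hf using hmem
  obtain ⟨t, t', hne, heq⟩ := Fintype.exists_ne_map_eq_of_card_lt f (by simp)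
  refine ⟨t, t', hne, fun i => (dist_le_pi_dist _ _ i).trans ?_⟩
  have h1 := hf t
  have h2 := hf t'
  rw [← heq] at h2
  linarith [dist_triangle_right (F t) (F t') (f t)]

/-- The edges of a row of dyadic triangulations of depth `k`, together with the edges from the
vertex `0` to the ends of all of them. -/
def FanRel (k i j : ℕ) : Prop := (i = 0 ∧ 2 ^ k ∣ j) ∨ ∃ l ≤ k, 2 ^ l ∣ i ∧ j = i + 2 ^ l

/-- A row of dyadic triangulations of depth `k` on the vertices `0, …, M`, joined to `0`. -/
def fanGraph (k M : ℕ) : SimpleGraph (Fin (M + 1)) :=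
  SimpleGraph.fromRel fun i j => FanRel k i j

lemma not_strictly_between_multiples {d i j : ℕ} (hi : d ∣ i) (hj : d ∣ j) (h1 : i < j)
    (h2 : j < i + d) : False := by
  obtain ⟨m, rfl⟩ := hi
  obtain ⟨n, rfl⟩ := hj
  have h3 := Nat.lt_of_mul_lt_mul_left h1
  have h4 : d * n < d * (m + 1) := by rw [mul_add, mul_one]; exact h2
  have h5 := Nat.lt_of_mul_lt_mul_left h4
  omega

lemma FanRel.not_interleaved {k i j i' j' : ℕ} (h : FanRel k i j) (h' : FanRel k i' j')
    (h1 : i < i') (h2 : i' < j) (h3 : j < j') : False := by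
  rcases h' with ⟨rfl, -⟩ | ⟨l', hl', hi', rfl⟩
  · omega
  rcases h with ⟨rfl, hj⟩ | ⟨l, hl, hi, rfl⟩
  · exact not_strictly_between_multiples hi' ((pow_dvd_pow 2 hl').trans hj) h2 h3
  · rcases le_total l l' with hll | hll
    · exact not_strictly_between_multiples hi ((pow_dvd_pow 2 hll).trans hi') h1 h2
    · exact not_strictly_between_multiples hi' ((pow_dvd_pow 2 hll).trans (hi.add dvd_rfl)) h2 h3

lemma FanRel.le {k i j : ℕ} (h : FanRel k i j) : i ≤ j := by
  rcases h with ⟨rfl, -⟩ | ⟨l, -, -, rfl⟩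
  · exact Nat.zero_le _
  · exact Nat.le_add_right _ _

lemma FanRel.noncrossing {k i j i' j' : ℕ} (h : FanRel k i j) (h' : FanRel k i' j')
    (hij : i ≠ j) (hij' : i' ≠ j') (h1 : i ≠ i') (h2 : i ≠ j') (h3 : j ≠ i') (h4 : j ≠ j') :
    0 < ((i' : ℝ) - i) * (i' - j) * ((j' - i) * (j' - j)) := by
  have a1 := lt_of_le_of_ne h.le hij
  have a2 := lt_of_le_of_ne h'.le hij'
  have n1 := h.not_interleaved h'
  have n2 := h'.not_interleaved h
  have pos : ∀ {m n : ℕ}, m < n → (0 : ℝ) < (n : ℝ) - m := fun hmn => by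
    have : ((_ : ℕ) : ℝ) < _ := Nat.cast_lt.2 hmn
    linarith
  rcases lt_or_gt_of_ne h1 with b1 | b1
  · rcases lt_or_gt_of_ne h3 with b3 | b3
    · exact mul_pos (mul_pos (pos b1) (pos b3))
        (mul_pos (pos (b1.trans a2)) (pos (b3.trans a2)))
    · have b4 : j' < j := by
        by_contra hcon
        exact n1 b1 b3 (by omega)
      have := mul_pos (mul_pos (pos b1) (pos b3)) (mul_pos (pos (b1.trans a2)) (pos b4))
      linarith
  · have b3 : i' < j := b1.trans a1
    rcases lt_or_gt_of_ne h2 with b2 | b2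
    · have b4 : j < j' := by
        by_contra hcon
        exact n2 b1 b2 (by omega)
      have := mul_pos (mul_pos (pos b1) (pos b3)) (mul_pos (pos b2) (pos b4))
      linarith
    · have := mul_pos (mul_pos (pos b1) (pos b3)) (mul_pos (pos b2) (pos (b2.trans a1)))
      linarith

lemma isOuterplanar_fanGraph (k M : ℕ) : IsOuterplanar (fanGraph k M) := by
  refine isOuterplanar_of_noncrossing _ (fun v => ((v : ℕ) : ℝ))
    (fun u v h => Fin.ext (Nat.cast_injective h)) ?_
  intro u v x y huv hxy hux huy hvx hvy
  simp only [fanGraph, SimpleGraph.fromRel_adj] at huv hxy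
  obtain ⟨hne, huv⟩ := huv
  obtain ⟨hne', hxy⟩ := hxy
  rw [Ne, Fin.ext_iff] at *
  rcases huv with h | h <;> rcases hxy with h' | h'
  · exact h.noncrossing h' hne hne' hux huy hvx hvy
  · have := h.noncrossing h' hne (Ne.symm hne') huy hux hvy hvx
    linarith
  · have := h.noncrossing h' (Ne.symm hne) hne' hvx hvy hux huy
    linarith
  · have := h.noncrossing h' (Ne.symm hne) (Ne.symm hne') hvy hvx huy hux
    linarith

/-- In every planar drawing of a sufficiently large fan of dyadic triangulations, the edge lengths
do not all lie in an interval `[s, (2 - ε) * s]`. -/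
lemma exists_fanGraph_not_short {ε : ℝ} (hε : 0 < ε) :
    ∃ k M : ℕ, (fanGraph k M).Adj 0 (Fin.ofNat (M + 1) 1) ∧
      ∀ ρ : Fin (M + 1) → Plane, IsPlanarDrawing (fanGraph k M) ρ → ∀ s : ℝ, 0 < s →
        ¬ ∀ u v, (fanGraph k M).Adj u v → s ≤ dist (ρ u) (ρ v) ∧
          dist (ρ u) (ρ v) ≤ (2 - ε) * s := by
  set κ : ℝ := ε ^ 2 / 2 with hκdef
  have hκ0 : 0 < κ := by positivity
  obtain ⟨l, hl⟩ : ∃ l : ℕ, 4 / κ < 2 ^ l := pow_unbounded_of_one_lt _ (by norm_num)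
  rw [div_lt_iff₀ hκ0] at hl
  set k := l + 2 with hk
  obtain ⟨N, hN⟩ := exists_close_configurations (Fin (2 ^ k + 1)) (2 * (2 ^ k + 1))
    (δ := κ / 8) (by positivity)
  set M := (2 * N + 1) * 2 ^ k with hM
  have hKpos : 0 < 2 ^ k := by positivity
  have hMpos : 1 ≤ M := Nat.mul_pos (by omega) hKpos
  have hval : ∀ {n : ℕ}, n ≤ M → ((Fin.ofNat (M + 1) n : Fin (M + 1)) : ℕ) = n :=
    fun hn => Nat.mod_eq_of_lt (by omega)
  have hadj : ∀ {i j : ℕ}, i ≤ M → j ≤ M → i ≠ j → FanRel k i j →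
      (fanGraph k M).Adj (Fin.ofNat (M + 1) i) (Fin.ofNat (M + 1) j) := by
    intro i j hi hj hij h
    rw [fanGraph, SimpleGraph.fromRel_adj, Ne, Fin.ext_iff, hval hi, hval hj]
    exact ⟨hij, .inl h⟩
  refine ⟨k, M, hadj (Nat.zero_le _) hMpos zero_ne_one
    (.inr ⟨0, by omega, by simp, by simp⟩), ?_⟩
  intro ρ hρ s hs hlen
  let f : Fin N → ℕ → ℕ := fun t i => (2 * t + 1) * 2 ^ k + i
  have hf : ∀ t i, i ≤ 2 ^ k → f t i ≤ M := by
    intro t i hi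
    have : (2 * (t : ℕ) + 1 + 1) * 2 ^ k ≤ (2 * N + 1) * 2 ^ k :=
      Nat.mul_le_mul_right _ (by omega)
    rw [add_mul, one_mul] at this
    simp only [f]
    omega
  have hfne : ∀ t t', t ≠ t' → ∀ i i', i ≤ 2 ^ k → i' ≤ 2 ^ k → f t i ≠ f t' i' := by
    have aux : ∀ t t' : Fin N, t < t' → ∀ i i', i ≤ 2 ^ k → f t i < f t' i' := by
      intro t t' h i i' hi
      have h' : (t : ℕ) < t' := h
      have : (2 * (t : ℕ) + 1 + 2) * 2 ^ k ≤ (2 * t' + 1) * 2 ^ k :=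
        Nat.mul_le_mul_right _ (by omega)
      rw [add_mul _ 2] at this
      simp only [f]
      omega
    intro t t' h i i' hi hi'
    rcases lt_or_gt_of_ne h with h | h
    · exact (aux t t' h i i' hi).ne
    · exact (aux t' t h i' i hi').ne'
  let Q : Fin N → ℕ → Plane := fun t i => ρ (Fin.ofNat (M + 1) (f t i))
  let A : ℕ → ℕ → Prop := fun i j => i ≤ 2 ^ k ∧ j ≤ 2 ^ k ∧
    ((∃ m, DyadicCell k m i ∧ j = i + 2 ^ m) ∨ ∃ m, DyadicCell k m j ∧ i = j + 2 ^ m)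
  have hA : ∀ i j, A i j → A j i := fun i j h => ⟨h.2.1, h.1, h.2.2.symm⟩
  have hcell : ∀ m a, DyadicCell k m a → A a (a + 2 ^ m) :=
    fun m a h => ⟨(Nat.le_add_right _ _).trans h.2, h.2, .inl ⟨m, h, rfl⟩⟩
  have hcelladj : ∀ t m a, DyadicCell k m a → (fanGraph k M).Adj
      (Fin.ofNat (M + 1) (f t a)) (Fin.ofNat (M + 1) (f t (a + 2 ^ m))) := by
    intro t m a h
    have hmpos : 0 < 2 ^ m := by positivity
    have hmk : m ≤ k := (Nat.pow_le_pow_iff_right one_lt_two).1 (by have := h.2; omega)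
    refine hadj (hf _ _ (by have := h.2; omega)) (hf _ _ h.2) (by simp only [f]; omega)
      (.inr ⟨m, hmk, ?_, by simp only [f]; omega⟩)
    exact (Dvd.dvd.mul_left (pow_dvd_pow 2 hmk) _).add h.1
  have hAadj : ∀ t i j, A i j → (fanGraph k M).Adj
      (Fin.ofNat (M + 1) (f t i)) (Fin.ofNat (M + 1) (f t j)) := by
    rintro t i j ⟨-, -, ⟨m, h, rfl⟩ | ⟨m, h, rfl⟩⟩
    · exact hcelladj t m i h
    · exact (hcelladj t m j h).symm
  have hneq : ∀ t t' i j, i ≤ 2 ^ k → j ≤ 2 ^ k → (t ≠ t' ∨ i ≠ j) →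
      (Fin.ofNat (M + 1) (f t i)) ≠ Fin.ofNat (M + 1) (f t' j) := by
    intro t t' i j hi hj h
    rw [Ne, Fin.ext_iff, hval (hf _ _ hi), hval (hf _ _ hj)]
    by_cases htt : t = t'
    · subst htt
      have := h.resolve_left (fun h => h rfl)
      simp only [f]
      omega
    · exact hfne _ _ htt _ _ hi hj
  have hdis : ∀ t t' i j i' j', A i j → A i' j' →
      (t ≠ t' ∨ i ≠ i' ∧ i ≠ j' ∧ j ≠ i' ∧ j ≠ j') →
      Disjoint (segment ℝ (Q t i) (Q t j)) (segment ℝ (Q t' i') (Q t' j')) := by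
    intro t t' i j i' j' h h' hne
    exact hρ.disjoint_segment (hAadj t _ _ h) (hAadj t' _ _ h')
      (hneq _ _ _ _ h.1 h'.1 (hne.imp_right fun h => h.1))
      (hneq _ _ _ _ h.1 h'.2.1 (hne.imp_right fun h => h.2.1))
      (hneq _ _ _ _ h.2.1 h'.1 (hne.imp_right fun h => h.2.2.1))
      (hneq _ _ _ _ h.2.1 h'.2.1 (hne.imp_right fun h => h.2.2.2))
  have hlen2 : ∀ u v, (fanGraph k M).Adj u v → dist (ρ u) (ρ v) ≤ 2 * s :=
    fun u v h => (hlen u v h).2.trans (by nlinarith)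
  have hbound : ∀ t i, i ≤ 2 ^ k → dist (Q t i) (ρ 0) ≤ (i + 1) * (2 * s) := by
    intro t i
    induction i with
    | zero =>
      intro _
      have h := hlen2 _ _ (hadj (i := 0) (j := f t 0) (Nat.zero_le _) (hf _ _ (Nat.zero_le _))
        (by simp only [f]; positivity) (.inl ⟨rfl, by simp only [f]; simp⟩))
      rw [dist_comm] at h
      rw [Nat.cast_zero, zero_add, one_mul]
      exact h
    | succ i ih =>
      intro hi
      have h1 := ih (by omega)
      have h2 := hlen2 _ _ (hcelladj t 0 i ⟨by simp, by simpa using hi⟩)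
      have h3 := dist_triangle_left (Q t (i + 1)) (ρ 0) (Q t i)
      rw [pow_zero] at h2
      push_cast
      change dist (Q t i) (Q t (i + 1)) ≤ _ at h2
      linarith
  obtain ⟨t, t', htt, hclose⟩ := hN (fun t i => s⁻¹ • (Q t i - ρ 0)) (by
    intro t i
    have hi : (i : ℕ) ≤ 2 ^ k := by omega
    rw [norm_smul, norm_inv, Real.norm_of_nonneg hs.le, ← dist_eq_norm, inv_mul_le_iff₀ hs]
    have h1 := hbound t i hi
    have h2 : ((i : ℕ) : ℝ) ≤ 2 ^ k := by exact_mod_cast hi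
    nlinarith)
  have hclose' : ∀ i j, A i j → dist (Q t i) (Q t' i) ≤ κ / 8 * s := by
    intro i j h
    have := hclose ⟨i, by have := h.1; omega⟩
    rw [dist_smul₀, dist_sub_right, norm_inv, Real.norm_of_nonneg hs.le, inv_mul_le_iff₀ hs]
      at this
    linarith
  have hκ : ∀ i j m, A i j → A j m → A i m →
      κ * s ^ 2 ≤ |signedArea (Q t i) (Q t j) (Q t m)| := by
    intro i j m h1 h2 h3
    obtain ⟨a1, b1⟩ := hlen _ _ (hAadj t _ _ h1)
    obtain ⟨a2, b2⟩ := hlen _ _ (hAadj t _ _ h2)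
    obtain ⟨a3, b3⟩ := hlen _ _ (hAadj t _ _ h3)
    exact le_abs_signedArea hε hs a1 a2 a3 b1 b2 b3
  have hAlen : ∀ i j, A i j → dist (Q t i) (Q t j) ≤ 2 * s :=
    fun i j h => hlen2 _ _ (hAadj t _ _ h)
  have hδ : 2 * (2 * s * (κ / 8 * s)) < κ * s ^ 2 := by
    have : 0 < κ * s ^ 2 := by positivity
    linarith
  obtain ⟨i, j, m, hij, him, hbig⟩ := exists_large_triangle_of_folded (Q := Q t) (l := l) hA hcell
    (fun i j i' j' h h' hne => hdis t t i j i' j' h h' (.inr hne)) (by positivity) hκ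
    (fun a b c d hbc hca hab hcd hdb => same_side_of_close hA hδ hAlen hclose' hκ
      (fun i j i' j' h h' => hdis t' t i' j' i j h' h (.inl (Ne.symm htt))) hbc hca hab hcd hdb)
  have h1 := abs_signedArea_le (Q t i) (Q t j) (Q t m)
  have h2 := mul_le_mul (hAlen _ _ hij) (hAlen _ _ (hA _ _ him)) dist_nonneg (by positivity)
  nlinarith [mul_lt_mul_of_pos_right hl (pow_pos hs 2)]

/-- For every ε > 0 there is an outerplanar finite simple graph with at least
one edge all of whose planar straight-line drawings have edge-length ratio greater than
2 − ε. -/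
theorem exists_outerplanar_ratio_gt {ε : ℝ} (hε : 0 < ε) :
    ∃ (V : Type) (_ : Fintype V) (G : SimpleGraph V),
      IsOuterplanar G ∧ (∃ u v : V, G.Adj u v) ∧
      ∀ ρ : V → Plane, IsPlanarDrawing G ρ → 2 - ε < edgeLengthRatio G ρ := by
  obtain ⟨k, M, hadj, hnot⟩ := exists_fanGraph_not_short hε
  refine ⟨Fin (M + 1), inferInstance, fanGraph k M, isOuterplanar_fanGraph k M, ⟨_, _, hadj⟩, ?_⟩
  intro ρ hρ
  by_contra! hle
  set D : Set ℝ := {d : ℝ | ∃ u v, (fanGraph k M).Adj u v ∧ d = dist (ρ u) (ρ v)} with hD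
  have hfin : D.Finite := by
    refine (Set.finite_range fun p : Fin (M + 1) × Fin (M + 1) => dist (ρ p.1) (ρ p.2)).subset ?_
    rintro d ⟨u, v, -, rfl⟩
    exact ⟨(u, v), rfl⟩
  have hne : D.Nonempty := ⟨_, _, _, hadj, rfl⟩
  have hpos : 0 < sInf D := by
    obtain ⟨u, v, huv, h⟩ := hne.csInf_mem hfin
    rw [h]
    exact dist_pos.2 (hρ.1.ne huv.ne)
  rw [edgeLengthRatio, ← hD, div_le_iff₀ hpos] at hle
  exact hnot ρ hρ _ hpos fun u v huv =>
    ⟨csInf_le hfin.bddBelow ⟨u, v, huv, rfl⟩, (le_csSup hfin.bddAbove ⟨u, v, huv, rfl⟩).trans hle⟩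
end
end
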